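/- arXiv:2402.13451 — 2 statements merged into one kernel-verified Lean document; each statement's English description precedes it below -/
import Mathlib

section
/- For every integer n ≥ 2, the Folklore set FS_{n,n} of n×n matrices with respect to the maximum norms satisfies dim_H FS_{n,n} ≥ (n−1)² + 1; moreover, the matrices can be chosen invertible (of full ℝ-rank n). -/
open Filter MeasureTheory
open scoped ENNReal

/-- `ψ_Ω(t)` for `Ω ∈ ℝ^{n×n}` with respect to the maximum norms: the minimum of
`‖Ω·b̂ + b̃‖_∞` over integer vectors `b = (b̂,b̃) ∈ ℤⁿ×ℤⁿ` with `1 ≤ ‖b̂‖_∞ ≤ t`. -/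
noncomputable def psiMax (n : ℕ) (Ω : Fin n → Fin n → ℝ) (t : ℝ) : ℝ :=
  sInf { r : ℝ | ∃ (bh : Fin n → ℤ) (bt : Fin n → ℤ),
    (∃ i, bh i ≠ 0) ∧ (∀ i, |(bh i : ℝ)| ≤ t) ∧
    r = ⨆ j, |(∑ i, Ω j i * (bh i : ℝ)) + (bt j : ℝ)| }

/-- `Θ(Ω) = limsup_{t→∞} t·ψ_Ω(t)`. -/
noncomputable def ThetaMax (n : ℕ) (Ω : Fin n → Fin n → ℝ) : ℝ :=
  limsup (fun t : ℝ => t * psiMax n Ω t) atTop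

/-- `Θ̃(Ω) = liminf_{t→∞} t·ψ_Ω(t)`. -/
noncomputable def ThetaTildeMax (n : ℕ) (Ω : Fin n → Fin n → ℝ) : ℝ :=
  liminf (fun t : ℝ => t * psiMax n Ω t) atTop

/-- `FS_{n,n} = Di_{n,n} \ (Bad_{n,n} ∪ Sing_{n,n})` with respect to maximum norms. -/
def FSmax (n : ℕ) : Set (Fin n → Fin n → ℝ) :=
  {Ω | ThetaMax n Ω < 1} \
    ({Ω | 0 < ThetaTildeMax n Ω} ∪ {Ω | ThetaMax n Ω = 0})

lemma psiMax_nonneg (n : ℕ) (Ω : Fin n → Fin n → ℝ) (t : ℝ) : 0 ≤ psiMax n Ω t := by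
  refine Real.sInf_nonneg ?_
  rintro _ ⟨bh, bt, -, -, rfl⟩
  exact Real.iSup_nonneg fun _ => abs_nonneg _

lemma psiMax_le {n : ℕ} {Ω : Fin n → Fin n → ℝ} {t δ : ℝ} (bh bt : Fin n → ℤ)
    (h0 : ∃ i, bh i ≠ 0) (ht : ∀ i, |(bh i : ℝ)| ≤ t)
    (hδ : ∀ j, |(∑ i, Ω j i * (bh i : ℝ)) + (bt j : ℝ)| ≤ δ) : psiMax n Ω t ≤ δ := by
  obtain ⟨i₀, hi₀⟩ := h0
  have : Nonempty (Fin n) := ⟨i₀⟩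
  unfold psiMax
  refine le_trans (csInf_le ⟨0, ?_⟩ ⟨bh, bt, ⟨i₀, hi₀⟩, ht, rfl⟩) (ciSup_le hδ)
  rintro _ ⟨bh, bt, -, -, rfl⟩
  exact Real.iSup_nonneg fun _ => abs_nonneg _

lemma le_psiMax {n : ℕ} (hn : 0 < n) {Ω : Fin n → Fin n → ℝ} {t δ : ℝ} (ht : 1 ≤ t)
    (h : ∀ bh bt : Fin n → ℤ, (∃ i, bh i ≠ 0) → (∀ i, |(bh i : ℝ)| ≤ t) →
      ∃ j, δ ≤ |(∑ i, Ω j i * (bh i : ℝ)) + (bt j : ℝ)|) : δ ≤ psiMax n Ω t := by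
  refine le_csInf ⟨_, fun _ => 1, fun _ => 0, ⟨⟨0, hn⟩, one_ne_zero⟩, fun _ => by simpa using ht, rfl⟩ ?_
  rintro _ ⟨bh, bt, h0, hb, rfl⟩
  obtain ⟨j, hj⟩ := h bh bt h0 hb
  exact hj.trans (le_ciSup (f := fun j => |(∑ i, Ω j i * (bh i : ℝ)) + (bt j : ℝ)|)
    (Set.finite_range _).bddAbove j)

lemma psiMax_add_intCast {n : ℕ} (Ω : Fin n → Fin n → ℝ) (M : Fin n → Fin n → ℤ) (t : ℝ) :
    psiMax n (fun j i => Ω j i + M j i) t = psiMax n Ω t := by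
  unfold psiMax
  congr 1
  ext r
  constructor
  · rintro ⟨bh, bt, h0, hb, rfl⟩
    refine ⟨bh, fun j => ∑ i, M j i * bh i + bt j, h0, hb, ?_⟩
    push_cast
    simp only [add_mul, Finset.sum_add_distrib, add_assoc]
  · rintro ⟨bh, bt, h0, hb, rfl⟩
    refine ⟨bh, fun j => bt j - ∑ i, M j i * bh i, h0, hb, ?_⟩
    push_cast
    simp only [add_mul, Finset.sum_add_distrib, add_assoc, add_sub_cancel]

lemma add_intCast_mem_FSmax {n : ℕ} {Ω : Fin n → Fin n → ℝ} (hΩ : Ω ∈ FSmax n)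
    (M : Fin n → Fin n → ℤ) : (fun j i => Ω j i + M j i) ∈ FSmax n := by
  simpa only [FSmax, ThetaMax, ThetaTildeMax, Set.mem_sdiff, Set.mem_union, Set.mem_ofPred_eq,
    psiMax_add_intCast] using hΩ

lemma exists_mem_FSmax_det_ne_zero {n : ℕ} {Ω : Fin n → Fin n → ℝ} (hΩ : Ω ∈ FSmax n) :
    ∃ Ω' ∈ FSmax n, (Matrix.of Ω').det ≠ 0 := by
  obtain ⟨k, hk⟩ : ∃ k : ℕ, ¬ (Matrix.charpoly (-Matrix.of Ω)).IsRoot (k : ℝ) := by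
    by_contra! h
    refine Set.infinite_range_of_injective (Nat.cast_injective (R := ℝ))
      ((Polynomial.finite_setOfPred_isRoot (Matrix.charpoly_monic (-Matrix.of Ω)).ne_zero).subset ?_)
    rintro _ ⟨k, rfl⟩
    exact h k
  refine ⟨_, add_intCast_mem_FSmax hΩ fun j i => if j = i then k else 0, ?_⟩
  rw [Polynomial.IsRoot, Matrix.eval_charpoly] at hk
  convert hk using 2
  ext j i
  simp only [Matrix.scalar_apply, Matrix.sub_apply, Matrix.neg_apply, Matrix.of_apply,
    Matrix.diagonal_apply]
  split_ifs <;> simp [add_comm]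

lemma sqrt_five_bounds : 2.236 < √(5 : ℝ) ∧ √(5 : ℝ) < 2.2362 := by
  constructor
  · exact Real.lt_sqrt_of_sq_lt (by norm_num)
  · rw [Real.sqrt_lt' (by norm_num)]
    norm_num

lemma fib_succ_mul_abs_goldenConj_pow_le {k : ℕ} (hk : 1 ≤ k) :
    (Nat.fib (k + 1) : ℝ) * |Real.goldenConj| ^ k ≤ 9 / 10 := by
  obtain ⟨h1, h2⟩ := sqrt_five_bounds
  have hψ : |Real.goldenConj| ≤ 0.6181 := by
    rw [abs_of_neg Real.goldenConj_neg, Real.goldenConj]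
    linarith
  have hφ : Real.goldenRatio ≤ 1.6181 := by
    rw [Real.goldenRatio]
    linarith
  have hu0 : 0 ≤ |Real.goldenConj| ^ k := by positivity
  have hu : |Real.goldenConj| ^ k ≤ 0.6181 :=
    (pow_le_of_le_one (abs_nonneg _) (hψ.trans (by norm_num)) (by omega)).trans hψ
  have huv : Real.goldenRatio ^ k * |Real.goldenConj| ^ k = 1 := by
    rw [← mul_pow, ← abs_of_pos Real.goldenRatio_pos, ← abs_mul,
      Real.goldenRatio_mul_goldenConj]
    simp
  have hx : |Real.goldenConj * Real.goldenConj ^ k| ≤ 0.6181 * 0.6181 := by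
    rw [abs_mul, abs_pow]
    exact mul_le_mul hψ hu hu0 (by norm_num)
  have hy : |Real.goldenConj * Real.goldenConj ^ k * |Real.goldenConj| ^ k|
      ≤ 0.6181 * 0.6181 * 0.6181 := by
    rw [abs_mul, abs_of_nonneg hu0]
    exact mul_le_mul hx hu hu0 (by norm_num)
  rw [Real.coe_fib_eq, div_mul_eq_mul_div, div_le_iff₀ (by positivity), sub_mul, pow_succ',
    pow_succ', mul_assoc Real.goldenRatio, huv]
  have := neg_abs_le (Real.goldenConj * Real.goldenConj ^ k * |Real.goldenConj| ^ k)
  linarith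

lemma one_div_le_abs_goldenRatio_mul_add {t : ℝ} (ht : 1 ≤ t) {q : ℤ} (p : ℤ) (hq : q ≠ 0)
    (hqt : |(q : ℝ)| ≤ t) : 1 / (4 * t) ≤ |Real.goldenRatio * q + p| := by
  obtain ⟨h1, h2⟩ := sqrt_five_bounds
  have hirr : ∀ x : ℝ, Irrational x → x * q + p ≠ 0 := by
    intro x hx h0
    exact ((hx.mul_intCast hq).add_intCast p).ne_zero h0
  have hnorm : (Real.goldenRatio * q + p) * (Real.goldenConj * q + p)
      = ((p ^ 2 + p * q - q ^ 2 : ℤ) : ℝ) := by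
    push_cast
    linear_combination (q : ℝ) ^ 2 * Real.goldenRatio_mul_goldenConj
      + (p : ℝ) * q * Real.goldenRatio_add_goldenConj
  have hprod : 1 ≤ |Real.goldenRatio * q + p| * |Real.goldenConj * q + p| := by
    have hne := mul_ne_zero (hirr _ Real.goldenRatio_irrational)
      (hirr _ Real.goldenConj_irrational)
    rw [← abs_mul, hnorm]
    rw [hnorm] at hne
    exact_mod_cast Int.one_le_abs (by exact_mod_cast hne)
  by_contra! hlt
  have hdiff : Real.goldenConj * q + p = (Real.goldenRatio * q + p) - √5 * q := by
    linear_combination (-(q : ℝ)) * Real.goldenRatio_sub_goldenConj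
  have hle : |Real.goldenConj * q + p| ≤ 4 * t := by
    have h3 := abs_sub (Real.goldenRatio * q + p) (√5 * q)
    rw [← hdiff, abs_mul, abs_of_pos (by positivity : (0 : ℝ) < √5)] at h3
    have h4 : 1 / (4 * t) ≤ 1 := by
      rw [div_le_one (by positivity)]
      linarith
    have h5 : √5 * |(q : ℝ)| ≤ 2.2362 * t := by gcongr
    linarith
  have : |Real.goldenRatio * q + p| * |Real.goldenConj * q + p| < 1 / (4 * t) * (4 * t) :=
    mul_lt_mul_of_lt_of_le_of_nonneg_of_pos hlt hle (abs_nonneg _) (by positivity)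
  rw [one_div_mul_cancel (by positivity)] at this
  linarith

/-- The `(m+1) × (m+1)` matrix with first column `(φ, 0, …, 0)` and the other columns given by
`X`. -/
noncomputable def goldenExtend (m : ℕ) (X : Fin (m + 1) × Fin m → ℝ) :
    Fin (m + 1) → Fin (m + 1) → ℝ :=
  fun j => Fin.cons (if j = 0 then Real.goldenRatio else 0) fun i => X (j, i)

lemma goldenExtend_sum (m : ℕ) (X : Fin (m + 1) × Fin m → ℝ) (b : Fin (m + 1) → ℝ)
    (j : Fin (m + 1)) : ∑ i, goldenExtend m X j i * b i =
      (if j = 0 then Real.goldenRatio else 0) * b 0 + ∑ i, X (j, i) * b i.succ := by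
  simp [goldenExtend, Fin.sum_univ_succ]

lemma goldenExtend_mul_psiMax_le (m : ℕ) (X : Fin (m + 1) × Fin m → ℝ) {t : ℝ} (ht : 1 ≤ t) :
    t * psiMax (m + 1) (goldenExtend m X) t ≤ 9 / 10 := by
  set k := Nat.greatestFib ⌊t⌋₊ with hk
  have hN : 1 ≤ ⌊t⌋₊ := Nat.one_le_floor_iff t |>.2 ht
  have hk1 : 1 ≤ k := Nat.greatestFib_pos.2 hN
  have hle : (Nat.fib k : ℝ) ≤ t :=
    (Nat.cast_le.2 (Nat.fib_greatestFib_le _)).trans (Nat.floor_le (by linarith))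
  have hlt : t ≤ Nat.fib (k + 1) :=
    (Nat.lt_floor_add_one t).le.trans
      (by exact_mod_cast Nat.succ_le_of_lt (Nat.lt_fib_greatestFib_add_one _))
  have hpsi : psiMax (m + 1) (goldenExtend m X) t ≤ |Real.goldenConj| ^ k := by
    refine psiMax_le (Fin.cons (Nat.fib k : ℤ) fun _ => 0)
      (Fin.cons (-(Nat.fib (k + 1) : ℤ)) fun _ => 0) ⟨0, ?_⟩ ?_ ?_
    · simpa using (Nat.fib_pos.2 hk1).ne'
    · intro i
      refine Fin.cases ?_ (fun i => ?_) i
      · simpa using hle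
      · simpa using by linarith
    · intro j
      rw [goldenExtend_sum]
      refine Fin.cases ?_ (fun j => ?_) j
      · have h := Real.fib_succ_sub_goldenRatio_mul_fib k
        rw [← abs_pow, ← h, abs_sub_comm]
        simp [sub_eq_add_neg]
      · simp
  calc t * psiMax (m + 1) (goldenExtend m X) t
      ≤ Nat.fib (k + 1) * |Real.goldenConj| ^ k :=
        mul_le_mul hlt hpsi (psiMax_nonneg _ _ _) (by positivity)
    _ ≤ 9 / 10 := fib_succ_mul_abs_goldenConj_pow_le hk1

lemma goldenExtend_mem_FSmax {m : ℕ} {X : Fin (m + 1) × Fin m → ℝ} {c : ℝ} (hc : 0 < c)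
    (hnonsing : ∃ᶠ t : ℕ in atTop, ∀ b p : Fin m → ℤ, b ≠ 0 → (∀ i, |b i| ≤ t) →
      ∃ j : Fin m, c / t ≤ |(∑ i, X (j.succ, i) * (b i : ℝ)) + (p j : ℝ)|)
    (hnotbad : ∀ ε > 0, ∀ T₀ : ℕ, ∃ T ≥ T₀, ∃ bh bt : Fin (m + 1) → ℤ,
      (∃ i, bh i ≠ 0) ∧ (∀ i, |bh i| ≤ T) ∧
      ∀ j, |(∑ i, goldenExtend m X j i * (bh i : ℝ)) + (bt j : ℝ)| < ε / T) :
    goldenExtend m X ∈ FSmax (m + 1) := by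
  have hle : ∀ᶠ t : ℝ in atTop, t * psiMax (m + 1) (goldenExtend m X) t ≤ 9 / 10 := by
    filter_upwards [eventually_ge_atTop 1] with t ht using goldenExtend_mul_psiMax_le m X ht
  have hge : ∀ᶠ t : ℝ in atTop, 0 ≤ t * psiMax (m + 1) (goldenExtend m X) t := by
    filter_upwards [eventually_ge_atTop 0] with t ht using mul_nonneg ht (psiMax_nonneg _ _ _)
  have hbdd_ge : IsBoundedUnder (· ≥ ·) atTop
      fun t : ℝ => t * psiMax (m + 1) (goldenExtend m X) t := ⟨0, hge⟩
  have hbdd_le : IsBoundedUnder (· ≤ ·) atTop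
      fun t : ℝ => t * psiMax (m + 1) (goldenExtend m X) t := ⟨9 / 10, hle⟩
  refine ⟨?_, ?_⟩
  · exact (limsup_le_of_le hbdd_ge.isCoboundedUnder_le hle).trans_lt (by norm_num)
  rintro (h | h)
  · have h' : 0 < ThetaTildeMax (m + 1) (goldenExtend m X) := h
    refine (not_le_of_gt h') (le_of_forall_pos_le_add fun ε hε => ?_)
    rw [zero_add]
    refine liminf_le_of_frequently_le ?_ hbdd_ge
    rw [frequently_atTop]
    intro a
    obtain ⟨T, hT, bh, bt, h0, hb, hlt⟩ := hnotbad ε hε (max ⌈a⌉₊ 1)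
    refine ⟨T, (Nat.le_ceil a).trans (by exact_mod_cast (le_max_left _ _).trans hT), ?_⟩
    have hT0 : (0 : ℝ) < T := by
      exact_mod_cast Nat.lt_of_lt_of_le Nat.one_pos ((le_max_right _ _).trans hT)
    calc (T : ℝ) * psiMax (m + 1) (goldenExtend m X) T ≤ T * (ε / T) := by
          gcongr
          exact psiMax_le bh bt h0 (fun i => by exact_mod_cast hb i) fun j => (hlt j).le
      _ = ε := by field_simp
  · have : min c (1 / 4) ≤ ThetaMax (m + 1) (goldenExtend m X) := by
      refine le_limsup_of_frequently_le ?_ hbdd_le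
      refine tendsto_natCast_atTop_atTop.frequently
        ((hnonsing.and_eventually (eventually_ge_atTop 1)).mono ?_)
      rintro t ⟨ht, ht1⟩
      have ht1' : (1 : ℝ) ≤ t := by exact_mod_cast ht1
      have ht0 : (0 : ℝ) < t := by linarith
      rw [← div_le_iff₀' ht0]
      refine le_psiMax (Nat.succ_pos m) ht1' fun bh bt h0 hb => ?_
      by_cases hb' : (fun i : Fin m => bh i.succ) = 0
      · refine ⟨0, ?_⟩
        have hb'' : ∀ i : Fin m, bh i.succ = 0 := fun i => congrFun hb' i
        have hq : bh 0 ≠ 0 := by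
          obtain ⟨i, hi⟩ := h0
          rcases Fin.eq_zero_or_eq_succ i with rfl | ⟨i, rfl⟩
          · exact hi
          · exact absurd (hb'' i) hi
        have := one_div_le_abs_goldenRatio_mul_add ht1' (bt 0) hq (hb 0)
        rw [goldenExtend_sum]
        simp only [hb'', if_true, Int.cast_zero, mul_zero, Finset.sum_const_zero, add_zero]
        refine le_trans ?_ this
        rw [← div_div]
        gcongr
        exact min_le_right _ _
      · obtain ⟨j, hj⟩ := ht (fun i => bh i.succ) (fun j => bt j.succ) hb'
          fun i => by exact_mod_cast hb i.succ
        refine ⟨j.succ, ?_⟩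
        rw [goldenExtend_sum]
        simp only [Fin.succ_ne_zero, if_false, zero_mul, zero_add]
        refine le_trans ?_ hj
        gcongr
        exact min_le_left _ _
    have h' : ThetaMax (m + 1) (goldenExtend m X) = 0 := h
    rw [h'] at this
    exact absurd this (not_le_of_gt (lt_min hc (by norm_num)))

/-- The Dirichlet pigeonhole principle for boxes of arbitrary shape. -/
lemma exists_int_small_of_prod_lt {n : ℕ} (Ω : Fin n → Fin n → ℝ) (B : Fin n → ℕ) {S : ℕ}
    (hS : 0 < S) (hcard : S ^ n < ∏ i, B i) :
    ∃ b p : Fin n → ℤ, (∃ i, b i ≠ 0) ∧ (∀ i, |b i| < B i) ∧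
      ∀ j, |(∑ i, Ω j i * (b i : ℝ)) + (p j : ℝ)| < 1 / S := by
  have hS' : (0 : ℝ) < S := by exact_mod_cast hS
  let y : (∀ i, Fin (B i)) → Fin n → ℝ := fun a j => ∑ i, Ω j i * ((a i : ℕ) : ℝ)
  have hlt : ∀ x : ℝ, ⌊S * Int.fract x⌋₊ < S := fun x => by
    rw [Nat.floor_lt (by positivity)]
    exact mul_lt_of_lt_one_right hS' (Int.fract_lt_one x)
  let f : (∀ i, Fin (B i)) → Fin n → Fin S := fun a j => ⟨⌊S * Int.fract (y a j)⌋₊, hlt _⟩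
  obtain ⟨a, a', hne, heq⟩ := Fintype.exists_ne_map_eq_of_card_lt f (by simpa using hcard)
  refine ⟨fun i => (a i : ℤ) - a' i, fun j => ⌊y a' j⌋ - ⌊y a j⌋, ?_, fun i => ?_, fun j => ?_⟩
  · by_contra! h
    refine hne (funext fun i => Fin.ext ?_)
    have := h i
    omega
  · have h1 := (a i).isLt
    have h2 := (a' i).isLt
    simp only [abs_lt]
    omega
  · have hfl : ⌊S * Int.fract (y a j)⌋₊ = ⌊S * Int.fract (y a' j)⌋₊ :=
      congrArg Fin.val (congrFun heq j)
    have h1 := Nat.floor_le (a := S * Int.fract (y a j)) (by positivity)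
    have h2 := Nat.lt_floor_add_one (S * Int.fract (y a j))
    have h3 := Nat.floor_le (a := S * Int.fract (y a' j)) (by positivity)
    have h4 := Nat.lt_floor_add_one (S * Int.fract (y a' j))
    rw [hfl] at h1 h2
    have hsum : (∑ i, Ω j i * (((a i : ℤ) - a' i : ℤ) : ℝ)) + ((⌊y a' j⌋ - ⌊y a j⌋ : ℤ) : ℝ)
        = Int.fract (y a j) - Int.fract (y a' j) := by
      simp only [Int.fract, y]
      push_cast
      simp only [mul_sub, Finset.sum_sub_distrib]
      ring
    rw [hsum, abs_sub_lt_iff]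
    constructor <;> (rw [lt_div_iff₀ hS']; linarith)

lemma exists_int_small_goldenExtend {m : ℕ} (hm : 1 ≤ m) (X : Fin (m + 1) × Fin m → ℝ) {k : ℕ}
    (hk : 1 ≤ k) :
    ∃ b p : Fin (m + 1) → ℤ, (∃ i : Fin m, b i.succ ≠ 0) ∧ (∀ i, |b i| ≤ (64 * k : ℕ)) ∧
      ∀ j, |(∑ i, goldenExtend m X j i * (b i : ℝ)) + (p j : ℝ)| < 1 / (4 * k : ℕ) := by
  have hcard : (4 * k) ^ (m + 1) < ∏ i, (Fin.cons k fun _ => 64 * k : Fin (m + 1) → ℕ) i := by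
    simp only [Fin.prod_univ_succ, Fin.cons_zero, Fin.cons_succ, Finset.prod_const,
      Finset.card_univ, Fintype.card_fin]
    have h1 : 4 < 16 ^ m := lt_of_lt_of_le (by norm_num : 4 < 16 ^ 1)
      (Nat.pow_le_pow_right (by norm_num) hm)
    have hkm : 0 < k ^ (m + 1) := by positivity
    calc (4 * k) ^ (m + 1) = 4 * (4 ^ m * k ^ (m + 1)) := by ring
      _ < 16 ^ m * (4 ^ m * k ^ (m + 1)) := by
        apply Nat.mul_lt_mul_of_pos_right h1
        positivity
      _ = k * (64 * k) ^ m := by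
        rw [mul_pow, show (64 : ℕ) = 16 * 4 by norm_num, mul_pow]
        ring
  obtain ⟨b, p, ⟨i₀, h0⟩, hb, hp⟩ := exists_int_small_of_prod_lt (goldenExtend m X) _
    (by omega : 0 < 4 * k) hcard
  refine ⟨b, p, ?_, fun i => ?_, hp⟩
  · by_contra! hb'
    have hq : b 0 ≠ 0 := by
      rcases Fin.eq_zero_or_eq_succ i₀ with rfl | ⟨i, rfl⟩
      · exact h0
      · exact absurd (hb' i) h0
    have hbk : |b 0| ≤ (k : ℤ) := (hb 0).le
    have h := one_div_le_abs_goldenRatio_mul_add (t := k) (by exact_mod_cast hk) (p 0) hq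
      (by exact_mod_cast hbk)
    have h' := hp 0
    rw [goldenExtend_sum] at h'
    simp only [hb', if_true, Int.cast_zero, mul_zero, Finset.sum_const_zero, add_zero] at h'
    push_cast at h'
    linarith
  · have := hb i
    refine Fin.cases (fun h => ?_) (fun i h => ?_) i this
    · simp only [Fin.cons_zero] at h
      push_cast
      omega
    · exact h.le

/-- Near every point, at arbitrarily small scales, there is a ball of proportional size
consisting of matrices with a very good rational approximation of height about `64 * k`. -/
lemma exists_closedBall_approx {m : ℕ} (hm : 1 ≤ m) (X : Fin (m + 1) × Fin m → ℝ) {ε : ℝ}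
    (hε : 0 < ε) {k : ℕ} (hk : 1 ≤ k) :
    ∃ (W : Fin (m + 1) × Fin m → ℝ) (δ : ℝ), 0 < δ ∧ δ ≤ ε / k ∧
      X ∈ Metric.closedBall W (32 * m / ε * δ) ∧
      ∃ b p : Fin (m + 1) → ℤ, (∃ i, b i ≠ 0) ∧ (∀ i, |b i| ≤ (64 * k : ℕ)) ∧
        ∀ Z ∈ Metric.closedBall W δ, ∀ j,
          |(∑ i, goldenExtend m Z j i * (b i : ℝ)) + (p j : ℝ)| < ε / (64 * k : ℕ) := by
  obtain ⟨b, p, ⟨i₁, hi₁⟩, hb, hp⟩ := exists_int_small_goldenExtend hm X hk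
  have : Nonempty (Fin m) := ⟨i₁⟩
  obtain ⟨i₀, hi₀⟩ := Finite.exists_max fun i : Fin m => |b i.succ|
  have hτ0 : 1 ≤ |b i₀.succ| := (Int.one_le_abs hi₁).trans (hi₀ i₁)
  set τ : ℝ := |(b i₀.succ : ℝ)| with hτ
  have hτ1 : 1 ≤ τ := by
    rw [hτ]
    exact_mod_cast hτ0
  have hbne : (b i₀.succ : ℝ) ≠ 0 := abs_pos.1 (by linarith)
  have hbτ : ∀ i : Fin m, |(b i.succ : ℝ)| ≤ τ := fun i => by
    rw [hτ]
    exact_mod_cast hi₀ i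
  have hk' : (1 : ℝ) ≤ k := by exact_mod_cast hk
  have hm' : (1 : ℝ) ≤ m := by exact_mod_cast hm
  set r : Fin (m + 1) → ℝ := fun j =>
    (∑ i, goldenExtend m X j i * (b i : ℝ)) + (p j : ℝ)
  let W : Fin (m + 1) × Fin m → ℝ := fun ji =>
    X ji - if ji.2 = i₀ then r ji.1 / b i₀.succ else 0
  have hW : ∀ j, (∑ i, goldenExtend m W j i * (b i : ℝ)) + (p j : ℝ) = 0 := by
    intro j
    have h : r j = (∑ i, goldenExtend m X j i * (b i : ℝ)) + (p j : ℝ) := rfl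
    rw [goldenExtend_sum] at h ⊢
    simp only [W, sub_mul, Finset.sum_sub_distrib, ite_mul, zero_mul, Finset.sum_ite_eq',
      Finset.mem_univ, if_true, div_mul_cancel₀ _ hbne] at h ⊢
    linarith
  set δ : ℝ := ε / (128 * k * m * τ) with hδ
  have hδ0 : 0 < δ := by positivity
  refine ⟨W, δ, hδ0, ?_, ?_, b, p, ⟨_, hi₁⟩, hb, ?_⟩
  · rw [hδ]
    gcongr
    have : (1 : ℝ) ≤ m * τ := one_le_mul_of_one_le_of_one_le hm' hτ1
    nlinarith
  · rw [Metric.mem_closedBall, dist_pi_le_iff (by positivity)]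
    rintro ⟨j, i⟩
    have hK : 32 * m / ε * δ = 1 / (4 * k) / τ := by
      rw [hδ]
      field_simp
      norm_num
    rw [hK, Real.dist_eq]
    simp only [W, sub_sub_cancel]
    split_ifs
    · rw [abs_div]
      gcongr
      have := (hp j).le
      push_cast at this
      exact this
    · rw [abs_zero]
      positivity
  · intro Z hZ j
    have hZ' : ∀ i, |Z (j, i) - W (j, i)| ≤ δ := fun i => by
      rw [← Real.dist_eq]
      exact (dist_le_pi_dist Z W (j, i)).trans hZ
    have hdiff : (∑ i, goldenExtend m Z j i * (b i : ℝ)) + (p j : ℝ)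
        = ∑ i, (Z (j, i) - W (j, i)) * (b i.succ : ℝ) := by
      have h := hW j
      rw [goldenExtend_sum] at h ⊢
      simp only [sub_mul, Finset.sum_sub_distrib]
      linarith
    rw [hdiff]
    calc |∑ i, (Z (j, i) - W (j, i)) * (b i.succ : ℝ)|
        ≤ ∑ i, |(Z (j, i) - W (j, i)) * (b i.succ : ℝ)| := Finset.abs_sum_le_sum_abs _ _
      _ ≤ ∑ _i : Fin m, δ * τ := by
        gcongr with i
        rw [abs_mul]
        exact mul_le_mul (hZ' i) (hbτ i) (abs_nonneg _) hδ0.le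
      _ = ε / (128 * k) := by
        rw [Finset.sum_const, Finset.card_univ, Fintype.card_fin, nsmul_eq_mul, hδ]
        field_simp
      _ < ε / (64 * k : ℕ) := by
        push_cast
        gcongr
        norm_num

lemma ae_not_bad_goldenExtend {m : ℕ} (hm : 1 ≤ m) :
    ∀ᵐ X : Fin (m + 1) × Fin m → ℝ, ∀ ε > 0, ∀ T₀ : ℕ, ∃ T ≥ T₀, ∃ bh bt : Fin (m + 1) → ℤ,
      (∃ i, bh i ≠ 0) ∧ (∀ i, |bh i| ≤ T) ∧
      ∀ j, |(∑ i, goldenExtend m X j i * (bh i : ℝ)) + (bt j : ℝ)| < ε / T := by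
  have key : ∀ (N T₀ : ℕ), ∀ᵐ X : Fin (m + 1) × Fin m → ℝ, ∃ T ≥ T₀,
      ∃ bh bt : Fin (m + 1) → ℤ, (∃ i, bh i ≠ 0) ∧ (∀ i, |bh i| ≤ T) ∧
      ∀ j, |(∑ i, goldenExtend m X j i * (bh i : ℝ)) + (bt j : ℝ)| < 1 / ((N : ℝ) + 1) / T := by
    intro N T₀
    set ε : ℝ := 1 / ((N : ℝ) + 1) with hε
    have hε0 : 0 < ε := by positivity
    rw [ae_iff]
    set S := {X : Fin (m + 1) × Fin m → ℝ | ¬ ∃ T ≥ T₀, ∃ bh bt : Fin (m + 1) → ℤ,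
      (∃ i, bh i ≠ 0) ∧ (∀ i, |bh i| ≤ T) ∧
      ∀ j, |(∑ i, goldenExtend m X j i * (bh i : ℝ)) + (bt j : ℝ)| < ε / T}
    have hdens := IsUnifLocDoublingMeasure.ae_tendsto_measure_inter_div
      (volume : Measure (Fin (m + 1) × Fin m → ℝ)) S (32 * m / ε)
    rw [← Measure.restrict_eq_zero, ← ae_eq_bot, ← eventually_false_iff_eq_bot]
    filter_upwards [hdens] with X hX
    choose W δ hδ0 hδle hXW hb using fun k : ℕ =>
      exists_closedBall_approx hm X hε0 (k := k + T₀ + 1) (by omega)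
    have hlim : Tendsto δ atTop (nhdsWithin 0 (Set.Ioi 0)) := by
      refine tendsto_nhdsWithin_iff.2 ⟨?_, Eventually.of_forall hδ0⟩
      refine squeeze_zero (fun k => (hδ0 k).le) hδle ?_
      refine tendsto_const_nhds.div_atTop (tendsto_natCast_atTop_atTop.comp ?_)
      exact tendsto_atTop_mono (fun k => by omega : ∀ k : ℕ, k ≤ k + T₀ + 1) tendsto_id
    have h1 := hX W δ hlim (Eventually.of_forall hXW)
    have hempty : ∀ k, S ∩ Metric.closedBall (W k) (δ k) = ∅ := by
      intro k
      refine Set.eq_empty_of_forall_notMem ?_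
      rintro Z ⟨hZS, hZ⟩
      obtain ⟨b, p, h0, hle, hlt⟩ := hb k
      exact hZS ⟨_, by omega, b, p, h0, hle, hlt Z hZ⟩
    simp only [hempty, measure_empty, ENNReal.zero_div] at h1
    exact zero_ne_one (tendsto_nhds_unique tendsto_const_nhds h1)
  filter_upwards [ae_all_iff.2 fun N => ae_all_iff.2 (key N)] with X hX ε hε T₀
  obtain ⟨N, hN⟩ := exists_nat_one_div_lt hε
  obtain ⟨T, hT, bh, bt, h0, hle, hlt⟩ := hX N T₀
  exact ⟨T, hT, bh, bt, h0, hle, fun j => (hlt j).trans_le (by gcongr)⟩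

/-- The matrices of the unit cube whose last `m` rows, applied to `b`, are all at distance less
than `1 / (2 * N)` from an integer. -/
def nearIntegerSet (m N : ℕ) (b : Fin m → ℤ) : Set (Fin (m + 1) × Fin m → ℝ) :=
  {X | X ∈ Set.Icc 0 1 ∧ ∃ p : Fin m → ℤ, ∀ j : Fin m,
    |(∑ i, X (j.succ, i) * (b i : ℝ)) + (p j : ℝ)| < 1 / (2 * N)}

lemma measurableSet_nearIntegerSet (m N : ℕ) (b : Fin m → ℤ) :
    MeasurableSet (nearIntegerSet m N b) := by
  have : nearIntegerSet m N b = Set.Icc 0 1 ∩ ⋃ p : Fin m → ℤ, ⋂ j : Fin m,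
      {X | |(∑ i, X (j.succ, i) * (b i : ℝ)) + (p j : ℝ)| < 1 / (2 * N)} := by
    ext X
    simp [nearIntegerSet]
  rw [this]
  refine measurableSet_Icc.inter (MeasurableSet.iUnion fun p => MeasurableSet.iInter fun j => ?_)
  exact measurableSet_lt (by fun_prop) measurable_const

lemma pow_mul_volume_nearIntegerSet_le {m N : ℕ} (hN : 0 < N) {b : Fin m → ℤ} (hb : b ≠ 0) :
    (N : ℝ≥0∞) ^ m * volume (nearIntegerSet m N b) ≤ 3 ^ ((m + 1) * m) := by
  obtain ⟨i₀, hi₀⟩ := Function.ne_iff.1 hb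
  have hi₀' : b i₀ ≠ 0 := hi₀
  have hbne : (b i₀ : ℝ) ≠ 0 := by exact_mod_cast hi₀'
  have hb1 : 1 ≤ |(b i₀ : ℝ)| := by exact_mod_cast Int.one_le_abs hi₀'
  have hN' : (0 : ℝ) < N := by exact_mod_cast hN
  let u : (Fin m → Fin N) → Fin (m + 1) × Fin m → ℝ := fun J ji =>
    if ji.2 = i₀ then (Fin.cons 0 fun j => ((J j : ℕ) : ℝ) / N / b i₀ : Fin (m + 1) → ℝ) ji.1
    else 0
  let A : (Fin m → Fin N) → Set (Fin (m + 1) × Fin m → ℝ) := fun J =>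
    (fun Y => Y + -u J) ⁻¹' nearIntegerSet m N b
  have hu : ∀ J ji, |u J ji| ≤ 1 := by
    rintro J ⟨j, i⟩
    simp only [u]
    split_ifs
    · refine Fin.cases (by simp) (fun j => ?_) j
      simp only [Fin.cons_succ, abs_div, Nat.abs_cast]
      have h1 : ((J j : ℕ) : ℝ) / N ≤ 1 :=
        (div_le_one hN').2 (by exact_mod_cast (J j).isLt.le)
      exact (div_le_self (by positivity) hb1).trans h1
    · simp
  have hdisj : Pairwise (Function.onFun Disjoint A) := by
    intro J J' hne
    refine Set.disjoint_left.2 ?_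
    rintro Y ⟨-, p, hp⟩ ⟨-, p', hp'⟩
    refine hne (funext fun j => Fin.ext ?_)
    have hsum : ∀ J : Fin m → Fin N,
        ∑ i, (Y + -u J) (j.succ, i) * (b i : ℝ)
          = (∑ i, Y (j.succ, i) * (b i : ℝ)) - ((J j : ℕ) : ℝ) / N := by
      intro J
      simp only [u, Pi.add_apply, Pi.neg_apply, add_mul, Finset.sum_add_distrib, neg_mul,
        ite_mul, zero_mul, Finset.sum_neg_distrib, Finset.sum_ite_eq', Finset.mem_univ, if_true,
        Fin.cons_succ, div_mul_cancel₀ _ hbne, sub_eq_add_neg]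
    have h1 := hp j
    have h2 := hp' j
    rw [hsum] at h1 h2
    have h3 : |(((J' j : ℕ) : ℝ) - ((J j : ℕ) : ℝ)) / N + ((p j : ℝ) - p' j)| < 1 / N := by
      have h4 := (abs_sub _ _).trans_lt (add_lt_add h1 h2)
      have h5 : 1 / (2 * (N : ℝ)) + 1 / (2 * N) = 1 / N := by
        field_simp
        norm_num
      rw [h5] at h4
      have h6 : (((J' j : ℕ) : ℝ) - ((J j : ℕ) : ℝ)) / N + ((p j : ℝ) - p' j)
          = (∑ i, Y (j.succ, i) * (b i : ℝ)) - ((J j : ℕ) : ℝ) / N + p j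
            - ((∑ i, Y (j.succ, i) * (b i : ℝ)) - ((J' j : ℕ) : ℝ) / N + p' j) := by
        ring
      rwa [h6]
    have h6 : |((J' j : ℕ) : ℤ) - ((J j : ℕ) : ℤ) + (p j - p' j) * (N : ℤ)| < 1 := by
      rw [lt_div_iff₀ hN', ← Nat.abs_cast N, ← abs_mul, Nat.abs_cast N, add_mul,
        div_mul_cancel₀ _ hN'.ne'] at h3
      exact_mod_cast h3
    rw [Int.abs_lt_one_iff] at h6
    have h7 : (N : ℤ) ∣ ((J j : ℕ) : ℤ) - ((J' j : ℕ) : ℤ) :=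
      ⟨p j - p' j, by linear_combination -h6⟩
    have h8 := Int.eq_zero_of_abs_lt_dvd h7 (by
      have := (J j).isLt
      have := (J' j).isLt
      rw [abs_lt]
      omega)
    omega
  have hsub : (⋃ J, A J) ⊆ Set.Icc (fun _ => -1) fun _ => 2 := by
    refine Set.iUnion_subset fun J Y hY => ?_
    obtain ⟨⟨h0, h1⟩, -⟩ := hY
    refine ⟨fun ji => ?_, fun ji => ?_⟩
    · have := h0 ji
      have := abs_le.1 (hu J ji)
      simp only [Pi.zero_apply, Pi.add_apply, Pi.neg_apply] at *
      linarith
    · have := h1 ji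
      have := abs_le.1 (hu J ji)
      simp only [Pi.one_apply, Pi.add_apply, Pi.neg_apply] at *
      linarith
  have hvol : ∀ J, volume (A J) = volume (nearIntegerSet m N b) := fun J =>
    measure_preimage_add_right _ _ _
  have hmeas : ∀ J, MeasurableSet (A J) := fun J =>
    (measurable_add_const _) (measurableSet_nearIntegerSet m N b)
  calc (N : ℝ≥0∞) ^ m * volume (nearIntegerSet m N b) = volume (⋃ J, A J) := by
        rw [measure_iUnion hdisj hmeas, tsum_fintype]
        simp [hvol]
    _ ≤ volume (Set.Icc (fun _ => -1) fun _ => 2 : Set (Fin (m + 1) × Fin m → ℝ)) :=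
        measure_mono hsub
    _ = 3 ^ ((m + 1) * m) := by
        rw [Real.volume_Icc_pi]
        norm_num

/-- The matrices of the unit cube whose last `m` rows admit an approximation of quality
`1 / (2 * L * t)` and height `t`. -/
def approxSet (m L t : ℕ) : Set (Fin (m + 1) × Fin m → ℝ) :=
  ⋃ b ∈ {b ∈ Fintype.piFinset fun _ : Fin m => Finset.Icc (-t : ℤ) t | b ≠ 0},
    nearIntegerSet m (L * t) b

lemma volume_approxSet_le {m t : ℕ} (hm : 1 ≤ m) (ht : 1 ≤ t) :
    volume (approxSet m (6 * 3 ^ (m + 1)) t) ≤ 1 / 2 := by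
  set L := 6 * 3 ^ (m + 1) with hL
  set s := {b ∈ Fintype.piFinset fun _ : Fin m => Finset.Icc (-t : ℤ) t | b ≠ 0} with hs
  have hcard : s.card ≤ (3 * t) ^ m := by
    refine (Finset.card_filter_le _ _).trans ?_
    simp only [Fintype.card_piFinset, Int.card_Icc, Finset.prod_const, Finset.card_univ,
      Fintype.card_fin]
    gcongr
    omega
  have hLt : 0 < L * t := by positivity
  set c : ℝ≥0∞ := ((t * 3 * 3 ^ (m + 1) : ℕ) : ℝ≥0∞) ^ m with hc
  have hc0 : c ≠ 0 := pow_ne_zero _ (Nat.cast_ne_zero.2 (by positivity))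
  have hctop : c ≠ ∞ := ENNReal.pow_ne_top (ENNReal.natCast_ne_top _)
  have hmain : c * (2 ^ m * volume (approxSet m L t)) ≤ c * 1 := by
    calc c * (2 ^ m * volume (approxSet m L t))
        = ((L * t : ℕ) : ℝ≥0∞) ^ m * volume (approxSet m L t) := by
          have hcast : ((t * 3 * 3 ^ (m + 1) : ℕ) : ℝ≥0∞) * 2 = ((L * t : ℕ) : ℝ≥0∞) := by
            rw [hL]
            push_cast
            ring
          rw [← mul_assoc, hc, ← mul_pow, hcast]
      _ ≤ ((L * t : ℕ) : ℝ≥0∞) ^ m * ∑ b ∈ s, volume (nearIntegerSet m (L * t) b) := by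
          gcongr
          exact measure_biUnion_finset_le _ _
      _ ≤ ∑ _b ∈ s, 3 ^ ((m + 1) * m) := by
          rw [Finset.mul_sum]
          exact Finset.sum_le_sum fun b hb =>
            pow_mul_volume_nearIntegerSet_le hLt (Finset.mem_filter.1 hb).2
      _ ≤ ((3 * t : ℕ) : ℝ≥0∞) ^ m * 3 ^ ((m + 1) * m) := by
          rw [Finset.sum_const, nsmul_eq_mul]
          gcongr
          exact_mod_cast hcard
      _ = c * 1 := by
          rw [hc, pow_mul, ← mul_pow, mul_one]
          push_cast
          ring
  have h2 : 2 ^ m * volume (approxSet m L t) ≤ 1 :=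
    (ENNReal.mul_le_mul_iff_right hc0 hctop).1 hmain
  rw [ENNReal.le_div_iff_mul_le (by simp) (by simp), mul_comm]
  refine le_trans ?_ h2
  gcongr
  exact le_self_pow₀ one_le_two (by omega)

lemma volume_frequently_notMem_approxSet_ne_zero {m : ℕ} (hm : 1 ≤ m) :
    volume {X : Fin (m + 1) × Fin m → ℝ | X ∈ Set.Icc 0 1 ∧
      ∃ᶠ t in atTop, X ∉ approxSet m (6 * 3 ^ (m + 1)) t} ≠ 0 := by
  intro h0
  set E := approxSet m (6 * 3 ^ (m + 1))
  set G := {X : Fin (m + 1) × Fin m → ℝ | X ∈ Set.Icc 0 1 ∧ ∃ᶠ t in atTop, X ∉ E t}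
  have hcover : Set.Icc 0 1 ⊆ G ∪ ⋃ T : ℕ, ⋂ t ≥ T, E t := by
    intro X hX
    by_cases h : ∃ᶠ t in atTop, X ∉ E t
    · exact Or.inl ⟨hX, h⟩
    · right
      obtain ⟨T, hT⟩ := eventually_atTop.1 (not_frequently.1 h)
      exact Set.mem_iUnion.2 ⟨T, Set.mem_iInter₂.2 fun t ht => not_not.1 (hT t ht)⟩
  have hmono : Monotone fun T : ℕ => ⋂ t ≥ T, E t := fun T T' hT =>
    Set.biInter_subset_biInter_left fun t ht => le_trans hT ht
  have hhalf : volume (⋃ T : ℕ, ⋂ t ≥ T, E t) ≤ 1 / 2 := by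
    rw [hmono.measure_iUnion]
    refine iSup_le fun T => (measure_mono ?_).trans
      (volume_approxSet_le hm (Nat.le_max_right T 1))
    exact Set.biInter_subset_of_mem (Nat.le_max_left T 1)
  have hone : volume (Set.Icc 0 1 : Set (Fin (m + 1) × Fin m → ℝ)) = 1 := by
    rw [Real.volume_Icc_pi]
    simp
  have : (1 : ℝ≥0∞) ≤ 1 / 2 := by
    calc (1 : ℝ≥0∞) = volume (Set.Icc 0 1 : Set (Fin (m + 1) × Fin m → ℝ)) := hone.symm
      _ ≤ volume G + volume (⋃ T : ℕ, ⋂ t ≥ T, E t) :=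
        (measure_mono hcover).trans (measure_union_le _ _)
      _ ≤ 0 + 1 / 2 := add_le_add h0.le hhalf
      _ = 1 / 2 := zero_add _
  exact absurd this (by simp)

lemma exists_lt_of_notMem_approxSet {m L t : ℕ} {X : Fin (m + 1) × Fin m → ℝ}
    (hX : X ∈ Set.Icc 0 1) (h : X ∉ approxSet m L t) (b p : Fin m → ℤ) (hb : b ≠ 0)
    (hbt : ∀ i, |b i| ≤ t) :
    ∃ j : Fin m, 1 / (2 * L) / t ≤ |(∑ i, X (j.succ, i) * (b i : ℝ)) + (p j : ℝ)| := by
  by_contra! hlt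
  refine h (Set.mem_biUnion (x := b) ?_ ⟨hX, p, fun j => ?_⟩)
  · simpa [hb, Fintype.mem_piFinset, ← abs_le] using hbt
  · have := hlt j
    rw [div_div, mul_assoc] at this
    exact_mod_cast this

lemma antilipschitzWith_goldenExtend (m : ℕ) : AntilipschitzWith 1 (goldenExtend m) := by
  refine AntilipschitzWith.of_le_mul_dist fun X Y => ?_
  rw [NNReal.coe_one, one_mul]
  refine (dist_pi_le_iff dist_nonneg).2 ?_
  rintro ⟨j, i⟩
  have h := (dist_le_pi_dist (goldenExtend m X j) (goldenExtend m Y j) i.succ).trans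
    (dist_le_pi_dist (goldenExtend m X) (goldenExtend m Y) j)
  simpa [goldenExtend] using h

lemma volume_preimage_FSmax_ne_zero {m : ℕ} (hm : 1 ≤ m) :
    volume (goldenExtend m ⁻¹' FSmax (m + 1)) ≠ 0 := by
  intro h0
  refine volume_frequently_notMem_approxSet_ne_zero hm ?_
  rw [measure_eq_zero_iff_ae_notMem] at h0 ⊢
  filter_upwards [h0, ae_not_bad_goldenExtend hm] with X hX hbad hmem
  obtain ⟨hX01, hfreq⟩ := hmem
  exact hX (goldenExtend_mem_FSmax (c := 1 / (2 * (6 * 3 ^ (m + 1) : ℕ))) (by positivity)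
    (hfreq.mono fun t ht b p hb hbt => exists_lt_of_notMem_approxSet hX01 ht b p hb hbt) hbad)

lemma le_dimH_FSmax_succ {m : ℕ} (hm : 1 ≤ m) :
    (((m + 1) * m : ℕ) : ℝ≥0∞) ≤ dimH (FSmax (m + 1)) := by
  have h := volume_preimage_FSmax_ne_zero hm
  rw [← hausdorffMeasure_pi_real] at h
  have hdim : (((m + 1) * m : ℕ) : ℝ≥0∞) ≤ dimH (goldenExtend m ⁻¹' FSmax (m + 1)) := by
    refine le_trans (le_of_eq ?_) (le_dimH_of_hausdorffMeasure_ne_zero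
      (d := (((m + 1) * m : ℕ) : NNReal)) ?_)
    · simp
    · simpa using h
  exact hdim.trans (((antilipschitzWith_goldenExtend m).le_dimH_image _).trans
    (dimH_mono (Set.image_preimage_subset _ _)))

/-- for `n ≥ 2`, `dim_H FS_{n,n} ≥ (n−1)² + 1`, and the matrices can be
chosen invertible. -/
theorem dimH_FSmax_square (n : ℕ) (hn : 2 ≤ n) :
    (((n - 1) ^ 2 + 1 : ℕ) : ℝ≥0∞) ≤ dimH (FSmax n) ∧
    ∃ Ω ∈ FSmax n, (Matrix.of Ω).det ≠ 0 := by
  obtain ⟨m, rfl⟩ : ∃ m, n = m + 1 := ⟨n - 1, by omega⟩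
  have hm : 1 ≤ m := by omega
  constructor
  · refine le_trans ?_ (le_dimH_FSmax_succ hm)
    refine Nat.cast_le.2 ?_
    rw [Nat.add_sub_cancel]
    nlinarith
  · obtain ⟨X, hX⟩ := nonempty_of_measure_ne_zero (volume_preimage_FSmax_ne_zero hm)
    exact exists_mem_FSmax_det_ne_zero hX
end

section
/- Let n ≥ 4 be an integer and let c ∈ (0, c(n)) be sufficiently small (e.g. c(n) = ((n−3)/(8(n−2)^{3/2}))·√π·Γ(n−1/2)/Γ(n)). Let ξ = (ξ₁,ξ₂) ∈ ℝ² be as constructed in Theorem 5.1, i.e. with {1,ξ₁,ξ₂} ℚ-linearly independent, limsup_{t→∞} tⁿ ψ_ξ(t) = c and liminf_{t→∞} tⁿ ψ_ξ(t) = 0 (with ξ₁, ξ₂ chosen arbitrarily small positive). Then the set 𝒴 ⊆ ℝ^{n−2} of vectors (ζ₃,…,ζ_n) for which ζ = (ξ₁,ξ₂,ζ₃,…,ζ_n) ∈ ℝⁿ satisfies limsup_{t→∞} tⁿ ψ_ζ(t) = c (equivalently ζ ∈ DI_n(c)) has positive (n−2)-dimensional Lebesgue measure. -/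
open Filter MeasureTheory

/-- `ψ_ξ(t)` for `ξ = (ξ₁,ξ₂) ∈ ℝ²`: the minimum of `|b₁ξ₁ + b₂ξ₂ + b₃|` over integer
vectors `(b₁,b₂,b₃) ∈ ℤ³` with `1 ≤ max(|b₁|,|b₂|) ≤ t`. -/
noncomputable def psiTwo (ξ1 ξ2 : ℝ) (t : ℝ) : ℝ :=
  sInf { r : ℝ | ∃ b1 b2 b3 : ℤ,
    (b1 ≠ 0 ∨ b2 ≠ 0) ∧ |(b1 : ℝ)| ≤ t ∧ |(b2 : ℝ)| ≤ t ∧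
    r = |(b1 : ℝ) * ξ1 + (b2 : ℝ) * ξ2 + (b3 : ℝ)| }

/-- `ψ_ζ(t)` for `ζ ∈ ℝⁿ`: the minimum of `|b₁ζ₁+⋯+b_nζ_n+b_{n+1}|` over integer
vectors with `1 ≤ max_i |b_i| ≤ t`. -/
noncomputable def psiDual (n : ℕ) (ζ : Fin n → ℝ) (t : ℝ) : ℝ :=
  sInf { r : ℝ | ∃ (b : Fin n → ℤ) (b' : ℤ),
    (∃ i, b i ≠ 0) ∧ (∀ i, |(b i : ℝ)| ≤ t) ∧
    r = |(∑ i, (b i : ℝ) * ζ i) + (b' : ℝ)| }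

/-- The vector `ζ = (ξ₁, ξ₂, γ₃, …, γ_n) ∈ ℝⁿ`. -/
def extendVec (n : ℕ) (ξ1 ξ2 : ℝ) (γ : Fin (n - 2) → ℝ) : Fin n → ℝ :=
  fun i =>
    if h0 : (i : ℕ) = 0 then ξ1
    else if h1 : (i : ℕ) = 1 then ξ2
    else γ ⟨(i : ℕ) - 2, by have := i.isLt; omega⟩

/-- Reduction of a real vector modulo the integer lattice. -/
noncomputable def toTorus (m : ℕ) (x : Fin m → ℝ) : Fin m → UnitAddCircle := fun i => (x i : UnitAddCircle)

theorem measurePreserving_toTorus (m : ℕ) (t : ℝ) :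
    MeasurePreserving (toTorus m)
      (volume.restrict (Set.univ.pi fun _ : Fin m => Set.Ioc t (t + 1))) volume := by
  have h := measurePreserving_pi (fun _ : Fin m => (volume : Measure ℝ).restrict (Set.Ioc t (t + 1)))
    (fun _ : Fin m => (volume : Measure UnitAddCircle))
    (fun _ => UnitAddCircle.measurePreserving_mk t)
  rw [← Measure.restrict_pi_pi] at h
  exact h

/-- The endomorphism of the torus induced by an integer matrix. -/
noncomputable def torusEnd {m : ℕ} (Q : Matrix (Fin m) (Fin m) ℤ) :
    (Fin m → UnitAddCircle) →+ (Fin m → UnitAddCircle) where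
  toFun y i := ∑ j, Q i j • y j
  map_zero' := by ext i; simp
  map_add' y z := by ext i; simp [Finset.sum_add_distrib]

theorem torusEnd_toTorus {m : ℕ} (Q : Matrix (Fin m) (Fin m) ℤ) (x : Fin m → ℝ) :
    torusEnd Q (toTorus m x) = toTorus m (fun i => ∑ j, (Q i j : ℝ) * x j) := by
  ext i
  simp only [torusEnd, toTorus, AddMonoidHom.coe_mk, ZeroHom.coe_mk]
  rw [← QuotientAddGroup.mk'_apply, map_sum]
  refine Finset.sum_congr rfl fun j _ => ?_
  rw [← zsmul_eq_mul, map_zsmul]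
  rfl

theorem toTorus_surjective (m : ℕ) : Function.Surjective (toTorus m) := by
  intro y
  choose x hx using fun i => QuotientAddGroup.mk_surjective (y i)
  exact ⟨x, funext hx⟩

theorem torusEnd_measurePreserving {m : ℕ} (Q : Matrix (Fin m) (Fin m) ℤ) (hQ : Q.det ≠ 0) :
    MeasurePreserving (torusEnd Q) volume volume := by
  refine AddMonoidHom.measurePreserving ?_ ?_ rfl
  · refine continuous_pi fun i => ?_
    change Continuous fun y : Fin m → UnitAddCircle => ∑ j, Q i j • y j
    fun_prop
  · intro y
    obtain ⟨x, rfl⟩ := toTorus_surjective m y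
    let R : Matrix (Fin m) (Fin m) ℝ := Q.map (Int.cast)
    have hR : IsUnit R.det := by
      have : R.det = ((Q.det : ℤ) : ℝ) := by
        simpa using (RingHom.map_det (Int.castRingHom ℝ) Q).symm
      rw [this, isUnit_iff_ne_zero]
      exact_mod_cast hQ
    refine ⟨toTorus m (R⁻¹.mulVec x), ?_⟩
    rw [torusEnd_toTorus]
    congr 1
    have : R.mulVec (R⁻¹.mulVec x) = x := by
      rw [Matrix.mulVec_mulVec, Matrix.mul_nonsing_inv _ hR, Matrix.one_mulVec]
    exact this

theorem toTorus_eq_iff {m : ℕ} (x y : Fin m → ℝ) :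
    toTorus m x = toTorus m y ↔ ∃ k : Fin m → ℤ, x = fun i => y i + k i := by
  simp only [funext_iff, toTorus]
  rw [← Classical.skolem (p := fun i (k : ℤ) => x i = y i + k)]
  refine forall_congr' fun i => ?_
  rw [← sub_eq_zero, ← AddCircle.coe_sub, AddCircle.coe_eq_zero_iff]
  refine exists_congr fun k => ?_
  rw [zsmul_eq_mul, mul_one]
  constructor <;> intro h <;> linarith

theorem volume_integer_translates {m : ℕ} (Q : Matrix (Fin m) (Fin m) ℤ) (hQ : Q.det ≠ 0)
    (s : Fin m → ℝ) (B : Set (Fin m → ℝ)) (hB : MeasurableSet B)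
    (hB' : B ⊆ Set.univ.pi fun _ => Set.Ioc (-1 / 2 : ℝ) (1 / 2)) :
    volume ((Set.univ.pi fun _ => Set.Ioc (0 : ℝ) 1) ∩
      {γ : Fin m → ℝ | ∃ x : Fin m → ℤ, (fun i => ∑ j, (Q i j : ℝ) * γ j + s i + x i) ∈ B})
      = volume B := by
  have hpi : ∀ t : ℝ, MeasurableSet (Set.univ.pi fun _ : Fin m => Set.Ioc t (t + 1)) :=
    fun t => MeasurableSet.univ_pi fun _ => measurableSet_Ioc
  let σ : (Fin m → UnitAddCircle) → (Fin m → ℝ) :=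
    fun y i => (AddCircle.measurableEquivIoc 1 (-1 / 2 : ℝ) (y i) : ℝ)
  have hσ : Measurable σ := by
    refine measurable_pi_lambda _ fun i => ?_
    exact measurable_subtype_coe.comp
      ((AddCircle.measurableEquivIoc 1 (-1 / 2 : ℝ)).measurable.comp (measurable_pi_apply i))
  have hσ1 : ∀ y, toTorus m (σ y) = y := fun y => funext fun i =>
    (AddCircle.measurableEquivIoc 1 (-1 / 2 : ℝ)).symm_apply_apply (y i)
  have hσ2 : ∀ x ∈ (Set.univ.pi fun _ : Fin m => Set.Ioc (-1 / 2 : ℝ) (1 / 2)),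
      σ (toTorus m x) = x := by
    intro x hx
    funext i
    have hxi : x i ∈ Set.Ioc (-1 / 2 : ℝ) (-1 / 2 + 1) := by
      have := hx i trivial
      norm_num at this ⊢
      exact this
    have := (AddCircle.measurableEquivIoc 1 (-1 / 2 : ℝ)).apply_symm_apply ⟨x i, hxi⟩
    exact congrArg Subtype.val this
  have hA : MeasurableSet (σ ⁻¹' B) := hσ hB
  have hmem : ∀ x, toTorus m x ∈ σ ⁻¹' B ↔ ∃ k : Fin m → ℤ, (fun i => x i + k i) ∈ B := by
    intro x
    constructor
    · intro h
      obtain ⟨k, hk⟩ := (toTorus_eq_iff _ _).1 (hσ1 (toTorus m x))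
      exact ⟨k, hk ▸ h⟩
    · rintro ⟨k, hk⟩
      have h1 : toTorus m x = toTorus m (fun i => x i + k i) :=
        ((toTorus_eq_iff _ _).2 ⟨k, rfl⟩).symm
      rw [Set.mem_preimage, h1, hσ2 _ (hB' hk)]
      exact hk
  have hone : (-1 / 2 : ℝ) + 1 = 1 / 2 := by norm_num
  have e1 : volume (σ ⁻¹' B) = volume B := by
    rw [← (measurePreserving_toTorus m (-1 / 2)).measure_preimage hA.nullMeasurableSet,
      Measure.restrict_apply ((measurePreserving_toTorus m (-1/2)).measurable hA)]
    congr 1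
    ext x
    rw [hone]
    constructor
    · rintro ⟨h1, h2⟩
      rw [Set.mem_preimage, Set.mem_preimage, hσ2 x h2] at h1
      exact h1
    · intro h
      refine ⟨?_, hB' h⟩
      rw [Set.mem_preimage, Set.mem_preimage, hσ2 x (hB' h)]
      exact h
  have hmp := (measurePreserving_add_right (volume : Measure (Fin m → UnitAddCircle))
    (toTorus m s)).comp ((torusEnd_measurePreserving Q hQ).comp (measurePreserving_toTorus m 0))
  rw [← e1, ← hmp.measure_preimage hA.nullMeasurableSet,
    Measure.restrict_apply (hmp.measurable hA), zero_add, Set.inter_comm]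
  congr 2
  ext γ
  simp only [Set.mem_preimage, Set.mem_ofPred_eq, Function.comp_apply, torusEnd_toTorus]
  have : toTorus m (fun i => ∑ j, (Q i j : ℝ) * γ j) + toTorus m s =
    toTorus m (fun i => ∑ j, (Q i j : ℝ) * γ j + s i) := rfl
  rw [this]
  exact ((hmem _).symm)

/-- The affine form `b · (ξ, γ) + x`, as a linear map in the integer vector `(b, x)`. -/
noncomputable def linForm {m : ℕ} (ξ : Fin 2 → ℝ) (γ : Fin m → ℝ) :
    ((Fin 2 ⊕ Fin m → ℤ) × ℤ) →ₗ[ℤ] ℝ where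
  toFun w := ∑ k, (w.1 k : ℝ) * Sum.elim ξ γ k + w.2
  map_add' w w' := by
    simp only [Prod.fst_add, Prod.snd_add, Pi.add_apply, Int.cast_add, add_mul,
      Finset.sum_add_distrib]
    ring
  map_smul' a w := by
    simp only [Prod.smul_fst, Prod.smul_snd, Pi.smul_apply, smul_eq_mul, Int.cast_mul, mul_assoc,
      ← Finset.mul_sum, ← mul_add]
    rw [zsmul_eq_mul]
    rfl

theorem linForm_apply {m : ℕ} (ξ : Fin 2 → ℝ) (γ : Fin m → ℝ) (b : Fin 2 ⊕ Fin m → ℤ) (x : ℤ) :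
    linForm ξ γ (b, x) =
      ∑ j, (b (.inr j) : ℝ) * γ j + ∑ k, (b (.inl k) : ℝ) * ξ k + x := by
  change ∑ k, (b k : ℝ) * Sum.elim ξ γ k + x = _
  rw [Fintype.sum_sum_type]
  simp only [Sum.elim_inl, Sum.elim_inr]
  ring

theorem volume_simultaneously_small {m : ℕ} (ξ : Fin 2 → ℝ) (p : Fin m → Fin 2 ⊕ Fin m → ℤ)
    (hp : (Matrix.of fun i j => p i (.inr j)).det ≠ 0) {ε : ℝ} (hε : 0 < ε) (hε' : ε ≤ 1 / 2) :
    volume ((Set.univ.pi fun _ => Set.Ioc (0 : ℝ) 1) ∩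
      {γ : Fin m → ℝ | ∃ x : Fin m → ℤ, ∀ i, |linForm ξ γ (p i, x i)| < ε}) =
      ENNReal.ofReal ((2 * ε) ^ m) := by
  have := volume_integer_translates (Matrix.of fun i j => p i (.inr j)) hp
    (fun i => ∑ k, (p i (.inl k) : ℝ) * ξ k) (Set.univ.pi fun _ => Set.Ioo (-ε) ε)
    (MeasurableSet.univ_pi fun _ => measurableSet_Ioo)
    (Set.pi_mono fun _ _ x hx => ⟨by linarith [hx.1], by linarith [hx.2]⟩)
  rw [Real.volume_pi_Ioo] at this
  convert this using 5 with γ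
  · simp only [linForm_apply, Set.mem_pi, Set.mem_univ, true_imp_iff, abs_lt, Set.mem_Ioo,
      Matrix.of_apply]
  · rw [Finset.prod_const, ← ENNReal.ofReal_pow (by linarith), Finset.card_univ, Fintype.card_fin]
    congr 2; ring

theorem det_updateRow_one {m : ℕ} {R : Type*} [CommRing R] (i : Fin m) (b : Fin m → R) :
    ((1 : Matrix (Fin m) (Fin m) R).updateRow i b).det = b i := by
  rw [← Matrix.cramer_transpose_apply, Matrix.transpose_one, Matrix.cramer_one]
  rfl

theorem updateRow_one_mulVec {m : ℕ} {R : Type*} [CommRing R] (i : Fin m) (b y : Fin m → R)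
    (j : Fin m) : ((1 : Matrix (Fin m) (Fin m) R).updateRow i b).mulVec y j =
      if j = i then ∑ l, b l * y l else y j := by
  unfold Matrix.mulVec dotProduct
  split_ifs with h
  · subst h; simp
  · simp [h, Matrix.one_apply]

theorem volume_sheared_cube {m : ℕ} (i : Fin m) (b : Fin m → ℝ) (hb : 0 < b i) (lam : ℝ)
    {ε : ℝ} (hε : 0 < ε) :
    volume {y : Fin m → ℝ | (∀ j, j ≠ i → |y j| < ε) ∧ |∑ l, b l * y l + lam| < ε} =
      ENNReal.ofReal ((2 * ε) ^ m / b i) := by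
  have hdet : LinearMap.det (Matrix.toLin' ((1 : Matrix (Fin m) (Fin m) ℝ).updateRow i b)) = b i := by
    rw [LinearMap.det_toLin', det_updateRow_one]
  have := Measure.addHaar_preimage_linearMap (volume : Measure (Fin m → ℝ))
    (f := Matrix.toLin' ((1 : Matrix (Fin m) (Fin m) ℝ).updateRow i b)) (by rw [hdet]; exact hb.ne')
    (Set.univ.pi fun j => Set.Ioo (-ε - if j = i then lam else 0) (ε - if j = i then lam else 0))
  rw [hdet, Real.volume_pi_Ioo, abs_of_pos (inv_pos.2 hb)] at this
  convert this using 2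
  · ext y
    simp only [Set.mem_ofPred_eq, Set.mem_preimage, Matrix.toLin'_apply, Set.mem_pi, Set.mem_univ,
      true_imp_iff, updateRow_one_mulVec, Set.mem_Ioo, abs_lt]
    constructor
    · rintro ⟨h1, h2⟩ j
      by_cases hj : j = i
      · simp only [hj, if_true]; constructor <;> linarith
      · simp only [hj, if_false, sub_zero]; exact h1 j hj
    · intro h
      refine ⟨fun j hj => by simpa [hj] using h j, ?_⟩
      have := h i
      simp only [if_true] at this
      constructor <;> linarith
  · have : ∀ j : Fin m, (ε - if j = i then lam else 0) - (-ε - if j = i then lam else 0) = 2 * ε :=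
      fun j => by ring
    simp only [this]
    rw [Finset.prod_const, ← ENNReal.ofReal_pow (by linarith), ← ENNReal.ofReal_mul (by positivity),
      Finset.card_univ, Fintype.card_fin, div_eq_inv_mul]

theorem volume_congruent_le {m : ℕ} (ξ : Fin 2 → ℝ) (p : Fin m → Fin 2 ⊕ Fin m → ℤ)
    (hp : (Matrix.of fun i j => p i (.inr j)).det ≠ 0) {ε : ℝ} (hε : 0 < ε)
    (hε' : ε * (m + 1) ≤ 1 / 4) (r : ℕ) (hr : 0 < r) (i : Fin m) (A : Fin m → ℤ)
    (hA : ∀ j, |A j| ≤ r) (hAi : A i = 0) (w : (Fin 2 → ℤ) × ℤ)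
    (hw : |∑ k, (w.1 k : ℝ) * ξ k + w.2| ≤ r / 4)
    (hcong : ∀ k, (r : ℤ) ∣ p i k - Sum.elim w.1 0 k - ∑ j, A j * p j k) :
    volume ((Set.univ.pi fun _ => Set.Ioc (0 : ℝ) 1) ∩
      {γ : Fin m → ℝ | ∃ x : Fin m → ℤ, (∀ j, |linForm ξ γ (p j, x j)| < ε) ∧
        (r : ℤ) ∣ x i - w.2 - ∑ j, A j * x j}) ≤
      ENNReal.ofReal ((2 * ε) ^ m / r) := by
  choose z hz using hcong
  set lam : ℝ := ∑ k, (w.1 k : ℝ) * ξ k + w.2 with hlam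
  set b : Fin m → ℤ := Function.update A i r with hb
  have hbi : b i = r := by simp [hb]
  have hr' : (0 : ℝ) < r := by exact_mod_cast hr
  let p' : Fin m → Fin 2 ⊕ Fin m → ℤ := Function.update p i z
  have hsum : ∀ {R : Type} [CommRing R] (f : Fin m → R) (t : R),
      ∑ l, (b l : R) * (Function.update f i t l) = r * t + ∑ j, (A j : R) * f j := by
    intro R _ f t
    rw [← Finset.add_sum_erase _ _ (Finset.mem_univ i), ← Finset.add_sum_erase _ (fun j => (A j : R) * f j) (Finset.mem_univ i)]
    simp only [hbi, Function.update_self, hAi, Int.cast_zero, zero_mul, zero_add, Int.cast_natCast]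
    congr 1
    refine Finset.sum_congr rfl fun j hj => ?_
    have hj' := Finset.ne_of_mem_erase hj
    simp [hb, hj']
  have hQ : (Matrix.of fun i j => p i (.inr j)) =
      ((1 : Matrix (Fin m) (Fin m) ℤ).updateRow i b) * (Matrix.of fun i j => p' i (.inr j)) := by
    ext j l
    have := updateRow_one_mulVec i b (fun j => p' j (.inr l)) j
    change _ = ((1 : Matrix (Fin m) (Fin m) ℤ).updateRow i b).mulVec (fun j => p' j (.inr l)) j
    rw [this]
    split_ifs with h
    · subst h
      have h2 := hsum (fun j' => p j' (.inr l)) (z (.inr l))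
      have h3 := hz (.inr l)
      have h4 : ∀ l', p' l' (.inr l) = Function.update (fun j' => p j' (.inr l)) j (z (.inr l)) l' := by
        intro l'
        by_cases h : l' = j
        · subst h; simp [p']
        · simp [p', h]
      simp only [h4]
      simp only [Int.cast_id, Sum.elim_inr, Pi.zero_apply] at h2 h3
      rw [h2]
      simp only [Matrix.of_apply]
      linarith
    · simp [p', h]
  have hdet : (Matrix.of fun i j => p' i (.inr j)).det ≠ 0 := by
    intro h
    rw [hQ, Matrix.det_mul, h, mul_zero] at hp
    exact hp rfl
  set B : Set (Fin m → ℝ) :=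
    {y | (∀ j, j ≠ i → |y j| < ε) ∧ |∑ l, (b l : ℝ) * y l + lam| < ε} with hB
  have hBm : MeasurableSet B := by
    refine IsOpen.measurableSet ?_
    have h1 : IsOpen {y : Fin m → ℝ | ∀ j, j ≠ i → |y j| < ε} := by
      simp only [Set.ofPred_forall]
      exact isOpen_iInter_of_finite fun j => isOpen_iInter_of_finite fun _ =>
        isOpen_lt (by fun_prop) continuous_const
    have h2 : IsOpen {y : Fin m → ℝ | |∑ l, (b l : ℝ) * y l + lam| < ε} :=
      isOpen_lt (by fun_prop) continuous_const
    exact h1.inter h2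
  have hr1 : (1 : ℝ) ≤ r := by exact_mod_cast hr
  have hBs : B ⊆ Set.univ.pi fun _ => Set.Ioc (-1 / 2 : ℝ) (1 / 2) := by
    rintro y ⟨h1, h2⟩ j -
    have hm : (0 : ℝ) ≤ m := by positivity
    have key : |y j| < 1 / 2 := by
      by_cases hj : j = i
      · subst hj
        have e := hsum (R := ℝ) y (y j)
        rw [Function.update_eq_self] at e
        rw [e] at h2
        have h3 : |∑ l, (A l : ℝ) * y l| ≤ m * (r * ε) := by
          calc |∑ l, (A l : ℝ) * y l| ≤ ∑ l, |(A l : ℝ) * y l| := Finset.abs_sum_le_sum_abs _ _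
            _ ≤ ∑ _l : Fin m, (r * ε : ℝ) := by
                refine Finset.sum_le_sum fun l _ => ?_
                by_cases hl : l = j
                · subst hl; simp [hAi]; positivity
                · rw [abs_mul]
                  exact mul_le_mul (by exact_mod_cast hA l) (h1 l hl).le (abs_nonneg _) hr'.le
            _ = _ := by simp
        have h4 : r * |y j| < ε + m * (r * ε) + r / 4 := by
          rw [← abs_of_pos hr', ← abs_mul, abs_of_pos hr']
          have : (r : ℝ) * y j = (r * y j + ∑ l, (A l : ℝ) * y l + lam) - ∑ l, (A l : ℝ) * y l - lam := by
            ring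
          rw [this]
          refine (abs_sub _ _).trans_lt ?_
          have := abs_sub (r * y j + ∑ l, (A l : ℝ) * y l + lam) (∑ l, (A l : ℝ) * y l)
          linarith
        by_contra! h5
        have := mul_le_mul_of_nonneg_left h5 hr'.le
        nlinarith
      · have := h1 j hj
        nlinarith
    exact ⟨by linarith [(abs_lt.1 key).1], (abs_lt.1 key).2.le⟩
  have hvol := volume_integer_translates _ hdet
    (fun i => ∑ k, (p' i (.inl k) : ℝ) * ξ k) B hBm hBs
  have hV : volume B = ENNReal.ofReal ((2 * ε) ^ m / r) := by
    rw [hB, volume_sheared_cube i (fun l => (b l : ℝ)) (by simp only [hbi]; exact_mod_cast hr) lam hε]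
    simp [hbi]
  rw [← hV, ← hvol]
  refine measure_mono (Set.inter_subset_inter_right _ ?_)
  rintro γ ⟨x, hx, t, ht⟩
  refine ⟨Function.update x i t, ?_⟩
  have hy : ∀ j, ∑ l, ((Matrix.of fun i j => p' i (.inr j)) j l : ℝ) * γ l
      + ∑ k, (p' j (.inl k) : ℝ) * ξ k + (Function.update x i t j : ℤ) =
      Function.update (fun j => linForm ξ γ (p j, x j)) i (linForm ξ γ (z, t)) j := by
    intro j
    by_cases hj : j = i
    · subst hj
      simp [p', linForm_apply]
    · simp [p', hj, linForm_apply]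
  simp only [hy]
  constructor
  · intro j hj
    simp only [Function.update_of_ne hj]
    exact hx j
  · rw [hsum]
    have e : (p i, x i) = ((Sum.elim w.1 0, w.2) : (Fin 2 ⊕ Fin m → ℤ) × ℤ) + (r : ℤ) • (z, t)
        + ∑ j, A j • (p j, x j) := by
      refine Prod.ext ?_ ?_
      · funext k
        have := hz k
        simp only [Prod.fst_add, Prod.fst_sum, Prod.smul_fst, Pi.add_apply, Finset.sum_apply,
          Pi.smul_apply, smul_eq_mul]
        linarith
      · simp only [Prod.snd_add, Prod.snd_sum, Prod.smul_snd, smul_eq_mul]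
        linarith
    have e2 := congrArg (linForm ξ γ) e
    rw [map_add, map_add, map_sum, map_zsmul, zsmul_eq_mul,
      Finset.sum_congr rfl fun j _ => (map_zsmul (linForm ξ γ) (A j) (p j, x j)).trans
        (zsmul_eq_mul _ _)] at e2
    have e3 : linForm ξ γ (Sum.elim w.1 0, w.2) = lam := by
      simp [linForm_apply, hlam]
    rw [e3] at e2
    have e4 := hx i
    rw [e2] at e4
    convert e4 using 2
    push_cast
    ring

/-- Families of `m` integer vectors in boxes of side `N`, the projections of which to the last `m`
coordinates are close to `T` times the standard basis. -/
noncomputable def boxFamily (m T N : ℕ) : Finset (Fin m → Fin 2 ⊕ Fin m → ℤ) :=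
  Fintype.piFinset fun i => Fintype.piFinset fun k =>
    Finset.Ico (if k = .inr i then (T + m * N : ℤ) else 0)
      ((if k = .inr i then (T + m * N : ℤ) else 0) + N)

theorem mem_boxFamily {m T N : ℕ} {p : Fin m → Fin 2 ⊕ Fin m → ℤ} : p ∈ boxFamily m T N ↔
    ∀ i k, (if k = .inr i then (T + m * N : ℤ) else 0) ≤ p i k ∧
      p i k < (if k = .inr i then (T + m * N : ℤ) else 0) + N := by
  simp [boxFamily, Fintype.mem_piFinset]

theorem abs_coeff_lt_of_mem_boxFamily {m T N : ℕ} {p : Fin m → Fin 2 ⊕ Fin m → ℤ}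
    (hp : p ∈ boxFamily m T N) (μ q : Fin m → ℤ) {D : ℤ} (hD : D ≠ 0)
    (h : ∀ l, ∑ i, μ i * p i (.inr l) = D * q l) (hq : ∀ l, |q l| < T) (i : Fin m) :
    |μ i| < |D| := by
  rw [mem_boxFamily] at hp
  have : Nonempty (Fin m) := ⟨i⟩
  obtain ⟨j, hj⟩ := Finite.exists_max fun i => |μ i|
  refine (hj i).trans_lt ?_
  have h1 := h j
  rw [← Finset.add_sum_erase _ _ (Finset.mem_univ j)] at h1
  have h2 : |∑ i ∈ Finset.univ.erase j, μ i * p i (.inr j)| ≤ m * (|μ j| * N) := by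
    calc _ ≤ ∑ i ∈ Finset.univ.erase j, |μ i * p i (.inr j)| := Finset.abs_sum_le_sum_abs _ _
      _ ≤ ∑ i ∈ Finset.univ.erase j, (|μ j| * N : ℤ) := by
        refine Finset.sum_le_sum fun i hi => ?_
        have hij := (Finset.ne_of_mem_erase hi).symm
        have := hp i (.inr j)
        simp only [Sum.inr.injEq, hij, if_false] at this
        rw [abs_mul, abs_of_nonneg this.1]
        exact mul_le_mul (hj i) (by linarith) this.1 (abs_nonneg _)
      _ ≤ ∑ i : Fin m, (|μ j| * N : ℤ) :=
        Finset.sum_le_sum_of_subset_of_nonneg (Finset.erase_subset _ _) fun _ _ _ => by positivity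
      _ = _ := by simp
  have h3 := (hp j (.inr j)).1
  simp only [if_true] at h3
  have h4 : |μ j| * (T + m * N) ≤ |D| * |q j| + m * (|μ j| * N) := by
    calc |μ j| * (T + m * N) ≤ |μ j| * |p j (.inr j)| :=
        mul_le_mul_of_nonneg_left (h3.trans (le_abs_self _)) (abs_nonneg _)
      _ = |D * q j - ∑ i ∈ Finset.univ.erase j, μ i * p i (.inr j)| := by
        rw [← abs_mul]; congr 1; linarith
      _ ≤ _ := by
        refine (abs_sub _ _).trans ?_
        rw [abs_mul]; linarith
  have hDp : 0 < |D| := abs_pos.2 hD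
  have h5 := mul_lt_mul_of_pos_left (hq j) hDp
  have hT : (0 : ℤ) < T := (abs_nonneg _).trans_lt (hq j)
  nlinarith

theorem det_ne_zero_of_mem_boxFamily {m T N : ℕ} {p : Fin m → Fin 2 ⊕ Fin m → ℤ} (hT : 0 < T)
    (hp : p ∈ boxFamily m T N) : (Matrix.of fun i j => p i (.inr j)).det ≠ 0 := by
  intro h
  obtain ⟨μ, hμ, h0⟩ := Matrix.exists_vecMul_eq_zero_iff.2 h
  refine hμ (funext fun i => ?_)
  have := abs_coeff_lt_of_mem_boxFamily hp μ 0 one_ne_zero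
    (fun l => by simpa [Matrix.vecMul, dotProduct] using congrFun h0 l) (fun _ => by simpa using hT) i
  simpa [Int.abs_lt_one_iff] using this

theorem abs_det_le_prod_sum {m : ℕ} (Q : Matrix (Fin m) (Fin m) ℤ) :
    |Q.det| ≤ ∏ i, ∑ j, |Q j i| := by
  rw [Matrix.det_apply', Finset.prod_univ_sum (fun _ => Finset.univ) fun i j => |Q j i|]
  have h1 : ∀ σ : Equiv.Perm (Fin m), |((Equiv.Perm.sign σ : ℤˣ) : ℤ) * ∏ i, Q (σ i) i| =
      ∏ i, |Q (σ i) i| := by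
    intro σ
    rw [abs_mul, Finset.abs_prod]
    rcases Int.units_eq_one_or (Equiv.Perm.sign σ) with h | h <;> simp [h]
  refine (Finset.abs_sum_le_sum_abs _ _).trans ((Finset.sum_congr rfl fun σ _ => h1 σ).trans_le ?_)
  rw [← Finset.sum_image (s := Finset.univ) (g := fun σ : Equiv.Perm (Fin m) => (σ : Fin m → Fin m))
    (f := fun f => ∏ i, |Q (f i) i|) (fun a _ b _ h => DFunLike.coe_injective h)]
  exact Finset.sum_le_sum_of_subset_of_nonneg (fun f _ => by simp)
    fun _ _ _ => Finset.prod_nonneg fun _ _ => abs_nonneg _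

theorem sum_abs_le_of_mem_boxFamily {m T N : ℕ} {p : Fin m → Fin 2 ⊕ Fin m → ℤ}
    (hp : p ∈ boxFamily m T N) (l : Fin m) :
    ∑ i, |p i (.inr l)| ≤ (T + 2 * m * N : ℤ) := by
  rw [mem_boxFamily] at hp
  have h : ∀ i, |p i (.inr l)| ≤ N + if i = l then (T + m * N : ℤ) else 0 := by
    intro i
    have := hp i (.inr l)
    simp only [Sum.inr.injEq, eq_comm (a := l)] at this
    split_ifs at this ⊢
    · rw [abs_of_nonneg (by nlinarith [this.1])]
      linarith
    · rw [abs_of_nonneg this.1]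
      linarith
  refine (Finset.sum_le_sum fun i _ => h i).trans ?_
  rw [Finset.sum_add_distrib]
  simp
  linarith

theorem abs_det_le_of_mem_boxFamily {m T N : ℕ} (hm : 0 < m) {p : Fin m → Fin 2 ⊕ Fin m → ℤ}
    (hp : p ∈ boxFamily m T N) (hN : 100 * m ^ 2 * N ≤ T) :
    (|(Matrix.of fun i j => p i (.inr j)).det| : ℤ) * (0.98 : ℝ) ≤ (T : ℝ) ^ m := by
  have h1 : (|(Matrix.of fun i j => p i (.inr j)).det| : ℤ) ≤ (T + 2 * m * N : ℤ) ^ m := by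
    refine (abs_det_le_prod_sum _).trans ?_
    calc _ ≤ ∏ _i : Fin m, (T + 2 * m * N : ℤ) := Finset.prod_le_prod
            (fun _ _ => Finset.sum_nonneg fun _ _ => abs_nonneg _)
            (fun l _ => sum_abs_le_of_mem_boxFamily hp l)
      _ = _ := by simp
  have h2 : (|(Matrix.of fun i j => p i (.inr j)).det| : ℤ) ≤ (T + 2 * m * N : ℝ) ^ m := by
    exact_mod_cast h1
  have hm' : (0 : ℝ) < m := by exact_mod_cast hm
  have hN' : 100 * (m : ℝ) ^ 2 * N ≤ T := by exact_mod_cast hN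
  set x : ℝ := 1 / (50 * m) with hx
  have hx0 : 0 < x := by positivity
  have hmx : m * x = 1 / 50 := by rw [hx]; field_simp
  have hm1 : (1 : ℝ) ≤ m := by exact_mod_cast hm
  have hx1 : x ≤ 1 / 50 := by rw [← hmx]; nlinarith
  have h3 : (T + 2 * m * N : ℝ) ≤ T * (1 + x) := by
    have h4 : 2 * m * N = (100 * (m : ℝ) ^ 2 * N) * x := by rw [hx]; field_simp; ring
    rw [h4]; nlinarith
  have h5 : (0.98 : ℝ) ≤ (1 - x) ^ m := by
    have := one_add_mul_le_pow (a := -x) (by linarith) m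
    rw [← sub_eq_add_neg] at this
    linarith
  have h6 : (1 + x) ^ m * (1 - x) ^ m ≤ 1 := by
    rw [← mul_pow]
    exact pow_le_one₀ (by nlinarith) (by nlinarith)
  have hT : (0 : ℝ) ≤ T := by positivity
  calc _ ≤ (T * (1 + x)) ^ m * (0.98 : ℝ) := by
        gcongr
        exact h2.trans (pow_le_pow_left₀ (by positivity) h3 _)
    _ ≤ (T * (1 + x)) ^ m * (1 - x) ^ m := by gcongr
    _ = (T : ℝ) ^ m * ((1 + x) ^ m * (1 - x) ^ m) := by rw [mul_pow]; ring
    _ ≤ _ := mul_le_of_le_one_right (by positivity) h6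

theorem exists_eq_sum_of_smul_eq_sum {ι M : Type*} [Fintype ι] [AddCommGroup M]
    [Module.IsTorsionFree ℤ M] (g : ι → M)
    (hg : ∀ r : ℕ, r.Prime → ∀ (d : ι → ℤ) (y : M), ∑ i, d i • g i = (r : ℤ) • y →
      ∀ i, (r : ℤ) ∣ d i) (a : ℕ) :
    a ≠ 0 → ∀ (w : M) (d : ι → ℤ), (a : ℤ) • w = ∑ i, d i • g i →
      ∃ d' : ι → ℤ, w = ∑ i, d' i • g i := by
  induction a using induction_on_primes with
  | zero => intro h; exact absurd rfl h
  | one => intro _ w d h; exact ⟨d, by simpa using h⟩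
  | prime_mul r a hr ih =>
    intro h w d hw
    have hdvd := hg r hr d ((a : ℤ) • w) (by rw [← hw, smul_smul]; push_cast; rfl)
    choose d' hd' using hdvd
    refine ih (right_ne_zero_of_mul h) w d' ?_
    have hr0 : (r : ℤ) ≠ 0 := by exact_mod_cast hr.ne_zero
    refine smul_right_injective M hr0 ?_
    simp only [Finset.smul_sum, smul_smul]
    rw [← Nat.cast_mul, hw]
    simp [hd']

/-- The integer vectors consisting of the two vectors `(e s, e₃ s)` of `ℤ³` and of the `(p i, x i)`. -/
def joinVec {m : ℕ} (e : Fin 2 → Fin 2 → ℤ) (e₃ : Fin 2 → ℤ) (p : Fin m → Fin 2 ⊕ Fin m → ℤ)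
    (x : Fin m → ℤ) : Fin 2 ⊕ Fin m → (Fin 2 ⊕ Fin m → ℤ) × ℤ :=
  Sum.elim (fun s => (Sum.elim (e s) 0, e₃ s)) (fun i => (p i, x i))

theorem exists_smul_eq_sum_joinVec {m T N : ℕ} (hm : 0 < m) (hT : 0 < T)
    (hN : 100 * m ^ 2 * N ≤ T) {p : Fin m → Fin 2 ⊕ Fin m → ℤ} (hp : p ∈ boxFamily m T N)
    {e : Fin 2 → Fin 2 → ℤ} {e₃ : Fin 2 → ℤ} (he : ∀ s k, |e s k| ≤ T)
    (hne : e 0 0 * e 1 1 - e 0 1 * e 1 0 ≠ 0) {ξ : Fin 2 → ℝ} {c' : ℝ} (hc : 0 < c')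
    (hcT : c' * T ^ (m + 2) ≤ 1 / 8)
    (hLe : ∀ s, |∑ k, (e s k : ℝ) * ξ k + e₃ s| ≤ 1.01 * c') {γ : Fin m → ℝ} {x : Fin m → ℤ}
    (hLp : ∀ i, |linForm ξ γ (p i, x i)| * (100 * m) ≤ c')
    (w : (Fin 2 ⊕ Fin m → ℤ) × ℤ) (hw : ∀ k, |w.1 k| < T) (hLw : |linForm ξ γ w| ≤ c') :
    ∃ a : ℕ, a ≠ 0 ∧ ∃ d : Fin 2 ⊕ Fin m → ℤ, (a : ℤ) • w = ∑ k, d k • joinVec e e₃ p x k := by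
  set Q : Matrix (Fin m) (Fin m) ℤ := Matrix.of fun i j => p i (.inr j) with hQ
  set D := Q.det with hD
  have hD0 : D ≠ 0 := det_ne_zero_of_mem_boxFamily hT hp
  set C : Fin m → ℤ := Matrix.vecMul (fun j => w.1 (.inr j)) Q.adjugate with hC
  have hCQ : ∀ l, ∑ i, C i * p i (.inr l) = D * w.1 (.inr l) := by
    intro l
    have : Matrix.vecMul C Q = fun l => D * w.1 (.inr l) := by
      rw [hC, Matrix.vecMul_vecMul, Matrix.adjugate_mul, Matrix.vecMul_smul, Matrix.vecMul_one]
      rfl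
    exact congrFun this l
  have hCD : ∀ i, |C i| ≤ |D| := fun i =>
    (abs_coeff_lt_of_mem_boxFamily hp C _ hD0 hCQ (fun l => hw _) i).le
  set W : (Fin 2 ⊕ Fin m → ℤ) × ℤ := D • w - ∑ i, C i • (p i, x i) with hW
  have hW1 : ∀ k, W.1 k = D * w.1 k - ∑ i, C i * p i k := by
    intro k
    simp [hW, Prod.fst_sum, Finset.sum_apply]
  have hWr : ∀ l, W.1 (.inr l) = 0 := fun l => by rw [hW1, hCQ, sub_self]
  have hLW : linForm ξ γ W = W.1 (.inl 0) * ξ 0 + W.1 (.inl 1) * ξ 1 + W.2 := by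
    have := linForm_apply ξ γ W.1 W.2
    rw [Prod.mk.eta] at this
    rw [this]
    simp [hWr, Fin.sum_univ_two]
  have hm' : (1 : ℝ) ≤ m := by exact_mod_cast hm
  have hDp : (0 : ℝ) < |(D : ℝ)| := abs_pos.2 (by exact_mod_cast hD0)
  have hCDr : ∀ i, |(C i : ℝ)| ≤ |(D : ℝ)| := fun i => by exact_mod_cast hCD i
  have hLWb : |linForm ξ γ W| ≤ 1.01 * c' * |(D : ℝ)| := by
    have e1 : linForm ξ γ W = D * linForm ξ γ w - ∑ i, C i * linForm ξ γ (p i, x i) := by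
      rw [hW, map_sub, map_sum, map_zsmul, zsmul_eq_mul]
      congr 1
      exact Finset.sum_congr rfl fun j _ => (map_zsmul (linForm ξ γ) (C j) (p j, x j)).trans
        (zsmul_eq_mul _ _)
    rw [e1]
    refine (abs_sub _ _).trans ?_
    have e2 : |∑ i, C i * linForm ξ γ (p i, x i)| ≤ |(D : ℝ)| * (c' / 100) := by
      calc _ ≤ ∑ i, |C i * linForm ξ γ (p i, x i)| := Finset.abs_sum_le_sum_abs _ _
        _ ≤ ∑ _i : Fin m, |(D : ℝ)| * (c' / (100 * m)) := by
          refine Finset.sum_le_sum fun i _ => ?_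
          rw [abs_mul]
          refine mul_le_mul (hCDr i) ?_ (abs_nonneg _) (abs_nonneg _)
          rw [le_div_iff₀ (by positivity)]
          exact hLp i
        _ = _ := by
          simp
          field_simp
    rw [abs_mul]
    nlinarith
  have hmN : (m : ℝ) * N * 100 ≤ T := by
    have : 100 * (m : ℝ) ^ 2 * N ≤ T := by exact_mod_cast hN
    nlinarith [mul_nonneg (Nat.cast_nonneg (α := ℝ) m) (Nat.cast_nonneg (α := ℝ) N)]
  have hWb : ∀ k, |(W.1 (.inl k) : ℝ)| ≤ 1.01 * T * |(D : ℝ)| := by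
    intro k
    rw [hW1]
    push_cast
    refine (abs_sub _ _).trans ?_
    have e2 : |∑ i, (C i : ℝ) * p i (.inl k)| ≤ |(D : ℝ)| * (m * N) := by
      calc _ ≤ ∑ i, |(C i : ℝ) * p i (.inl k)| := Finset.abs_sum_le_sum_abs _ _
        _ ≤ ∑ _i : Fin m, |(D : ℝ)| * N := by
          refine Finset.sum_le_sum fun i _ => ?_
          rw [abs_mul]
          refine mul_le_mul (hCDr i) ?_ (abs_nonneg _) (abs_nonneg _)
          have := mem_boxFamily.1 hp i (.inl k)
          simp only [reduceCtorEq, if_false, zero_add] at this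
          rw [abs_of_nonneg (by exact_mod_cast this.1)]
          exact_mod_cast this.2.le
        _ = _ := by
          simp
          ring
    rw [abs_mul]
    have : |(w.1 (.inl k) : ℝ)| ≤ T := by exact_mod_cast (hw (.inl k)).le
    nlinarith
  have hheD : |(D : ℝ)| * 0.98 ≤ (T : ℝ) ^ m := by
    have := abs_det_le_of_mem_boxFamily hm hp hN
    rw [Int.cast_abs] at this
    exact this
  have heb : ∀ s k, |(e s k : ℝ)| ≤ T := fun s k => by exact_mod_cast he s k
  have hdet : e₃ 0 * (e 1 0 * W.1 (.inl 1) - e 1 1 * W.1 (.inl 0))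
      - e₃ 1 * (e 0 0 * W.1 (.inl 1) - e 0 1 * W.1 (.inl 0))
      + W.2 * (e 0 0 * e 1 1 - e 0 1 * e 1 0) = 0 := by
    rw [← Int.abs_lt_one_iff]
    have : ((e₃ 0 * (e 1 0 * W.1 (.inl 1) - e 1 1 * W.1 (.inl 0))
      - e₃ 1 * (e 0 0 * W.1 (.inl 1) - e 0 1 * W.1 (.inl 0))
      + W.2 * (e 0 0 * e 1 1 - e 0 1 * e 1 0) : ℤ) : ℝ) =
        (∑ k, (e 0 k : ℝ) * ξ k + e₃ 0) * (e 1 0 * W.1 (.inl 1) - e 1 1 * W.1 (.inl 0))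
      - (∑ k, (e 1 k : ℝ) * ξ k + e₃ 1) * (e 0 0 * W.1 (.inl 1) - e 0 1 * W.1 (.inl 0))
      + linForm ξ γ W * (e 0 0 * e 1 1 - e 0 1 * e 1 0) := by
      rw [hLW, Fin.sum_univ_two, Fin.sum_univ_two]
      push_cast
      ring
    have hT0 : (0 : ℝ) ≤ T := by positivity
    have b1 : ∀ (s : Fin 2), |((e s 0 : ℝ) * W.1 (.inl 1) - e s 1 * W.1 (.inl 0))| ≤
        2 * (T * (1.01 * T * |(D : ℝ)|)) := by
      intro s
      refine (abs_sub _ _).trans ?_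
      rw [abs_mul, abs_mul]
      have := mul_le_mul (heb s 0) (hWb 1) (abs_nonneg _) hT0
      have := mul_le_mul (heb s 1) (hWb 0) (abs_nonneg _) hT0
      linarith
    have b2 : |((e 0 0 : ℝ) * e 1 1 - e 0 1 * e 1 0)| ≤ 2 * (T * T) := by
      refine (abs_sub _ _).trans ?_
      rw [abs_mul, abs_mul]
      have := mul_le_mul (heb 0 0) (heb 1 1) (abs_nonneg _) hT0
      have := mul_le_mul (heb 0 1) (heb 1 0) (abs_nonneg _) hT0
      linarith
    have key : |((e₃ 0 * (e 1 0 * W.1 (.inl 1) - e 1 1 * W.1 (.inl 0))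
      - e₃ 1 * (e 0 0 * W.1 (.inl 1) - e 0 1 * W.1 (.inl 0))
      + W.2 * (e 0 0 * e 1 1 - e 0 1 * e 1 0) : ℤ) : ℝ)| < 1 := by
      rw [this]
      have t1 := mul_le_mul (hLe 0) (b1 1) (abs_nonneg _) (by positivity)
      have t2 := mul_le_mul (hLe 1) (b1 0) (abs_nonneg _) (by positivity)
      have t3 := mul_le_mul hLWb b2 (abs_nonneg _) (by positivity)
      rw [← abs_mul] at t1 t2 t3
      refine (abs_add_le _ _).trans_lt ?_
      have t4 := abs_sub ((∑ k, (e 0 k : ℝ) * ξ k + e₃ 0) *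
        (e 1 0 * W.1 (.inl 1) - e 1 1 * W.1 (.inl 0)))
        ((∑ k, (e 1 k : ℝ) * ξ k + e₃ 1) * (e 0 0 * W.1 (.inl 1) - e 0 1 * W.1 (.inl 0)))
      have t5 : c' * T ^ 2 * (|(D : ℝ)| * 0.98) ≤ 1 / 8 := by
        calc c' * T ^ 2 * (|(D : ℝ)| * 0.98) ≤ c' * T ^ 2 * T ^ m :=
              mul_le_mul_of_nonneg_left hheD (by positivity)
          _ = c' * T ^ (m + 2) := by ring
          _ ≤ 1 / 8 := hcT
      have t6 : 0 ≤ c' * T ^ 2 * |(D : ℝ)| := by positivity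
      nlinarith
    exact_mod_cast key
  set N₃ := e 0 0 * e 1 1 - e 0 1 * e 1 0 with hN₃
  have hsmul : (N₃ * D) • w = ∑ k, Sum.elim
      ![W.1 (.inl 0) * e 1 1 - W.1 (.inl 1) * e 1 0, e 0 0 * W.1 (.inl 1) - e 0 1 * W.1 (.inl 0)]
      (fun i => N₃ * C i) k • joinVec e e₃ p x k := by
    have h1 : N₃ • W = (W.1 (.inl 0) * e 1 1 - W.1 (.inl 1) * e 1 0) • joinVec e e₃ p x (.inl 0) +
        (e 0 0 * W.1 (.inl 1) - e 0 1 * W.1 (.inl 0)) • joinVec e e₃ p x (.inl 1) := by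
      refine Prod.ext (funext fun k => ?_) ?_
      · rcases k with k | k
        · simp only [joinVec, Sum.elim_inl, Prod.smul_fst, Prod.fst_add, Pi.smul_apply,
            Pi.add_apply, smul_eq_mul]
          fin_cases k <;> simp only [Fin.zero_eta, Fin.mk_one, hN₃] <;> ring
        · simp [joinVec, hWr]
      · simp only [joinVec, Sum.elim_inl, Prod.smul_snd, Prod.snd_add, smul_eq_mul]
        linarith
    have h2 : (N₃ * D) • w = N₃ • W + ∑ i, (N₃ * C i) • (p i, x i) := by
      rw [hW, smul_sub, smul_smul, Finset.smul_sum]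
      simp only [smul_smul, sub_add_cancel]
    rw [h2, h1, Fintype.sum_sum_type, Fin.sum_univ_two]
    rfl
  refine ⟨(N₃ * D).natAbs, by simp [hne, hD0], ?_⟩
  rcases Int.natAbs_eq (N₃ * D) with h | h
  · rw [← h, hsmul]; exact ⟨_, rfl⟩
  · have : ((N₃ * D).natAbs : ℤ) = -(N₃ * D) := by linarith
    rw [this, neg_smul, hsmul, ← Finset.sum_neg_distrib]
    refine ⟨fun k => -_, Finset.sum_congr rfl fun k _ => (neg_smul _ _).symm⟩

/-- Reduced coefficient vectors modulo `r` supported on the first `2 + i` coordinates. -/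
noncomputable def coeffs (m r : ℕ) (i : Fin m) : Finset (Fin 2 ⊕ Fin m → ℤ) :=
  Fintype.piFinset (Sum.elim (fun _ => Finset.Ico 0 (r : ℤ))
    (fun j => if j < i then Finset.Ico 0 (r : ℤ) else {0}))

theorem mem_coeffs {m r : ℕ} {i : Fin m} {A : Fin 2 ⊕ Fin m → ℤ} : A ∈ coeffs m r i ↔
    (∀ s, 0 ≤ A (.inl s) ∧ A (.inl s) < r) ∧
    (∀ j, (j < i → 0 ≤ A (.inr j) ∧ A (.inr j) < r) ∧ (¬ j < i → A (.inr j) = 0)) := by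
  simp only [coeffs, Fintype.mem_piFinset, Sum.forall, Sum.elim_inl, Sum.elim_inr, Finset.mem_Ico]
  refine and_congr_right fun _ => forall_congr' fun j => ?_
  by_cases h : j < i <;> simp [h]

/-- The `i`-th vector of `p` is congruent modulo `r` to a combination of the others. -/
def IsCong {m : ℕ} (e : Fin 2 → Fin 2 → ℤ) (p : Fin m → Fin 2 ⊕ Fin m → ℤ) (r : ℕ) (i : Fin m)
    (A : Fin 2 ⊕ Fin m → ℤ) : Prop :=
  ∀ k, (r : ℤ) ∣ p i k - Sum.elim (fun l => ∑ s, A (.inl s) * e s l) 0 k - ∑ j, A (.inr j) * p j k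

theorem sum_update_sub {m : ℕ} (i : Fin m) (A g : Fin 2 ⊕ Fin m → ℤ) :
    ∑ k, ((if k = .inr i then 1 else 0) - A k) * g k =
      g (.inr i) - ∑ s, A (.inl s) * g (.inl s) - ∑ j, A (.inr j) * g (.inr j) := by
  simp only [sub_mul, Finset.sum_sub_distrib, ite_mul, one_mul, zero_mul, Finset.sum_ite_eq',
    Finset.mem_univ, if_true, Fintype.sum_sum_type (fun k => A k * g k)]
  ring

theorem exists_coeffs_of_relation {m : ℕ} {r : ℕ} (hr : r.Prime) (d : Fin 2 ⊕ Fin m → ℤ) (l : Fin m)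
    (hl : ¬ (r : ℤ) ∣ d (.inr l)) : ∃ i : Fin m, ∃ A ∈ coeffs m r i,
      ∀ g : Fin 2 ⊕ Fin m → ℤ, (r : ℤ) ∣ ∑ k, d k * g k →
        (r : ℤ) ∣ g (.inr i) - ∑ s, A (.inl s) * g (.inl s) - ∑ j, A (.inr j) * g (.inr j) := by
  classical
  have hne : (Finset.univ.filter fun j : Fin m => ¬ (r : ℤ) ∣ d (.inr j)).Nonempty :=
    ⟨l, by simpa using hl⟩
  set i := Finset.max' _ hne with hi
  have hir : ¬ (r : ℤ) ∣ d (.inr i) := by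
    have := Finset.max'_mem _ hne
    exact (Finset.mem_filter.1 this).2
  have hgt : ∀ j, i < j → (r : ℤ) ∣ d (.inr j) := by
    intro j hj
    by_contra h
    exact absurd (Finset.le_max' _ j (Finset.mem_filter.2 ⟨Finset.mem_univ _, h⟩)) (not_le.2 hj)
  have hr0 : (0 : ℤ) < r := by exact_mod_cast hr.pos
  obtain ⟨a, b, hab⟩ : IsCoprime (d (.inr i)) (r : ℤ) :=
    ((Nat.prime_iff_prime_int.1 hr).coprime_iff_not_dvd.2 hir).symm
  let A : Fin 2 ⊕ Fin m → ℤ := Sum.elim (fun s => (-a * d (.inl s)) % r)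
    (fun j => if j < i then (-a * d (.inr j)) % r else 0)
  refine ⟨i, A, ?_, ?_⟩
  · rw [mem_coeffs]
    refine ⟨fun s => ⟨Int.emod_nonneg _ hr0.ne', Int.emod_lt_of_pos _ hr0⟩, fun j => ⟨fun h => ?_,
      fun h => by simp [A, h]⟩⟩
    simp only [A, Sum.elim_inr, h, if_true]
    exact ⟨Int.emod_nonneg _ hr0.ne', Int.emod_lt_of_pos _ hr0⟩
  · intro g hg
    rw [← sum_update_sub]
    have hk : ∀ k, (r : ℤ) ∣ ((if k = .inr i then 1 else 0) - A k) - a * d k := by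
      have hmod : ∀ t : ℤ, (r : ℤ) ∣ 0 - (-a * t) % r - a * t := by
        intro t
        refine ⟨(-a * t) / r, ?_⟩
        have := Int.mul_ediv_add_emod (-a * t) r
        linarith
      intro k
      rcases k with s | j
      · simpa [A] using hmod (d (.inl s))
      · rcases lt_trichotomy j i with h | h | h
        · simpa [A, h, h.ne] using hmod (d (.inr j))
        · subst h
          simp only [A, if_true, Sum.elim_inr, lt_irrefl, if_false]
          exact ⟨b, by linarith⟩
        · simpa [A, h.ne', h.not_gt] using (hgt j h).mul_left a
    have : ∑ k, ((if k = .inr i then 1 else 0) - A k) * g k =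
        ∑ k, (((if k = .inr i then 1 else 0) - A k) - a * d k) * g k + a * ∑ k, d k * g k := by
      rw [Finset.mul_sum, ← Finset.sum_add_distrib]
      exact Finset.sum_congr rfl fun k _ => by ring
    rw [this]
    exact dvd_add (Finset.dvd_sum fun k _ => (hk k).mul_right _) (hg.mul_left _)

theorem exists_isCong_of_bad {m T N : ℕ} (hm : 0 < m) (hT : 0 < T)
    (hN : 100 * m ^ 2 * N ≤ T) {p : Fin m → Fin 2 ⊕ Fin m → ℤ} (hp : p ∈ boxFamily m T N)
    {e : Fin 2 → Fin 2 → ℤ} {e₃ : Fin 2 → ℤ} (he : ∀ s k, |e s k| ≤ T)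
    (hne : e 0 0 * e 1 1 - e 0 1 * e 1 0 ≠ 0)
    (hprim : ∀ r : ℕ, r.Prime → ∀ d : Fin 2 → ℤ, (∀ k, (r : ℤ) ∣ ∑ s, d s * e s k) →
      (r : ℤ) ∣ ∑ s, d s * e₃ s → ∀ s, (r : ℤ) ∣ d s) {ξ : Fin 2 → ℝ} {c' : ℝ} (hc : 0 < c')
    (hcT : c' * T ^ (m + 2) ≤ 1 / 8)
    (hLe : ∀ s, |∑ k, (e s k : ℝ) * ξ k + e₃ s| ≤ 1.01 * c') {γ : Fin m → ℝ} {x : Fin m → ℤ}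
    (hLp : ∀ i, |linForm ξ γ (p i, x i)| * (100 * m) ≤ c')
    (w : (Fin 2 ⊕ Fin m → ℤ) × ℤ) (hw : ∀ k, |w.1 k| < T) (hLw : |linForm ξ γ w| ≤ c')
    (hw0 : ∃ j, w.1 (.inr j) ≠ 0) :
    ∃ r : ℕ, r.Prime ∧ ∃ i : Fin m, ∃ A ∈ coeffs m r i, IsCong e p r i A ∧
      (r : ℤ) ∣ x i - ∑ s, A (.inl s) * e₃ s - ∑ j, A (.inr j) * x j := by
  obtain ⟨a, ha, d, hd⟩ := exists_smul_eq_sum_joinVec hm hT hN hp he hne hc hcT hLe hLp w hw hLw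
  have hfst : ∀ (d : Fin 2 ⊕ Fin m → ℤ) (l : Fin 2 ⊕ Fin m),
      (∑ k, d k • joinVec e e₃ p x k).1 l = ∑ k, d k * (joinVec e e₃ p x k).1 l := by
    intro d l
    simp [Prod.fst_sum, Finset.sum_apply]
  have hsnd : ∀ (d : Fin 2 ⊕ Fin m → ℤ),
      (∑ k, d k • joinVec e e₃ p x k).2 = ∑ k, d k * (joinVec e e₃ p x k).2 := by
    intro d
    simp [Prod.snd_sum]
  by_contra hcon
  have hall : ∀ r : ℕ, r.Prime → ∀ (d : Fin 2 ⊕ Fin m → ℤ) (y : (Fin 2 ⊕ Fin m → ℤ) × ℤ),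
      ∑ i, d i • joinVec e e₃ p x i = (r : ℤ) • y → ∀ i, (r : ℤ) ∣ d i := by
    intro r hr d y hy
    have h1 : ∀ l, (r : ℤ) ∣ ∑ k, d k * (joinVec e e₃ p x k).1 l := fun l => by
      rw [← hfst, hy]; exact ⟨y.1 l, rfl⟩
    have h2 : (r : ℤ) ∣ ∑ k, d k * (joinVec e e₃ p x k).2 := by
      rw [← hsnd, hy]; exact ⟨y.2, rfl⟩
    have hinr : ∀ j, (r : ℤ) ∣ d (.inr j) := by
      by_contra! h
      obtain ⟨l, hl⟩ := h
      obtain ⟨i, A, hA, hg⟩ := exists_coeffs_of_relation hr d l hl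
      refine hcon ⟨r, hr, i, A, hA, fun k => ?_, hg _ h2⟩
      have := hg _ (h1 k)
      convert this using 2
      · rcases k with k | k <;> simp [joinVec]
      · rfl
    have hinl := hprim r hr (fun s => d (.inl s)) (fun k => by
      have := h1 (.inl k)
      rw [Fintype.sum_sum_type] at this
      exact (dvd_add_left (Finset.dvd_sum fun j _ => (hinr j).mul_right _)).1 this) (by
      rw [Fintype.sum_sum_type] at h2
      exact (dvd_add_left (Finset.dvd_sum fun j _ => (hinr j).mul_right _)).1 h2)
    rintro (s | j)
    exacts [hinl s, hinr j]
  obtain ⟨d', hd'⟩ := exists_eq_sum_of_smul_eq_sum _ hall a ha w d hd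
  have hq : ∀ l, ∑ i, d' (.inr i) * p i (.inr l) = 1 * w.1 (.inr l) := by
    intro l
    rw [hd', hfst, Fintype.sum_sum_type]
    simp [joinVec]
  have hz : ∀ i, d' (.inr i) = 0 := fun i => by
    simpa [Int.abs_lt_one_iff] using
      abs_coeff_lt_of_mem_boxFamily hp (fun i => d' (.inr i)) (fun l => w.1 (.inr l)) one_ne_zero hq
        (fun l => hw _) i
  obtain ⟨j, hj⟩ := hw0
  refine hj ?_
  have := hq j
  simp only [hz, zero_mul, Finset.sum_const_zero, one_mul] at this
  exact this.symm

theorem dvd_det_mul_of_dvd_vecMul {ι : Type*} [Fintype ι] [DecidableEq ι] (X : Matrix ι ι ℤ)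
    (f : ι → ℤ) (r : ℤ) (h : ∀ k, r ∣ ∑ l, f l * X l k) (k : ι) : r ∣ X.det * f k := by
  have h1 : Matrix.vecMul (Matrix.vecMul f X) X.adjugate k = X.det * f k := by
    rw [Matrix.vecMul_vecMul, Matrix.mul_adjugate, Matrix.vecMul_smul, Matrix.vecMul_one]
    rfl
  rw [← h1]
  exact Finset.dvd_sum fun l _ => (h l).mul_right _

/-- The square matrix with rows `(e s, 0)` and `p j`. -/
def joinMatrix {m : ℕ} (e : Fin 2 → Fin 2 → ℤ) (p : Fin m → Fin 2 ⊕ Fin m → ℤ) :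
    Matrix (Fin 2 ⊕ Fin m) (Fin 2 ⊕ Fin m) ℤ :=
  Matrix.of (Sum.elim (fun s => Sum.elim (e s) 0) p)

theorem det_joinMatrix {m : ℕ} (e : Fin 2 → Fin 2 → ℤ) (p : Fin m → Fin 2 ⊕ Fin m → ℤ) :
    (joinMatrix e p).det =
      (e 0 0 * e 1 1 - e 0 1 * e 1 0) * (Matrix.of fun i j => p i (.inr j)).det := by
  have h : joinMatrix e p = Matrix.fromBlocks (Matrix.of e) 0 (Matrix.of fun i j => p i (.inl j))
      (Matrix.of fun i j => p i (.inr j)) := by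
    ext a b
    rcases a with a | a <;> rcases b with b | b <;> rfl
  rw [h, Matrix.det_fromBlocks_zero₁₂, Matrix.det_fin_two]
  rfl

/-- Replace the vectors of `p` from the `i`-th one on by fixed ones. -/
def truncate (T N : ℕ) {m : ℕ} (i : ℕ) (p : Fin m → Fin 2 ⊕ Fin m → ℤ) :
    Fin m → Fin 2 ⊕ Fin m → ℤ :=
  fun j => if (j : ℕ) < i then p j else Pi.single (.inr j) (T + m * N : ℤ)

theorem truncate_mem_boxFamily {m T N : ℕ} (hN : 0 < N) (i : ℕ) {p : Fin m → Fin 2 ⊕ Fin m → ℤ}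
    (hp : p ∈ boxFamily m T N) : truncate T N i p ∈ boxFamily m T N := by
  rw [mem_boxFamily] at hp ⊢
  intro j k
  by_cases h : (j : ℕ) < i
  · simpa only [truncate, h, if_true] using hp j k
  · by_cases hk : k = .inr j
    · simp [truncate, h, hk, hN]
    · simp [truncate, h, hk, hN]

theorem truncate_update {m T N : ℕ} (i : Fin m) (p : Fin m → Fin 2 ⊕ Fin m → ℤ)
    (x : Fin 2 ⊕ Fin m → ℤ) :
    truncate T N (i : ℕ) (Function.update p i x) = truncate T N (i : ℕ) p := by
  funext j
  unfold truncate
  split_ifs with h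
  · rw [Function.update_of_ne (by rintro rfl; exact lt_irrefl _ h)]
  · rfl

/-- The determinant controlling the congruences for the `i`-th vector. -/
def truncDet (T N : ℕ) {m : ℕ} (e : Fin 2 → Fin 2 → ℤ) (i : ℕ)
    (p : Fin m → Fin 2 ⊕ Fin m → ℤ) : ℤ :=
  (joinMatrix e (truncate T N i p)).det

theorem truncDet_ne_zero {m T N : ℕ} (hT : 0 < T) (hN : 0 < N) {e : Fin 2 → Fin 2 → ℤ}
    (hne : e 0 0 * e 1 1 - e 0 1 * e 1 0 ≠ 0) (i : ℕ) {p : Fin m → Fin 2 ⊕ Fin m → ℤ}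
    (hp : p ∈ boxFamily m T N) : truncDet T N e i p ≠ 0 := by
  unfold truncDet
  rw [det_joinMatrix]
  exact mul_ne_zero hne (det_ne_zero_of_mem_boxFamily hT (truncate_mem_boxFamily hN i hp))

theorem abs_truncDet_le {m T N : ℕ} (hm : 0 < m) (hN : 0 < N) (hNT : 100 * m ^ 2 * N ≤ T)
    {e : Fin 2 → Fin 2 → ℤ} (he : ∀ s k, |e s k| ≤ T) (i : ℕ)
    {p : Fin m → Fin 2 ⊕ Fin m → ℤ} (hp : p ∈ boxFamily m T N) :
    |truncDet T N e i p| ≤ (m + 2).factorial * (2 * T : ℤ) ^ (m + 2) := by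
  have hmN : (m : ℤ) * N + N ≤ T := by
    have : m * N + N ≤ 100 * m ^ 2 * N := by nlinarith [mul_pos hm hN, mul_pos (mul_pos hm hm) hN, Nat.mul_le_mul_right N (Nat.le_mul_self m), Nat.mul_le_mul_right N hm]
    exact_mod_cast this.trans hNT
  have h := mem_boxFamily.1 (truncate_mem_boxFamily hN i hp)
  have := Matrix.det_le (abv := AbsoluteValue.abs) (A := joinMatrix e (truncate T N i p))
    (x := (2 * T : ℤ)) (by
      rintro (s | j) k
      · rcases k with k | k
        · change |e s k| ≤ _
          have := he s k
          linarith
        · change |(0 : ℤ)| ≤ _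
          simp
      · change |truncate T N i p j k| ≤ _
        have := h j k
        have h0 : (0 : ℤ) ≤ T + m * N := by positivity
        split_ifs at this
        · rw [abs_of_nonneg (by linarith)]; linarith
        · rw [abs_of_nonneg (by linarith)]
          have : (0 : ℤ) ≤ m * N := by positivity
          linarith)
  simpa [truncDet, add_comm] using this

theorem sum_mul_joinMatrix {m T N : ℕ} {e : Fin 2 → Fin 2 → ℤ}
    {p : Fin m → Fin 2 ⊕ Fin m → ℤ} (i : ℕ) (f : Fin 2 ⊕ Fin m → ℤ)
    (hf : ∀ j : Fin m, ¬ (j : ℕ) < i → f (.inr j) = 0) (k : Fin 2 ⊕ Fin m) :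
    ∑ l, f l * joinMatrix e (truncate T N i p) l k =
      Sum.elim (fun l => ∑ s, f (.inl s) * e s l) 0 k + ∑ j, f (.inr j) * p j k := by
  rw [Fintype.sum_sum_type]
  congr 1
  · rcases k with k | k <;> simp [joinMatrix]
  · refine Finset.sum_congr rfl fun j _ => ?_
    by_cases h : (j : ℕ) < i
    · simp [joinMatrix, truncate, h]
    · simp [hf j h]

theorem IsCong.eq_of_not_dvd {m T N : ℕ} {e : Fin 2 → Fin 2 → ℤ}
    {p : Fin m → Fin 2 ⊕ Fin m → ℤ} {r : ℕ} (hr : r.Prime) {i : Fin m}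
    (hd : ¬ (r : ℤ) ∣ truncDet T N e i p) {A A' : Fin 2 ⊕ Fin m → ℤ} (hA : A ∈ coeffs m r i)
    (hA' : A' ∈ coeffs m r i) (h : IsCong e p r i A) (h' : IsCong e p r i A') : A = A' := by
  rw [mem_coeffs] at hA hA'
  have hdv := dvd_det_mul_of_dvd_vecMul (joinMatrix e (truncate T N i p)) (fun k => A k - A' k) r
    (fun k => by
      rw [sum_mul_joinMatrix i (fun k => A k - A' k) (fun j hj => by
        have hj' : ¬ j < i := hj
        simp [(hA.2 j).2 hj', (hA'.2 j).2 hj']) k]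
      have h2 : Sum.elim (fun l => ∑ s, (A (.inl s) - A' (.inl s)) * e s l) 0 k +
          ∑ j, (A (.inr j) - A' (.inr j)) * p j k =
          (p i k - Sum.elim (fun l => ∑ s, A' (.inl s) * e s l) 0 k - ∑ j, A' (.inr j) * p j k) -
          (p i k - Sum.elim (fun l => ∑ s, A (.inl s) * e s l) 0 k - ∑ j, A (.inr j) * p j k) := by
        rcases k with k | k <;> simp only [Sum.elim_inl, Sum.elim_inr, Pi.zero_apply, sub_mul,
          Finset.sum_sub_distrib] <;> abel
      rw [h2]
      exact dvd_sub (h' k) (h k))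
  funext k
  have h1 := ((Nat.prime_iff_prime_int.1 hr).dvd_or_dvd (hdv k)).resolve_left hd
  have hr0 : (0 : ℤ) < r := by exact_mod_cast hr.pos
  have hb : ∀ A : Fin 2 ⊕ Fin m → ℤ, ((∀ s, 0 ≤ A (.inl s) ∧ A (.inl s) < r) ∧
    (∀ j, (j < i → 0 ≤ A (.inr j) ∧ A (.inr j) < r) ∧ (¬ j < i → A (.inr j) = 0))) →
      0 ≤ A k ∧ A k < r := by
    intro A hA
    rcases k with s | j
    · exact hA.1 s
    · by_cases hj : j < i
      · exact (hA.2 j).1 hj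
      · rw [(hA.2 j).2 hj]; exact ⟨le_rfl, hr0⟩
  have b := hb A hA
  have b' := hb A' hA'
  have := Int.eq_zero_of_abs_lt_dvd h1 (abs_lt.2 ⟨by linarith, by linarith⟩)
  linarith

theorem IsCong.dvd_truncDet {m T N : ℕ} {e : Fin 2 → Fin 2 → ℤ}
    {p : Fin m → Fin 2 ⊕ Fin m → ℤ} {r : ℕ} {i : Fin m}
    {A : Fin 2 ⊕ Fin m → ℤ} (hA : A ∈ coeffs m r i)
    (h : IsCong e p r i A) : (r : ℤ) ∣ truncDet T N e (i + 1) p := by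
  rw [mem_coeffs] at hA
  have hdv := dvd_det_mul_of_dvd_vecMul (joinMatrix e (truncate T N (i + 1) p))
    (fun k => (if k = .inr i then 1 else 0) - A k) r
    (fun k => by
      rw [sum_mul_joinMatrix (i + 1) (fun k => (if k = .inr i then 1 else 0) - A k) (fun j hj => by
        have hj' : i < j := by rw [Fin.lt_def]; omega
        simp [(hA.2 j).2 hj'.not_gt, hj'.ne']) k]
      have := h k
      convert this using 1
      have e1 : ∑ j, ((if (Sum.inr j : Fin 2 ⊕ Fin m) = .inr i then 1 else 0) - A (.inr j)) * p j k =
          p i k - ∑ j, A (.inr j) * p j k := by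
        simp [sub_mul, Finset.sum_sub_distrib]
      rw [e1]
      rcases k with k | k <;> simp
      ring) (.inr i)
  simpa [truncDet, (hA.2 i).2 (lt_irrefl _)] using hdv

theorem card_filter_piFinset_mul_card_le {ι α : Type*} [Fintype ι] [DecidableEq ι] [DecidableEq α]
    (t : ι → Finset α) (i : ι) (S : (ι → α) → Prop) [DecidablePred S] {K : ℕ}
    (h : ∀ p ∈ Fintype.piFinset t, ((t i).filter fun x => S (Function.update p i x)).card ≤ K) :
    ((Fintype.piFinset t).filter S).card * (t i).card ≤ K * (Fintype.piFinset t).card := by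
  rw [← Finset.card_product]
  calc _ ≤ ((Fintype.piFinset t).sigma
        fun p => (t i).filter fun x => S (Function.update p i x)).card := by
        refine Finset.card_le_card_of_injOn
          (fun q => (⟨Function.update q.1 i q.2, q.1 i⟩ : Σ _ : ι → α, α)) ?_ ?_
        · rintro ⟨p, y⟩ hq
          simp only [Finset.coe_product, Set.mem_prod, Finset.mem_coe, Finset.mem_filter,
            Fintype.mem_piFinset] at hq
          simp only [Finset.mem_coe, Finset.mem_sigma, Finset.mem_filter, Function.update_idem,
            Function.update_eq_self, Fintype.mem_piFinset]
          refine ⟨fun j => ?_, hq.1.1 i, hq.1.2⟩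
          by_cases hj : j = i
          · subst hj; simpa using hq.2
          · simpa [hj] using hq.1.1 j
        · rintro ⟨p, y⟩ - ⟨p', y'⟩ - heq
          simp only [Sigma.mk.injEq, heq_eq_eq] at heq
          obtain ⟨h1, h2⟩ := heq
          have hy : y = y' := by simpa using congrFun h1 i
          subst hy
          refine Prod.ext (funext fun j => ?_) rfl
          by_cases hj : j = i
          · subst hj; exact h2
          · simpa [hj] using congrFun h1 j
    _ = ∑ p ∈ Fintype.piFinset t, ((t i).filter fun x => S (Function.update p i x)).card :=
      Finset.card_sigma _ _
    _ ≤ ∑ p ∈ Fintype.piFinset t, K := Finset.sum_le_sum h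
    _ = _ := by rw [Finset.sum_const, smul_eq_mul, mul_comm]

theorem card_Ico_filter_dvd_sub_le (a c : ℤ) (N : ℕ) {r : ℕ} (hr : 0 < r) :
    (((Finset.Ico a (a + N)).filter fun y => (r : ℤ) ∣ y - c).card : ℝ) ≤ N / r + 1 := by
  have h1 : ((Finset.Ico a (a + N)).filter fun y => (r : ℤ) ∣ y - c) =
      (Finset.Ico a (a + N)).filter fun y => y ≡ c [ZMOD r] := by
    refine Finset.filter_congr fun y _ => ?_
    rw [Int.modEq_comm, Int.modEq_iff_dvd]
  have h2 := Int.Ico_filter_modEq_card a (a + N) (r := (r : ℤ)) (by exact_mod_cast hr) c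
  rw [← h1] at h2
  have hr' : (0 : ℚ) < r := by exact_mod_cast hr
  have h3 : ((⌈((a + N : ℤ) - c : ℚ) / (r : ℤ)⌉ - ⌈(a - c : ℚ) / (r : ℤ)⌉ : ℤ) : ℚ) ≤ N / r + 1 := by
    have e1 := Int.ceil_lt_add_one (((a + N : ℤ) - c : ℚ) / (r : ℤ))
    have e2 := Int.le_ceil ((a - c : ℚ) / (r : ℤ))
    have e3 : (((a + N : ℤ) - c : ℚ) / (r : ℤ)) = ((a - c : ℚ) / (r : ℤ)) + N / r := by
      push_cast; field_simp; ring
    push_cast at *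
    linarith
  have h4 : ((((Finset.Ico a (a + N)).filter fun y => (r : ℤ) ∣ y - c).card : ℤ) : ℚ) ≤ N / r + 1 := by
    rw [h2, Int.cast_max]
    refine max_le h3 ?_
    rw [Int.cast_zero]
    positivity
  have h5 := (Rat.cast_le (K := ℝ)).2 h4
  push_cast at h5
  exact_mod_cast h5

theorem card_boxFamily (m T N : ℕ) : (boxFamily m T N).card = (N ^ (m + 2)) ^ m := by
  simp [boxFamily, Fintype.card_piFinset, add_comm]

/-- The factors of `boxFamily`. -/
noncomputable def box (m T N : ℕ) (i : Fin m) : Finset (Fin 2 ⊕ Fin m → ℤ) :=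
  Fintype.piFinset fun k =>
    Finset.Ico (if k = .inr i then (T + m * N : ℤ) else 0)
      ((if k = .inr i then (T + m * N : ℤ) else 0) + N)

theorem card_box (m T N : ℕ) (i : Fin m) : (box m T N i).card = N ^ (m + 2) := by
  simp [box, Fintype.card_piFinset, add_comm]

theorem isCong_update_iff {m : ℕ} {e : Fin 2 → Fin 2 → ℤ} {p : Fin m → Fin 2 ⊕ Fin m → ℤ}
    {r : ℕ} {i : Fin m} {A x : Fin 2 ⊕ Fin m → ℤ} (hA : A (.inr i) = 0) :
    IsCong e (Function.update p i x) r i A ↔ ∀ k, (r : ℤ) ∣ x k -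
      (Sum.elim (fun l => ∑ s, A (.inl s) * e s l) 0 k + ∑ j, A (.inr j) * p j k) := by
  refine forall_congr' fun k => ?_
  have : ∑ j, A (.inr j) * Function.update p i x j k = ∑ j, A (.inr j) * p j k := by
    refine Finset.sum_congr rfl fun j _ => ?_
    by_cases hj : j = i
    · subst hj; simp [hA]
    · simp [hj]
  rw [this, Function.update_self, sub_add_eq_sub_sub]

open Classical in
theorem card_isCong_le {m T N : ℕ} (e : Fin 2 → Fin 2 → ℤ) {r : ℕ} (hr : 0 < r) (i : Fin m)
    {A : Fin 2 ⊕ Fin m → ℤ} (hA : A (.inr i) = 0) :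
    (((boxFamily m T N).filter fun p => IsCong e p r i A).card : ℝ) * N ^ (m + 2) ≤
      (N / r + 1) ^ (m + 2) * (boxFamily m T N).card := by
  have key : ∀ p : Fin m → Fin 2 ⊕ Fin m → ℤ,
      (((box m T N i).filter fun x => IsCong e (Function.update p i x) r i A).card : ℝ) ≤
        (N / r + 1) ^ (m + 2) := by
    intro p
    let c : Fin 2 ⊕ Fin m → ℤ := fun k =>
      (Sum.elim (fun l => ∑ s, A (.inl s) * e s l) 0 k + ∑ j, A (.inr j) * p j k)
    have hsub : ((box m T N i).filter fun x => IsCong e (Function.update p i x) r i A) ⊆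
        Fintype.piFinset fun k => (Finset.Ico (if k = .inr i then (T + m * N : ℤ) else 0)
          ((if k = .inr i then (T + m * N : ℤ) else 0) + N)).filter fun y => (r : ℤ) ∣ y - c k := by
      intro x hx
      rw [Finset.mem_filter, isCong_update_iff hA] at hx
      rw [Fintype.mem_piFinset]
      intro k
      rw [Finset.mem_filter]
      exact ⟨Fintype.mem_piFinset.1 hx.1 k, hx.2 k⟩
    calc _ ≤ ((Fintype.piFinset fun k => (Finset.Ico (if k = .inr i then (T + m * N : ℤ) else 0)
          ((if k = .inr i then (T + m * N : ℤ) else 0) + N)).filter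
            fun y => (r : ℤ) ∣ y - c k).card : ℝ) := by
          exact_mod_cast Finset.card_le_card hsub
      _ ≤ ∏ _k : Fin 2 ⊕ Fin m, (N / r + 1 : ℝ) := by
          rw [Fintype.card_piFinset]
          push_cast
          exact Finset.prod_le_prod (fun _ _ => by positivity)
            fun k _ => card_Ico_filter_dvd_sub_le _ _ _ hr
      _ = _ := by simp [add_comm]
  have := card_filter_piFinset_mul_card_le (box m T N) i (fun p => IsCong e p r i A)
    (K := ⌊((N : ℝ) / r + 1) ^ (m + 2)⌋₊) (fun p _ => Nat.le_floor (key p))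
  rw [card_box] at this
  have h2 : (((boxFamily m T N).filter fun p => IsCong e p r i A).card : ℝ) * N ^ (m + 2) ≤
      ⌊((N : ℝ) / r + 1) ^ (m + 2)⌋₊ * (boxFamily m T N).card := by exact_mod_cast this
  exact h2.trans (mul_le_mul_of_nonneg_right (Nat.floor_le (by positivity)) (by positivity))

theorem card_coeffs (m r : ℕ) (i : Fin m) : (coeffs m r i).card = r ^ (2 + (i : ℕ)) := by
  have h : ∀ j : Fin m, (if j < i then Finset.Ico 0 (r : ℤ) else {0}).card =
      if j < i then r else 1 := fun j => by split_ifs <;> simp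
  rw [coeffs, Fintype.card_piFinset, Fintype.prod_sum_type]
  simp only [Sum.elim_inl, Sum.elim_inr, h, Finset.prod_ite, Finset.prod_const, one_pow, mul_one,
    Int.card_Ico, sub_zero, Int.toNat_natCast, Finset.card_univ, Fintype.card_fin, pow_add]
  congr 2
  have : (Finset.univ.filter fun j : Fin m => j < i) = Finset.Iio i := by ext; simp
  rw [this, Fin.card_Iio]

open Classical in
theorem sum_card_isCong_le {m T N : ℕ} (e : Fin 2 → Fin 2 → ℤ) {r : ℕ} (hr : 0 < r) (i : Fin m) :
    (∑ p ∈ boxFamily m T N, (((coeffs m r i).filter fun A => IsCong e p r i A).card : ℝ)) *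
      N ^ (m + 2) ≤ r ^ (2 + (i : ℕ)) * ((N / r + 1) ^ (m + 2) * (boxFamily m T N).card) := by
  have hsw : ∑ p ∈ boxFamily m T N, (((coeffs m r i).filter fun A => IsCong e p r i A).card : ℝ) =
      ∑ A ∈ coeffs m r i, (((boxFamily m T N).filter fun p => IsCong e p r i A).card : ℝ) := by
    exact_mod_cast Finset.sum_card_bipartiteAbove_eq_sum_card_bipartiteBelow
      (fun p A => IsCong e p r i A)
  rw [hsw, Finset.sum_mul]
  refine (Finset.sum_le_sum fun A hA => card_isCong_le e hr i
    (((mem_coeffs.1 hA).2 i).2 (lt_irrefl _))).trans_eq ?_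
  rw [Finset.sum_const, card_coeffs]
  simp

theorem card_large_primeFactors_le {Δ : ℤ} (hΔ : Δ ≠ 0) {N k : ℕ} (h : |Δ| < (N : ℤ) ^ (k + 1)) :
    (Δ.natAbs.primeFactors.filter (N < ·)).card ≤ k := by
  rcases Nat.eq_zero_or_pos N with rfl | hN
  · have := abs_pos.2 hΔ
    simp at h
    omega
  have h1 : N ^ (Δ.natAbs.primeFactors.filter (N < ·)).card ≤
      ∏ r ∈ Δ.natAbs.primeFactors.filter (N < ·), r := by
    rw [← Finset.prod_const]
    exact Finset.prod_le_prod' fun r hr => (Finset.mem_filter.1 hr).2.le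
  have h2 : ∏ r ∈ Δ.natAbs.primeFactors.filter (N < ·), r ∣ Δ.natAbs :=
    (Finset.prod_dvd_prod_of_subset _ _ _ (Finset.filter_subset _ _)).trans
      (Nat.prod_primeFactors_dvd _)
  have h3 := Nat.le_of_dvd (Int.natAbs_pos.2 hΔ) h2
  have h4 : Δ.natAbs < N ^ (k + 1) := by zify; simpa using h
  rcases Nat.lt_or_ge 1 N with hN1 | hN1
  · exact Nat.lt_succ_iff.1 ((Nat.pow_lt_pow_iff_right hN1).1 (h1.trans_lt (h3.trans_lt h4)))
  · obtain rfl : N = 1 := by omega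
    have := abs_pos.2 hΔ
    simp at h4
    omega

open Classical in
theorem card_filter_isCong_mul_le {m T N : ℕ} (e : Fin 2 → Fin 2 → ℤ)
    (p : Fin m → Fin 2 ⊕ Fin m → ℤ) {r : ℕ} (hr : r.Prime) (hNr : N ≤ r) (i : Fin m) :
    ((box m T N i).filter fun x =>
      ∃ A ∈ coeffs m r i, IsCong e (Function.update p i x) r i A).card * N ≤ N ^ (m + 2) := by
  have := Fact.mk hr
  let q : Fin m → Fin 2 ⊕ Fin m → ℤ := fun j => if j < i then p j else 0
  have hdet : ((joinMatrix e q).map (Int.cast : ℤ → ZMod r)).det = 0 :=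
    Matrix.det_eq_zero_of_row_eq_zero (.inr i) fun k => by simp [joinMatrix, q]
  obtain ⟨y, hy, hmul⟩ := Matrix.exists_mulVec_eq_zero_iff.2 hdet
  obtain ⟨k₀, hk₀⟩ := Function.ne_iff.1 hy
  have hrow : ∀ l, ∑ k, ((joinMatrix e q l k : ℤ) : ZMod r) * y k = 0 := fun l => congrFun hmul l
  have hsub : ((box m T N i).filter fun x =>
      ∃ A ∈ coeffs m r i, IsCong e (Function.update p i x) r i A) ⊆
      (box m T N i).filter fun x => ∑ k, ((x k : ℤ) : ZMod r) * y k = 0 := by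
    intro x hx
    rw [Finset.mem_filter] at hx ⊢
    refine ⟨hx.1, ?_⟩
    obtain ⟨A, hA, hcong⟩ := hx.2
    rw [mem_coeffs] at hA
    rw [isCong_update_iff ((hA.2 i).2 (lt_irrefl _))] at hcong
    have hx' : ∀ k, ((x k : ℤ) : ZMod r) = ∑ l, (A l : ZMod r) * (joinMatrix e q l k : ℤ) := by
      intro k
      have h1 := (ZMod.intCast_zmod_eq_zero_iff_dvd _ r).2 (hcong k)
      rw [Int.cast_sub, sub_eq_zero] at h1
      rw [h1, Fintype.sum_sum_type]
      push_cast
      congr 1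
      · rcases k with k | k <;> simp [joinMatrix]
      · refine Finset.sum_congr rfl fun j _ => ?_
        by_cases hj : j < i
        · simp [joinMatrix, q, hj]
        · simp [(hA.2 j).2 hj]
    simp only [hx', Finset.sum_mul]
    rw [Finset.sum_comm]
    refine Finset.sum_eq_zero fun l _ => ?_
    have := hrow l
    simp only [mul_assoc, ← Finset.mul_sum, this, mul_zero]
  refine (Nat.mul_le_mul_right _ (Finset.card_le_card hsub)).trans ?_
  have h1 := card_filter_piFinset_mul_card_le (fun k => Finset.Ico
    (if k = .inr i then (T + m * N : ℤ) else 0) ((if k = .inr i then (T + m * N : ℤ) else 0) + N))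
    k₀ (fun x => ∑ k, ((x k : ℤ) : ZMod r) * y k = 0) (K := 1) (by
      intro x _
      rw [Finset.card_le_one]
      intro a ha b hb
      rw [Finset.mem_filter, Finset.mem_Ico] at ha hb
      have hsum : ∀ a : ℤ, ∑ k, ((Function.update x k₀ a k : ℤ) : ZMod r) * y k =
          a * y k₀ + ∑ k ∈ Finset.univ.erase k₀, ((x k : ℤ) : ZMod r) * y k := by
        intro a
        rw [← Finset.add_sum_erase _ _ (Finset.mem_univ k₀), Function.update_self]
        congr 1
        refine Finset.sum_congr rfl fun k hk => ?_
        rw [Function.update_of_ne (Finset.ne_of_mem_erase hk)]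
      have h2 : ((a - b : ℤ) : ZMod r) * y k₀ = 0 := by
        have := ha.2.trans hb.2.symm
        rw [hsum, hsum, add_left_inj] at this
        rw [Int.cast_sub, sub_mul, this, sub_self]
      have h3 := (mul_eq_zero.1 h2).resolve_right hk₀
      rw [ZMod.intCast_zmod_eq_zero_iff_dvd] at h3
      have hNr' : (N : ℤ) ≤ r := by exact_mod_cast hNr
      have := Int.eq_zero_of_abs_lt_dvd h3 (abs_lt.2 ⟨by linarith, by linarith⟩)
      linarith)
  have h2 : (Finset.Ico (if k₀ = .inr i then (T + m * N : ℤ) else 0)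
      ((if k₀ = .inr i then (T + m * N : ℤ) else 0) + N)).card = N := by simp
  rw [h2, one_mul] at h1
  have h3 := card_box m T N i
  unfold box at h3 ⊢
  exact h1.trans_eq h3

open Classical in
theorem card_large_dvd_truncDet_mul_le {m T N : ℕ} (hm : 0 < m) (hN : 0 < N)
    (hNT : 100 * m ^ 2 * N ≤ T) (hbig : (m + 2).factorial * (2 * T) ^ (m + 2) < N ^ (m + 3))
    {e : Fin 2 → Fin 2 → ℤ} (he : ∀ s k, |e s k| ≤ T)
    (hne : e 0 0 * e 1 1 - e 0 1 * e 1 0 ≠ 0) (i : Fin m) :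
    ((boxFamily m T N).filter fun p => ∃ r : ℕ, r.Prime ∧ N < r ∧
      (r : ℤ) ∣ truncDet T N e i p ∧ ∃ A ∈ coeffs m r i, IsCong e p r i A).card * N ≤
      (m + 2) * (boxFamily m T N).card := by
  have hT : 0 < T := lt_of_lt_of_le (by positivity) hNT
  have h1 := card_filter_piFinset_mul_card_le (box m T N) i (fun p => ∃ r : ℕ, r.Prime ∧ N < r ∧
      (r : ℤ) ∣ truncDet T N e i p ∧ ∃ A ∈ coeffs m r i, IsCong e p r i A)
    (K := (m + 2) * N ^ (m + 1)) (by
      intro p hp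
      refine Nat.le_of_mul_le_mul_right ?_ hN
      have hΔ : truncDet T N e i p ≠ 0 := truncDet_ne_zero hT hN hne i hp
      have hsub : ((box m T N i).filter fun x => ∃ r : ℕ, r.Prime ∧ N < r ∧
          (r : ℤ) ∣ truncDet T N e i (Function.update p i x) ∧
          ∃ A ∈ coeffs m r i, IsCong e (Function.update p i x) r i A) ⊆
          ((truncDet T N e i p).natAbs.primeFactors.filter (N < ·)).biUnion fun r =>
            (box m T N i).filter fun x =>
              ∃ A ∈ coeffs m r i, IsCong e (Function.update p i x) r i A := by
        intro x hx
        rw [Finset.mem_filter] at hx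
        obtain ⟨hx, r, hr, hNr, hd, hA⟩ := hx
        rw [truncDet, truncate_update] at hd
        rw [Finset.mem_biUnion]
        refine ⟨r, Finset.mem_filter.2 ⟨Nat.mem_primeFactors.2
          ⟨hr, Int.natCast_dvd.1 hd, Int.natAbs_ne_zero.2 hΔ⟩, hNr⟩, Finset.mem_filter.2 ⟨hx, hA⟩⟩
      have hcard : ((truncDet T N e i p).natAbs.primeFactors.filter (N < ·)).card ≤ m + 2 :=
        card_large_primeFactors_le hΔ
          ((abs_truncDet_le hm hN hNT he i hp).trans_lt (by exact_mod_cast hbig))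
      calc _ ≤ (∑ r ∈ (truncDet T N e i p).natAbs.primeFactors.filter (N < ·),
            ((box m T N i).filter fun x =>
              ∃ A ∈ coeffs m r i, IsCong e (Function.update p i x) r i A).card) * N :=
            Nat.mul_le_mul_right _ ((Finset.card_le_card hsub).trans Finset.card_biUnion_le)
        _ ≤ ∑ r ∈ (truncDet T N e i p).natAbs.primeFactors.filter (N < ·), N ^ (m + 2) := by
            rw [Finset.sum_mul]
            refine Finset.sum_le_sum fun r hr => ?_
            rw [Finset.mem_filter] at hr
            exact card_filter_isCong_mul_le e p (Nat.prime_of_mem_primeFactors hr.1) hr.2.le i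
        _ ≤ (m + 2) * N ^ (m + 2) := by
            rw [Finset.sum_const, smul_eq_mul]
            exact Nat.mul_le_mul_right _ hcard
        _ = _ := by ring)
  rw [card_box] at h1
  change (Finset.filter _ (boxFamily m T N)).card * _ ≤ _ * (boxFamily m T N).card at h1
  refine Nat.le_of_mul_le_mul_right ?_ (pow_pos hN (m + 1))
  calc _ = _ := by rw [mul_assoc, ← pow_succ']
    _ ≤ _ := h1
    _ = _ := by ring

theorem one_div_mul_sub_one_telescope {K : ℕ} (hK : 2 ≤ K) :
    1 / ((K : ℝ) * (K - 1)) = 1 / (K - 1) - 1 / ((K + 1 : ℕ) - 1) := by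
  have h : (2 : ℝ) ≤ K := by exact_mod_cast hK
  have h1 : (K : ℝ) - 1 ≠ 0 := by linarith
  have h2 : (K : ℝ) ≠ 0 := by linarith
  push_cast
  rw [add_sub_cancel_right]
  field_simp
  ring

theorem sum_primes_one_div_le (K : ℕ) :
    ∑ r ∈ (Finset.range K).filter Nat.Prime, 1 / ((r : ℝ) * (r - 1)) ≤ 11 / 12 := by
  have h : ∀ k, ∑ r ∈ (Finset.range (k + 5)).filter Nat.Prime, 1 / ((r : ℝ) * (r - 1)) ≤
      11 / 12 - 1 / ((k + 5 : ℕ) - 1) := by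
    intro k
    induction k with
    | zero =>
      have : (Finset.range (0 + 5)).filter Nat.Prime = {2, 3} := by decide
      rw [this]
      norm_num
    | succ k ih =>
      have h1 := one_div_mul_sub_one_telescope (show 2 ≤ k + 5 by omega)
      have h0 : 0 ≤ 1 / (((k + 5 : ℕ) : ℝ) * ((k + 5 : ℕ) - 1)) := by
        have : (1 : ℝ) ≤ (k + 5 : ℕ) := by exact_mod_cast (by omega : 1 ≤ k + 5)
        exact div_nonneg zero_le_one (mul_nonneg (by positivity) (by linarith))
      rw [show k + 1 + 5 = (k + 5) + 1 by ring, Finset.range_add_one, Finset.filter_insert]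
      split_ifs
      · rw [Finset.sum_insert (by simp)]
        linarith
      · linarith
  have hk := h K
  have : (1 : ℝ) ≤ (K + 5 : ℕ) := by exact_mod_cast (by omega : 1 ≤ K + 5)
  have h2 : 0 ≤ 1 / (((K + 5 : ℕ) : ℝ) - 1) := div_nonneg zero_le_one (by linarith)
  refine le_trans ?_ (hk.trans (by linarith))
  refine Finset.sum_le_sum_of_subset_of_nonneg
    (Finset.filter_subset_filter _ (Finset.range_mono (by omega))) fun r hr _ => ?_
  have : (1 : ℝ) ≤ r := by exact_mod_cast (Finset.mem_filter.1 hr).2.one_le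
  exact div_nonneg zero_le_one (mul_nonneg (by linarith) (by linarith))

theorem sum_Ico_one_div_le {P : ℕ} (hP : 2 ≤ P) (k : ℕ) :
    ∑ r ∈ Finset.Ico P (P + k), 1 / ((r : ℝ) * (r - 1)) ≤ 1 / (P - 1) := by
  have h : ∑ r ∈ Finset.Ico P (P + k), 1 / ((r : ℝ) * (r - 1)) ≤
      1 / (P - 1) - 1 / ((P + k : ℕ) - 1) := by
    induction k with
    | zero => simp
    | succ k ih =>
      rw [← add_assoc, Finset.sum_Ico_succ_top (by omega)]
      have := one_div_mul_sub_one_telescope (show 2 ≤ P + k by omega)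
      linarith
  have : (1 : ℝ) ≤ (P + k : ℕ) := by exact_mod_cast (by omega : 1 ≤ P + k)
  have h2 : 0 ≤ 1 / (((P + k : ℕ) : ℝ) - 1) := div_nonneg zero_le_one (by linarith)
  linarith

theorem one_add_pow_le {x : ℝ} (hx : 0 ≤ x) {n : ℕ} (h : n * x ≤ 1 / 100) (hx1 : x ≤ 1) :
    (1 + x) ^ n ≤ 100 / 99 := by
  have h1 := one_add_mul_le_pow (a := -x) (by linarith) n
  have h2 : (1 + x) ^ n * (1 + -x) ^ n ≤ 1 := by
    rw [← mul_pow]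
    exact pow_le_one₀ (by nlinarith) (by nlinarith)
  have h3 : (1 + x) ^ n * (99 / 100) ≤ (1 + x) ^ n * (1 + -x) ^ n :=
    mul_le_mul_of_nonneg_left (by linarith) (by positivity)
  linarith

theorem sum_primes_weighted_le {n N : ℕ} (hn : 0 < n) (hN : 100 * n * (100 * 2 ^ n + 1) ≤ N) :
    ∑ r ∈ (Finset.range (N + 1)).filter Nat.Prime,
      (1 + (r : ℝ) / N) ^ n * (1 / ((r : ℝ) * (r - 1))) ≤ 0.94 := by
  obtain ⟨P, hP⟩ : ∃ P, P = 100 * 2 ^ n + 1 := ⟨_, rfl⟩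
  rw [← hP] at hN
  have h2n : 1 ≤ 2 ^ n := Nat.one_le_two_pow
  have hP2 : 2 ≤ P := by omega
  have hNP : P ≤ N := by nlinarith
  have hN0 : (0 : ℝ) < N := by exact_mod_cast (by omega : 0 < N)
  have hnn : ∀ r ∈ (Finset.range (N + 1)).filter Nat.Prime, 0 ≤ 1 / ((r : ℝ) * (r - 1)) := by
    intro r hr
    have : (1 : ℝ) ≤ r := by exact_mod_cast (Finset.mem_filter.1 hr).2.one_le
    exact div_nonneg zero_le_one (mul_nonneg (by linarith) (by linarith))
  rw [← Finset.sum_filter_add_sum_filter_not _ (fun r => r < P)]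
  have hA : ∑ r ∈ ((Finset.range (N + 1)).filter Nat.Prime).filter (fun r => r < P),
      (1 + (r : ℝ) / N) ^ n * (1 / ((r : ℝ) * (r - 1))) ≤ 100 / 99 * (11 / 12) := by
    calc _ ≤ ∑ r ∈ ((Finset.range (N + 1)).filter Nat.Prime).filter (fun r => r < P),
          100 / 99 * (1 / ((r : ℝ) * (r - 1))) := by
          refine Finset.sum_le_sum fun r hr => ?_
          rw [Finset.mem_filter] at hr
          refine mul_le_mul_of_nonneg_right ?_ (hnn r hr.1)
          have hrP : (r : ℝ) ≤ P := by exact_mod_cast hr.2.le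
          have hrN : (P : ℝ) ≤ N := by exact_mod_cast hNP
          refine one_add_pow_le (by positivity) ?_ ?_
          · rw [← mul_div_assoc, div_le_iff₀ hN0]
            have : (100 * n * P : ℝ) ≤ N := by exact_mod_cast hN
            have : (n * r : ℝ) ≤ n * P := mul_le_mul_of_nonneg_left hrP (by positivity)
            linarith
          · rw [div_le_one hN0]; linarith
      _ = 100 / 99 * ∑ r ∈ ((Finset.range (N + 1)).filter Nat.Prime).filter (fun r => r < P),
          (1 / ((r : ℝ) * (r - 1))) := by rw [Finset.mul_sum]
      _ ≤ _ := by
          refine mul_le_mul_of_nonneg_left ?_ (by norm_num)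
          exact (Finset.sum_le_sum_of_subset_of_nonneg (Finset.filter_subset _ _)
            fun r hr _ => hnn r hr).trans (sum_primes_one_div_le _)
  have hB : ∑ r ∈ ((Finset.range (N + 1)).filter Nat.Prime).filter (fun r => ¬ r < P),
      (1 + (r : ℝ) / N) ^ n * (1 / ((r : ℝ) * (r - 1))) ≤ 1 / 100 := by
    calc _ ≤ ∑ r ∈ ((Finset.range (N + 1)).filter Nat.Prime).filter (fun r => ¬ r < P),
          2 ^ n * (1 / ((r : ℝ) * (r - 1))) := by
          refine Finset.sum_le_sum fun r hr => ?_
          rw [Finset.mem_filter] at hr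
          refine mul_le_mul_of_nonneg_right ?_ (hnn r hr.1)
          have hrN : (r : ℝ) ≤ N := by
            exact_mod_cast Nat.lt_succ_iff.1 (Finset.mem_range.1 (Finset.mem_filter.1 hr.1).1)
          refine pow_le_pow_left₀ (by positivity) ?_ n
          have := (div_le_one hN0).2 hrN
          linarith
      _ = 2 ^ n * ∑ r ∈ ((Finset.range (N + 1)).filter Nat.Prime).filter (fun r => ¬ r < P),
          (1 / ((r : ℝ) * (r - 1))) := by rw [Finset.mul_sum]
      _ ≤ 2 ^ n * (1 / (P - 1)) := by
          refine mul_le_mul_of_nonneg_left ?_ (by positivity)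
          refine le_trans ?_ (sum_Ico_one_div_le hP2 (N + 1 - P))
          refine Finset.sum_le_sum_of_subset_of_nonneg ?_ fun r hr _ => ?_
          · intro r hr
            simp only [Finset.mem_filter, Finset.mem_range, Finset.mem_Ico] at hr ⊢
            omega
          · have : (1 : ℝ) ≤ r := by
              have := (Finset.mem_Ico.1 hr).1
              exact_mod_cast (by omega : 1 ≤ r)
            exact div_nonneg zero_le_one (mul_nonneg (by linarith) (by linarith))
      _ = _ := by
          rw [hP]; push_cast; field_simp; ring
  norm_num at hA hB ⊢
  linarith

/-- Two independent integer vectors `(e s, e₃ s)` of height at most `T`, spanning a primitive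
lattice, at which the linear form given by `ξ` is at most `1.01 κ`. -/
structure IsBasePair (T : ℕ) (κ : ℝ) (ξ : Fin 2 → ℝ) (e : Fin 2 → Fin 2 → ℤ) (e₃ : Fin 2 → ℤ) :
    Prop where
  abs_le : ∀ s k, |e s k| ≤ T
  det_ne_zero : e 0 0 * e 1 1 - e 0 1 * e 1 0 ≠ 0
  primitive : ∀ r : ℕ, r.Prime → ∀ d : Fin 2 → ℤ, (∀ k, (r : ℤ) ∣ ∑ s, d s * e s k) →
    (r : ℤ) ∣ ∑ s, d s * e₃ s → ∀ s, (r : ℤ) ∣ d s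
  form_le : ∀ s, |∑ k, (e s k : ℝ) * ξ k + e₃ s| ≤ 1.01 * κ

/-- The points at which the form is at least `κ` on all vectors of height less than `T` that
involve `γ`. -/
def goodSet {m : ℕ} (T : ℕ) (κ : ℝ) (ξ : Fin 2 → ℝ) : Set (Fin m → ℝ) :=
  {γ | ∀ (b : Fin 2 ⊕ Fin m → ℤ) (x : ℤ), (∃ j, b (.inr j) ≠ 0) → (∀ k, |b k| < T) →
    κ ≤ |linForm ξ γ (b, x)|}

/-- The points of the unit cube at which the form takes small values at the vectors `p i`. -/
def smallSet {m : ℕ} (ε : ℝ) (ξ : Fin 2 → ℝ) (p : Fin m → Fin 2 ⊕ Fin m → ℤ) :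
    Set (Fin m → ℝ) :=
  (Set.univ.pi fun _ => Set.Ioc (0 : ℝ) 1) ∩
    {γ | ∃ x : Fin m → ℤ, ∀ i, |linForm ξ γ (p i, x i)| < ε}

/-- The part of `smallSet` on which the last coordinates satisfy a congruence. -/
def congSet {m : ℕ} (ε : ℝ) (ξ : Fin 2 → ℝ) (e₃ : Fin 2 → ℤ) (p : Fin m → Fin 2 ⊕ Fin m → ℤ)
    (r : ℕ) (i : Fin m) (A : Fin 2 ⊕ Fin m → ℤ) : Set (Fin m → ℝ) :=
  (Set.univ.pi fun _ => Set.Ioc (0 : ℝ) 1) ∩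
    {γ | ∃ x : Fin m → ℤ, (∀ i, |linForm ξ γ (p i, x i)| < ε) ∧
      (r : ℤ) ∣ x i - ∑ s, A (.inl s) * e₃ s - ∑ j, A (.inr j) * x j}

theorem continuous_linForm {m : ℕ} (ξ : Fin 2 → ℝ) (w : (Fin 2 ⊕ Fin m → ℤ) × ℤ) :
    Continuous fun γ : Fin m → ℝ => linForm ξ γ w := by
  obtain ⟨b, x⟩ := w
  simp only [linForm_apply]
  fun_prop

theorem measurableSet_goodSet {m : ℕ} (T : ℕ) (κ : ℝ) (ξ : Fin 2 → ℝ) :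
    MeasurableSet (goodSet T κ ξ : Set (Fin m → ℝ)) := by
  unfold goodSet
  simp only [Set.ofPred_forall]
  refine IsClosed.measurableSet ?_
  refine isClosed_iInter fun b => isClosed_iInter fun x => isClosed_iInter fun _ =>
    isClosed_iInter fun _ => ?_
  exact isClosed_le continuous_const (continuous_linForm ξ _).abs

theorem measurableSet_smallSet {m : ℕ} (ε : ℝ) (ξ : Fin 2 → ℝ) (p : Fin m → Fin 2 ⊕ Fin m → ℤ) :
    MeasurableSet (smallSet ε ξ p) := by
  refine (MeasurableSet.univ_pi fun _ => measurableSet_Ioc).inter ?_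
  simp only [Set.ofPred_exists, Set.ofPred_forall]
  refine MeasurableSet.iUnion fun x => MeasurableSet.iInter fun i => ?_
  exact (isOpen_lt (continuous_linForm ξ _).abs continuous_const).measurableSet

theorem eq_of_mem_smallSet_of_mem_goodSet {m T N : ℕ} (hNT : N ≤ T) {κ ε : ℝ} (hεκ : 2 * ε ≤ κ)
    {ξ : Fin 2 → ℝ} (hlow : ∀ (z : Fin 2 → ℤ) (z₃ : ℤ), z ≠ 0 → (∀ k, |z k| < T) →
      2 * ε ≤ |∑ k, (z k : ℝ) * ξ k + z₃|) {p p' : Fin m → Fin 2 ⊕ Fin m → ℤ}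
    (hp : p ∈ boxFamily m T N) (hp' : p' ∈ boxFamily m T N) {γ : Fin m → ℝ}
    (hγ : γ ∈ goodSet T κ ξ) (h : γ ∈ smallSet ε ξ p) (h' : γ ∈ smallSet ε ξ p') : p = p' := by
  obtain ⟨-, x, hx⟩ := h
  obtain ⟨-, x', hx'⟩ := h'
  rw [mem_boxFamily] at hp hp'
  funext i
  by_contra hne
  have hsub : linForm ξ γ (p i - p' i, x i - x' i) =
      linForm ξ γ (p i, x i) - linForm ξ γ (p' i, x' i) := by
    rw [← map_sub, Prod.mk_sub_mk]
  have hlt : |linForm ξ γ (p i - p' i, x i - x' i)| < 2 * ε := by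
    rw [hsub]
    have := abs_sub (linForm ξ γ (p i, x i)) (linForm ξ γ (p' i, x' i))
    linarith [hx i, hx' i]
  have hT : ∀ k, |(p i - p' i) k| < T := by
    intro k
    have h1 := hp i k
    have h2 := hp' i k
    have : (N : ℤ) ≤ T := by exact_mod_cast hNT
    rw [Pi.sub_apply, abs_lt]
    constructor <;> linarith
  by_cases hr : ∃ j, (p i - p' i) (.inr j) ≠ 0
  · exact absurd (hγ _ (x i - x' i) hr hT) (by linarith)
  · push Not at hr
    have hz : (fun k => (p i - p' i) (.inl k)) ≠ 0 := by
      intro hz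
      refine hne (sub_eq_zero.1 (funext fun k => ?_))
      rcases k with k | k
      · exact congrFun hz k
      · exact hr k
    have := hlow _ (x i - x' i) hz fun k => hT _
    rw [linForm_apply] at hlt
    simp only [hr, Int.cast_zero, zero_mul, Finset.sum_const_zero, zero_add] at hlt
    linarith

theorem volume_congSet_le {m T N : ℕ} (hm : 0 < m) (hT : 0 < T)
    {p : Fin m → Fin 2 ⊕ Fin m → ℤ} (hp : p ∈ boxFamily m T N) {κ : ℝ} (hκ : 0 < κ)
    (hκ1 : κ ≤ 1 / 9) {ξ : Fin 2 → ℝ} {e : Fin 2 → Fin 2 → ℤ} {e₃ : Fin 2 → ℤ}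
    (he : IsBasePair T κ ξ e e₃) {r : ℕ} (hr : 0 < r) {i : Fin m} {A : Fin 2 ⊕ Fin m → ℤ}
    (hA : A ∈ coeffs m r i) (hcong : IsCong e p r i A) :
    volume (congSet (κ / (100 * m)) ξ e₃ p r i A) ≤
      ENNReal.ofReal ((2 * (κ / (100 * m))) ^ m / r) := by
  rw [mem_coeffs] at hA
  have hm1 : (1 : ℝ) ≤ m := by exact_mod_cast hm
  have hr0 : (0 : ℝ) < r := by exact_mod_cast hr
  refine volume_congruent_le ξ p (det_ne_zero_of_mem_boxFamily hT hp) (by positivity) ?_ r hr i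
    (fun j => A (.inr j)) (fun j => ?_) ((hA.2 i).2 (lt_irrefl _))
    (fun l => ∑ s, A (.inl s) * e s l, ∑ s, A (.inl s) * e₃ s) ?_ hcong
  · rw [div_mul_eq_mul_div, div_le_iff₀ (by positivity)]
    nlinarith
  · by_cases hj : j < i
    · have := (hA.2 j).1 hj
      rw [abs_of_nonneg this.1]
      exact this.2.le
    · simp [(hA.2 j).2 hj]
  · have h1 : ∑ k, ((∑ s, A (.inl s) * e s k : ℤ) : ℝ) * ξ k + (∑ s, A (.inl s) * e₃ s : ℤ) =
        ∑ s, (A (.inl s) : ℝ) * (∑ k, (e s k : ℝ) * ξ k + e₃ s) := by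
      simp only [Fin.sum_univ_two]
      push_cast
      ring
    rw [h1]
    have h2 : ∀ s, |(A (.inl s) : ℝ) * (∑ k, (e s k : ℝ) * ξ k + e₃ s)| ≤ r * (1.01 * κ) := by
      intro s
      rw [abs_mul]
      refine mul_le_mul ?_ (he.form_le s) (abs_nonneg _) hr0.le
      rw [abs_of_nonneg (by exact_mod_cast (hA.1 s).1)]
      exact_mod_cast (hA.1 s).2.le
    calc _ ≤ ∑ s, |(A (.inl s) : ℝ) * (∑ k, (e s k : ℝ) * ξ k + e₃ s)| :=
          Finset.abs_sum_le_sum_abs _ _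
      _ ≤ ∑ _s : Fin 2, r * (1.01 * κ) := Finset.sum_le_sum fun s _ => h2 s
      _ ≤ _ := by
        simp only [Finset.sum_const, Finset.card_univ, Fintype.card_fin, nsmul_eq_mul]
        push_cast
        nlinarith

open Classical in
/-- The weight bounding the proportion of `smallSet` that is not in `goodSet`. -/
noncomputable def badWeight {m : ℕ} (T N : ℕ) (e : Fin 2 → Fin 2 → ℤ)
    (p : Fin m → Fin 2 ⊕ Fin m → ℤ) : ℝ :=
  (∑ r ∈ (Finset.range (N + 1)).filter Nat.Prime, ∑ i,
    (((coeffs m r i).filter fun A => IsCong e p r i A).card : ℝ) * (1 / r)) +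
  (∑ i : Fin m, if ∃ r : ℕ, r.Prime ∧ N < r ∧ (r : ℤ) ∣ truncDet T N e i p ∧
    ∃ A ∈ coeffs m r i, IsCong e p r i A then 1 else 0) + m * ((m + 2) / N)

open Classical in
theorem volume_smallSet_sdiff_goodSet_le {m T N : ℕ} (hm : 0 < m) (hN : 0 < N)
    (hNT : 100 * m ^ 2 * N ≤ T) (hbig : (m + 2).factorial * (2 * T) ^ (m + 2) < N ^ (m + 3))
    {p : Fin m → Fin 2 ⊕ Fin m → ℤ} (hp : p ∈ boxFamily m T N) {κ : ℝ} (hκ : 0 < κ)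
    (hκ1 : κ ≤ 1 / 9) (hκT : κ * T ^ (m + 2) ≤ 1 / 8) {ξ : Fin 2 → ℝ} {e : Fin 2 → Fin 2 → ℤ}
    {e₃ : Fin 2 → ℤ} (he : IsBasePair T κ ξ e e₃) :
    volume (smallSet (κ / (100 * m)) ξ p \ goodSet T κ ξ) ≤
      ENNReal.ofReal ((2 * (κ / (100 * m))) ^ m * badWeight T N e p) := by
  have hT : 0 < T := lt_of_lt_of_le (by positivity) hNT
  have hm0 : (0 : ℝ) < m := by exact_mod_cast hm
  have hN0 : (0 : ℝ) < N := by exact_mod_cast hN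
  set ε : ℝ := κ / (100 * m) with hε
  have hε0 : 0 < ε := by positivity
  set V : ℝ := (2 * ε) ^ m with hV
  have hV0 : 0 < V := by positivity
  let S : Fin m → Prop := fun i => ∃ r : ℕ, r.Prime ∧ N < r ∧ (r : ℤ) ∣ truncDet T N e i p ∧
    ∃ A ∈ coeffs m r i, IsCong e p r i A
  let L : Fin m → Finset ℕ := fun i =>
    (truncDet T N e (i + 1) p).natAbs.primeFactors.filter (N < ·)
  let U₁ : Set (Fin m → ℝ) := ⋃ r ∈ (Finset.range (N + 1)).filter Nat.Prime, ⋃ i ∈ Finset.univ,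
    ⋃ A ∈ (coeffs m r i).filter fun A => IsCong e p r i A, congSet ε ξ e₃ p r i A
  let U₂ : Set (Fin m → ℝ) := ⋃ i ∈ (Finset.univ : Finset (Fin m)),
    if S i then smallSet ε ξ p else ∅
  let U₃ : Set (Fin m → ℝ) := ⋃ i ∈ (Finset.univ : Finset (Fin m)), ⋃ r ∈ L i,
    ⋃ A ∈ (coeffs m r i).filter fun A => IsCong e p r i A ∧ ¬ S i, congSet ε ξ e₃ p r i A
  have hcover : smallSet ε ξ p \ goodSet T κ ξ ⊆ U₁ ∪ U₂ ∪ U₃ := by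
    rintro γ ⟨hγ, hbad⟩
    obtain ⟨hC, x, hx⟩ := hγ
    simp only [goodSet, Set.mem_ofPred_eq] at hbad
    push Not at hbad
    obtain ⟨b, x', hb0, hb, hlt⟩ := hbad
    obtain ⟨r, hr, i, A, hA, hcong, hdvd⟩ := exists_isCong_of_bad hm hT hNT hp he.abs_le
      he.det_ne_zero he.primitive hκ hκT he.form_le (fun i => by
        have := (hx i).le
        rwa [hε, le_div_iff₀ (by positivity)] at this) (b, x') hb hlt.le hb0
    have hmem : γ ∈ congSet ε ξ e₃ p r i A := ⟨hC, x, hx, hdvd⟩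
    rcases Nat.lt_or_ge N r with hNr | hNr
    · by_cases hS : S i
      · refine Or.inl (Or.inr (Set.mem_iUnion₂.2 ⟨i, Finset.mem_univ i, ?_⟩))
        rw [if_pos hS]
        exact ⟨hC, x, hx⟩
      · refine Or.inr (Set.mem_iUnion₂.2 ⟨i, Finset.mem_univ i, Set.mem_iUnion₂.2 ⟨r, ?_,
          Set.mem_iUnion₂.2 ⟨A, Finset.mem_filter.2 ⟨hA, hcong, hS⟩, hmem⟩⟩⟩)
        exact Finset.mem_filter.2 ⟨Nat.mem_primeFactors.2 ⟨hr, Int.natCast_dvd.1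
          (hcong.dvd_truncDet hA), Int.natAbs_ne_zero.2
            (truncDet_ne_zero hT hN he.det_ne_zero _ hp)⟩, hNr⟩
    · refine Or.inl (Or.inl (Set.mem_iUnion₂.2 ⟨r, ?_, Set.mem_iUnion₂.2 ⟨i, Finset.mem_univ i,
        Set.mem_iUnion₂.2 ⟨A, Finset.mem_filter.2 ⟨hA, hcong⟩, hmem⟩⟩⟩))
      exact Finset.mem_filter.2 ⟨Finset.mem_range.2 (by omega), hr⟩
  have hcs : ∀ {r : ℕ} {i : Fin m} {A}, 0 < r → A ∈ coeffs m r i → IsCong e p r i A →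
      volume (congSet ε ξ e₃ p r i A) ≤ ENNReal.ofReal (V / r) := fun hr hA hcong =>
    volume_congSet_le hm hT hp hκ hκ1 he hr hA hcong
  have h₁ : volume U₁ ≤ ENNReal.ofReal (V * ∑ r ∈ (Finset.range (N + 1)).filter Nat.Prime, ∑ i,
      (((coeffs m r i).filter fun A => IsCong e p r i A).card : ℝ) * (1 / r)) := by
    rw [Finset.mul_sum, ENNReal.ofReal_sum_of_nonneg fun r _ =>
      mul_nonneg hV0.le (Finset.sum_nonneg fun i _ => by positivity)]
    refine (measure_biUnion_finset_le _ _).trans (Finset.sum_le_sum fun r hr => ?_)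
    rw [Finset.mul_sum, ENNReal.ofReal_sum_of_nonneg fun i _ => by positivity]
    refine (measure_biUnion_finset_le _ _).trans (Finset.sum_le_sum fun i _ => ?_)
    refine (measure_biUnion_finset_le _ _).trans ?_
    have hr0 := (Finset.mem_filter.1 hr).2.pos
    refine (Finset.sum_le_sum fun A hA => hcs hr0 (Finset.mem_filter.1 hA).1
      (Finset.mem_filter.1 hA).2).trans_eq ?_
    rw [Finset.sum_const, nsmul_eq_mul, ← ENNReal.ofReal_natCast,
      ← ENNReal.ofReal_mul (by positivity)]
    congr 1
    ring
  have h₂ : volume U₂ ≤ ENNReal.ofReal (V * ∑ i : Fin m, if S i then 1 else 0) := by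
    rw [Finset.mul_sum, ENNReal.ofReal_sum_of_nonneg fun i _ => by split_ifs <;> simp [hV0.le]]
    refine (measure_biUnion_finset_le _ _).trans (Finset.sum_le_sum fun i _ => ?_)
    split_ifs
    · rw [mul_one]
      refine (volume_simultaneously_small ξ p (det_ne_zero_of_mem_boxFamily hT hp) hε0 ?_).le
      rw [hε, div_le_iff₀ (by positivity)]
      have : (1 : ℝ) ≤ m := by exact_mod_cast hm
      nlinarith
    · simp
  have h₃ : volume U₃ ≤ ENNReal.ofReal (V * (m * ((m + 2) / N))) := by
    have h4 : ∀ i, ∀ r ∈ L i,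
        ((coeffs m r i).filter fun A => IsCong e p r i A ∧ ¬ S i).card ≤ 1 := by
      intro i r hr
      rw [Finset.card_le_one]
      intro A hA A' hA'
      rw [Finset.mem_filter] at hA hA'
      rw [Finset.mem_filter] at hr
      have hrp := Nat.prime_of_mem_primeFactors hr.1
      refine hA.2.1.eq_of_not_dvd (T := T) (N := N) hrp (fun hd => hA.2.2 ?_) hA.1 hA'.1 hA'.2.1
      exact ⟨r, hrp, hr.2, hd, A, hA.1, hA.2.1⟩
    calc volume U₃ ≤ ∑ i : Fin m, ENNReal.ofReal (V * ((m + 2) / N)) := by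
          refine (measure_biUnion_finset_le _ _).trans (Finset.sum_le_sum fun i _ => ?_)
          refine (measure_biUnion_finset_le _ _).trans ?_
          calc _ ≤ ∑ r ∈ L i, ENNReal.ofReal (V / N) := by
                refine Finset.sum_le_sum fun r hr => ?_
                have hr' := Finset.mem_filter.1 hr
                have hNr : (N : ℝ) ≤ r := by exact_mod_cast hr'.2.le
                refine (measure_biUnion_finset_le _ _).trans ?_
                refine (Finset.sum_le_card_nsmul _ _ (ENNReal.ofReal (V / N)) fun A hA => ?_).trans ?_
                · refine (hcs (hN.trans hr'.2) (Finset.mem_filter.1 hA).1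
                    (Finset.mem_filter.1 hA).2.1).trans (ENNReal.ofReal_le_ofReal ?_)
                  exact div_le_div_of_nonneg_left hV0.le hN0 hNr
                · refine (nsmul_le_nsmul_left zero_le (h4 i r hr)).trans ?_
                  rw [one_nsmul]
            _ ≤ _ := by
                rw [Finset.sum_const, nsmul_eq_mul, ← ENNReal.ofReal_natCast,
                  ← ENNReal.ofReal_mul (by positivity)]
                refine ENNReal.ofReal_le_ofReal ?_
                have hcard : (L i).card ≤ m + 2 := card_large_primeFactors_le
                  (truncDet_ne_zero hT hN he.det_ne_zero _ hp)
                  ((abs_truncDet_le hm hN hNT he.abs_le _ hp).trans_lt (by exact_mod_cast hbig))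
                have hcard' : ((L i).card : ℝ) ≤ m + 2 := by exact_mod_cast hcard
                calc _ ≤ (m + 2) * (V / N) := mul_le_mul_of_nonneg_right hcard' (by positivity)
                  _ = _ := by ring
      _ = _ := by
          rw [Finset.sum_const, nsmul_eq_mul, ← ENNReal.ofReal_natCast,
            ← ENNReal.ofReal_mul (by positivity), Finset.card_univ, Fintype.card_fin]
          congr 1
          ring
  calc _ ≤ volume (U₁ ∪ U₂ ∪ U₃) := measure_mono hcover
    _ ≤ volume U₁ + volume U₂ + volume U₃ := (measure_union_le _ _).trans
        (add_le_add_left (measure_union_le _ _) _)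
    _ ≤ _ := add_le_add (add_le_add h₁ h₂) h₃
    _ = _ := by
        rw [← ENNReal.ofReal_add, ← ENNReal.ofReal_add, ← mul_add, ← mul_add]
        · rfl
        · exact add_nonneg (mul_nonneg hV0.le (Finset.sum_nonneg fun r _ =>
            Finset.sum_nonneg fun i _ => by positivity)) (mul_nonneg hV0.le
              (Finset.sum_nonneg fun i _ => by split_ifs <;> norm_num))
        · positivity
        · exact mul_nonneg hV0.le (Finset.sum_nonneg fun r _ =>
            Finset.sum_nonneg fun i _ => by positivity)
        · exact mul_nonneg hV0.le
              (Finset.sum_nonneg fun i _ => by split_ifs <;> norm_num)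

open Classical in
theorem sum_badWeight_le {m T N : ℕ} (hm : 0 < m) (hN : 0 < N)
    (hNT : 100 * m ^ 2 * N ≤ T) (hbig : (m + 2).factorial * (2 * T) ^ (m + 2) < N ^ (m + 3))
    (hN₁ : 100 * (m + 2) * (100 * 2 ^ (m + 2) + 1) ≤ N) (hN₂ : 200 * m * (m + 2) ≤ N)
    {e : Fin 2 → Fin 2 → ℤ} (he : ∀ s k, |e s k| ≤ T)
    (hne : e 0 0 * e 1 1 - e 0 1 * e 1 0 ≠ 0) :
    ∑ p ∈ boxFamily m T N, badWeight T N e p ≤ 0.95 * (boxFamily m T N).card := by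
  have hm0 : (0 : ℝ) < m := by exact_mod_cast hm
  have hN0 : (0 : ℝ) < N := by exact_mod_cast hN
  set M : ℝ := ((boxFamily m T N).card : ℝ) with hM
  have hM0 : 0 ≤ M := by positivity
  have hfrac : (m : ℝ) * ((m + 2) / N) ≤ 0.005 := by
    rw [← mul_div_assoc, div_le_iff₀ hN0]
    have : (200 * m * (m + 2) : ℝ) ≤ N := by exact_mod_cast hN₂
    linarith
  unfold badWeight
  rw [Finset.sum_add_distrib, Finset.sum_add_distrib]
  have h₁ : ∑ p ∈ boxFamily m T N, ∑ r ∈ (Finset.range (N + 1)).filter Nat.Prime, ∑ i,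
      (((coeffs m r i).filter fun A => IsCong e p r i A).card : ℝ) * (1 / r) ≤ 0.94 * M := by
    rw [Finset.sum_comm]
    calc _ ≤ ∑ r ∈ (Finset.range (N + 1)).filter Nat.Prime,
          ((1 + (r : ℝ) / N) ^ (m + 2) * (1 / ((r : ℝ) * (r - 1)))) * M := by
          refine Finset.sum_le_sum fun r hr => ?_
          have hr2 : (2 : ℝ) ≤ r := by exact_mod_cast (Finset.mem_filter.1 hr).2.two_le
          have hr0 : (0 : ℝ) < r := by linarith
          rw [Finset.sum_comm]
          calc _ ≤ ∑ i : Fin m, (r : ℝ) ^ (i : ℕ) *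
                ((1 + (r : ℝ) / N) ^ (m + 2) * M / r ^ (m + 1)) := by
                refine Finset.sum_le_sum fun i _ => ?_
                rw [← Finset.sum_mul]
                have := sum_card_isCong_le (m := m) (T := T) (N := N) e
                  (Finset.mem_filter.1 hr).2.pos i
                rw [← le_div_iff₀ (by positivity)] at this
                refine (mul_le_mul_of_nonneg_right this (by positivity)).trans_eq ?_
                have e1 : (N : ℝ) / r + 1 = (1 + (r : ℝ) / N) * (N / r) := by
                  field_simp
                rw [e1, mul_pow, div_pow]
                field_simp
                ring
            _ = ((r : ℝ) ^ m - 1) / (r - 1) * ((1 + (r : ℝ) / N) ^ (m + 2) * M / r ^ (m + 1)) := by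
                rw [← Finset.sum_mul, Fin.sum_univ_eq_sum_range (fun i => (r : ℝ) ^ i),
                  geom_sum_eq (by linarith)]
            _ ≤ (r : ℝ) ^ m / (r - 1) * ((1 + (r : ℝ) / N) ^ (m + 2) * M / r ^ (m + 1)) := by
                refine mul_le_mul_of_nonneg_right ?_ (by positivity)
                exact div_le_div_of_nonneg_right (by linarith) (by linarith)
            _ = _ := by
                have : (r : ℝ) - 1 ≠ 0 := by linarith
                field_simp
                ring
      _ ≤ _ := by
          rw [← Finset.sum_mul]
          exact mul_le_mul_of_nonneg_right (sum_primes_weighted_le (by omega) hN₁) hM0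
  have h₂ : ∑ p ∈ boxFamily m T N, (∑ i : Fin m, if ∃ r : ℕ, r.Prime ∧ N < r ∧
      (r : ℤ) ∣ truncDet T N e i p ∧ ∃ A ∈ coeffs m r i, IsCong e p r i A then (1 : ℝ) else 0) ≤
      0.005 * M := by
    rw [Finset.sum_comm]
    calc _ ≤ ∑ _i : Fin m, ((m + 2) / N) * M := by
          refine Finset.sum_le_sum fun i _ => ?_
          rw [Finset.sum_boole, div_mul_eq_mul_div, le_div_iff₀ hN0]
          rw [hM]
          exact_mod_cast card_large_dvd_truncDet_mul_le hm hN hNT hbig he hne i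
      _ = m * ((m + 2) / N) * M := by simp [mul_assoc]
      _ ≤ _ := mul_le_mul_of_nonneg_right hfrac hM0
  have h₃ : ∑ _p ∈ boxFamily m T N, (m * ((m + 2) / N) : ℝ) ≤ 0.005 * M := by
    rw [Finset.sum_const, nsmul_eq_mul, mul_comm]
    exact mul_le_mul_of_nonneg_right hfrac hM0
  linarith

theorem ofReal_le_volume_goodSet {m T N : ℕ} (hm : 0 < m) (hN : 0 < N)
    (hNT : 100 * m ^ 2 * N ≤ T) (hbig : (m + 2).factorial * (2 * T) ^ (m + 2) < N ^ (m + 3))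
    (hN₁ : 100 * (m + 2) * (100 * 2 ^ (m + 2) + 1) ≤ N) (hN₂ : 200 * m * (m + 2) ≤ N)
    {κ : ℝ} (hκ : 0 < κ) (hκ1 : κ ≤ 1 / 9) (hκT : κ * T ^ (m + 2) ≤ 1 / 8) {ξ : Fin 2 → ℝ}
    {e : Fin 2 → Fin 2 → ℤ} {e₃ : Fin 2 → ℤ} (he : IsBasePair T κ ξ e e₃)
    (hlow : ∀ (z : Fin 2 → ℤ) (z₃ : ℤ), z ≠ 0 → (∀ k, |z k| < T) →
      κ / 2 ≤ |∑ k, (z k : ℝ) * ξ k + z₃|) :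
    ENNReal.ofReal (0.05 * ((2 * (κ / (100 * m))) ^ m * (boxFamily m T N).card)) ≤
      volume ((Set.univ.pi fun _ : Fin m => Set.Ioc (0 : ℝ) 1) ∩ goodSet T κ ξ) := by
  have hT : 0 < T := lt_of_lt_of_le (by positivity) hNT
  have hm1 : (1 : ℝ) ≤ m := by exact_mod_cast hm
  have hNT' : N ≤ T := le_trans (Nat.le_mul_of_pos_left _ (by positivity)) hNT
  set ε : ℝ := κ / (100 * m) with hε
  have hε0 : 0 < ε := by positivity
  have hεκ : ε ≤ κ / 100 := div_le_div_of_nonneg_left hκ.le (by norm_num) (by linarith)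
  set V : ℝ := (2 * ε) ^ m with hV
  have hV0 : 0 < V := by positivity
  have hw0 : ∀ p : Fin m → Fin 2 ⊕ Fin m → ℤ, 0 ≤ badWeight T N e p := by
    intro p
    unfold badWeight
    refine add_nonneg (add_nonneg (Finset.sum_nonneg fun r _ =>
      Finset.sum_nonneg fun i _ => by positivity) (Finset.sum_nonneg fun i _ => ?_)) (by positivity)
    split_ifs <;> norm_num
  have hdisj : ∑ p ∈ boxFamily m T N, volume (smallSet ε ξ p ∩ goodSet T κ ξ) ≤
      volume ((Set.univ.pi fun _ : Fin m => Set.Ioc (0 : ℝ) 1) ∩ goodSet T κ ξ) := by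
    rw [← measure_biUnion_finset]
    · refine measure_mono (Set.iUnion₂_subset fun p _ => ?_)
      exact Set.inter_subset_inter_left _ Set.inter_subset_left
    · intro p hp p' hp' hne
      refine Set.disjoint_left.2 fun γ hγ hγ' => hne ?_
      refine eq_of_mem_smallSet_of_mem_goodSet hNT' (by linarith) (fun z z₃ hz hzT => ?_) hp hp'
        hγ.2 hγ.1 hγ'.1
      linarith [hlow z z₃ hz hzT]
    · exact fun p _ => (measurableSet_smallSet ε ξ p).inter (measurableSet_goodSet T κ ξ)
  have htotal : ENNReal.ofReal (V * (boxFamily m T N).card) ≤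
      volume ((Set.univ.pi fun _ : Fin m => Set.Ioc (0 : ℝ) 1) ∩ goodSet T κ ξ) +
        ENNReal.ofReal (V * (0.95 * (boxFamily m T N).card)) := by
    calc ENNReal.ofReal (V * (boxFamily m T N).card) =
          ∑ p ∈ boxFamily m T N, volume (smallSet ε ξ p) := by
          have hvol : ∀ p ∈ boxFamily m T N, volume (smallSet ε ξ p) = ENNReal.ofReal V :=
            fun p hp => volume_simultaneously_small ξ p (det_ne_zero_of_mem_boxFamily hT hp) hε0
              (by linarith)
          rw [Finset.sum_congr rfl hvol, Finset.sum_const, nsmul_eq_mul, mul_comm, ENNReal.ofReal_mul (by positivity), ENNReal.ofReal_natCast]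
      _ ≤ ∑ p ∈ boxFamily m T N, (volume (smallSet ε ξ p ∩ goodSet T κ ξ) +
            volume (smallSet ε ξ p \ goodSet T κ ξ)) :=
          Finset.sum_le_sum fun p _ => measure_le_inter_add_sdiff _ _ _
      _ ≤ _ := by
          rw [Finset.sum_add_distrib]
          refine add_le_add hdisj ?_
          refine (Finset.sum_le_sum fun p hp => volume_smallSet_sdiff_goodSet_le hm hN hNT hbig hp
            hκ hκ1 hκT he).trans ?_
          rw [← ENNReal.ofReal_sum_of_nonneg fun p _ => mul_nonneg hV0.le (hw0 p), ← Finset.mul_sum]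
          exact ENNReal.ofReal_le_ofReal (mul_le_mul_of_nonneg_left
            (sum_badWeight_le hm hN hNT hbig hN₁ hN₂ he.abs_le he.det_ne_zero) hV0.le)
  have hsplit : V * (boxFamily m T N).card =
      0.05 * (V * (boxFamily m T N).card) + V * (0.95 * (boxFamily m T N).card) := by ring
  have hVM : 0 ≤ V * (boxFamily m T N).card := mul_nonneg hV0.le (Nat.cast_nonneg _)
  rw [hsplit, ENNReal.ofReal_add (mul_nonneg (by norm_num) hVM)
    (mul_nonneg hV0.le (mul_nonneg (by norm_num) (Nat.cast_nonneg _)))] at htotal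
  exact (ENNReal.add_le_add_iff_right ENNReal.ofReal_ne_top).1 htotal

theorem exists_ofReal_le_volume_goodSet {m : ℕ} (hm : 0 < m) {c : ℝ} (hc : 0 < c)
    (hc8 : c ≤ 1 / 8) : ∃ ρ : ℝ, 0 < ρ ∧ ∃ T₀ : ℕ, ∀ T : ℕ, T₀ ≤ T → ∀ (ξ : Fin 2 → ℝ)
    (e : Fin 2 → Fin 2 → ℤ) (e₃ : Fin 2 → ℤ), IsBasePair T (c / T ^ (m + 2)) ξ e e₃ →
    (∀ (z : Fin 2 → ℤ) (z₃ : ℤ), z ≠ 0 → (∀ k, |z k| < T) →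
      c / T ^ (m + 2) / 2 ≤ |∑ k, (z k : ℝ) * ξ k + z₃|) →
    ENNReal.ofReal ρ ≤ volume ((Set.univ.pi fun _ : Fin m => Set.Ioc (0 : ℝ) 1) ∩
      goodSet T (c / T ^ (m + 2)) ξ) := by
  have hm1 : (1 : ℝ) ≤ m := by exact_mod_cast hm
  obtain ⟨N₀, hN₀⟩ : ∃ N₀, N₀ = (m + 2).factorial * (400 * m ^ 2) ^ (m + 2) +
    100 * (m + 2) * (100 * 2 ^ (m + 2) + 1) + 200 * m * (m + 2) + 1 := ⟨_, rfl⟩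
  refine ⟨0.05 * ((2 * (c / (100 * m))) ^ m * ((1 / (200 * m ^ 2)) ^ (m + 2)) ^ m), by positivity,
    100 * m ^ 2 * N₀, fun T hT ξ e e₃ he hlow => ?_⟩
  have hm2 : 0 < 100 * m ^ 2 := by positivity
  obtain ⟨N, hN⟩ : ∃ N, N = T / (100 * m ^ 2) := ⟨_, rfl⟩
  have hNN : N₀ ≤ N := by rw [hN, Nat.le_div_iff_mul_le hm2, mul_comm]; exact hT
  have hN0 : 0 < N := by omega
  have hNT : 100 * m ^ 2 * N ≤ T := by rw [hN]; exact Nat.mul_div_le _ _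
  have hTN : T ≤ 200 * m ^ 2 * N := by
    have h1 : T < 100 * m ^ 2 * (N + 1) := by rw [hN]; exact Nat.lt_mul_div_succ _ hm2
    have h2 : 100 * m ^ 2 * 1 ≤ 100 * m ^ 2 * N := Nat.mul_le_mul_left _ hN0
    linarith
  have hT2 : 2 ≤ T := by
    have : 100 * 1 * 1 ≤ 100 * m ^ 2 * N := by
      gcongr
      · exact Nat.one_le_pow _ _ hm
      · exact hN0
    omega
  have hT0 : (0 : ℝ) < T := by exact_mod_cast (by omega : 0 < T)
  have hbig : (m + 2).factorial * (2 * T) ^ (m + 2) < N ^ (m + 3) := by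
    calc _ ≤ (m + 2).factorial * (400 * m ^ 2 * N) ^ (m + 2) := by
          refine Nat.mul_le_mul_left _ (Nat.pow_le_pow_left ?_ _)
          linarith
      _ = (m + 2).factorial * (400 * m ^ 2) ^ (m + 2) * N ^ (m + 2) := by
          rw [mul_pow (400 * m ^ 2) N, mul_assoc]
      _ < N * N ^ (m + 2) := Nat.mul_lt_mul_of_pos_right (by omega) (by positivity)
      _ = _ := by ring
  have hκT : c / (T : ℝ) ^ (m + 2) * (T : ℝ) ^ (m + 2) ≤ 1 / 8 := by
    rw [div_mul_cancel₀ _ (by positivity)]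
    exact hc8
  have hκ1 : c / (T : ℝ) ^ (m + 2) ≤ 1 / 9 := by
    rw [div_le_iff₀ (by positivity)]
    have : (2 : ℝ) ≤ T := by exact_mod_cast hT2
    have h2 : (2 : ℝ) ^ 1 ≤ (T : ℝ) ^ (m + 2) :=
      (pow_le_pow_right₀ one_le_two (by omega)).trans (pow_le_pow_left₀ zero_le_two this _)
    linarith
  refine (ENNReal.ofReal_le_ofReal ?_).trans (ofReal_le_volume_goodSet hm hN0 hNT hbig (by omega)
    (by omega) (by positivity) hκ1 hκT he hlow)
  refine mul_le_mul_of_nonneg_left ?_ (by norm_num)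
  rw [card_boxFamily]
  push_cast
  rw [← mul_pow, ← mul_pow]
  refine pow_le_pow_left₀ (by positivity) ?_ m
  calc _ ≤ 2 * (c / (100 * m)) * (N / T : ℝ) ^ (m + 2) := by
        refine mul_le_mul_of_nonneg_left (pow_le_pow_left₀ (by positivity) ?_ _) (by positivity)
        rw [div_le_div_iff₀ (by positivity) hT0]
        have : (T : ℝ) ≤ 200 * m ^ 2 * N := by exact_mod_cast hTN
        linarith
    _ = _ := by
        rw [div_pow]
        field_simp

theorem psiTwo_le {ξ1 ξ2 t : ℝ} {b1 b2 : ℤ} (b3 : ℤ) (h : b1 ≠ 0 ∨ b2 ≠ 0) (h1 : |(b1 : ℝ)| ≤ t)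
    (h2 : |(b2 : ℝ)| ≤ t) : psiTwo ξ1 ξ2 t ≤ |(b1 : ℝ) * ξ1 + b2 * ξ2 + b3| :=
  csInf_le ⟨0, by rintro _ ⟨_, _, _, _, _, _, rfl⟩; exact abs_nonneg _⟩
    ⟨b1, b2, b3, h, h1, h2, rfl⟩

theorem psiTwo_nonneg (ξ1 ξ2 t : ℝ) : 0 ≤ psiTwo ξ1 ξ2 t :=
  Real.sInf_nonneg (by rintro _ ⟨_, _, _, _, _, _, rfl⟩; exact abs_nonneg _)

theorem exists_psiTwo_eq (ξ1 ξ2 : ℝ) {t : ℝ} (ht : 1 ≤ t) : ∃ b1 b2 b3 : ℤ, (b1 ≠ 0 ∨ b2 ≠ 0) ∧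
    |(b1 : ℝ)| ≤ t ∧ |(b2 : ℝ)| ≤ t ∧ psiTwo ξ1 ξ2 t = |(b1 : ℝ) * ξ1 + b2 * ξ2 + b3| := by
  set S : Set ℝ := { r : ℝ | ∃ b1 b2 b3 : ℤ, (b1 ≠ 0 ∨ b2 ≠ 0) ∧ |(b1 : ℝ)| ≤ t ∧ |(b2 : ℝ)| ≤ t ∧
    r = |(b1 : ℝ) * ξ1 + (b2 : ℝ) * ξ2 + (b3 : ℝ)| } with hS
  have hmem : |ξ1| ∈ S := ⟨1, 0, 0, Or.inl one_ne_zero, by simpa using ht, by simp; linarith, by simp⟩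
  obtain ⟨K, hK⟩ := exists_nat_ge (|ξ1| + t * |ξ1| + t * |ξ2| + t)
  have hfin : (S ∩ Set.Iic |ξ1|).Finite := by
    refine Set.Finite.subset (Set.Finite.image (fun b : ℤ × ℤ × ℤ =>
      |(b.1 : ℝ) * ξ1 + b.2.1 * ξ2 + b.2.2|) (s := Set.Icc (-K : ℤ) K ×ˢ Set.Icc (-K : ℤ) K ×ˢ
        Set.Icc (-K : ℤ) K) (Set.Finite.prod (Set.finite_Icc _ _)
          (Set.Finite.prod (Set.finite_Icc _ _) (Set.finite_Icc _ _)))) ?_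
    rintro _ ⟨⟨b1, b2, b3, h0, h1, h2, rfl⟩, hle⟩
    have hb : ∀ b : ℤ, |(b : ℝ)| ≤ K → b ∈ Set.Icc (-K : ℤ) K := by
      intro b h
      rw [abs_le] at h
      exact ⟨by exact_mod_cast h.1, by exact_mod_cast h.2⟩
    have e1 : |(b1 : ℝ) * ξ1| ≤ t * |ξ1| := by
      rw [abs_mul]; exact mul_le_mul_of_nonneg_right h1 (abs_nonneg _)
    have e2 : |(b2 : ℝ) * ξ2| ≤ t * |ξ2| := by
      rw [abs_mul]; exact mul_le_mul_of_nonneg_right h2 (abs_nonneg _)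
    have n1 := abs_nonneg ((b1 : ℝ) * ξ1)
    have n2 := abs_nonneg ((b2 : ℝ) * ξ2)
    have n3 := abs_nonneg ξ1
    have hle' : |(b1 : ℝ) * ξ1 + b2 * ξ2 + b3| ≤ |ξ1| := hle
    refine ⟨(b1, b2, b3), ⟨hb _ (by linarith), hb _ (by linarith), hb _ ?_⟩, rfl⟩
    have e3 : (b3 : ℝ) = ((b1 : ℝ) * ξ1 + b2 * ξ2 + b3) - ((b1 : ℝ) * ξ1 + b2 * ξ2) := by ring
    have e4 := abs_sub ((b1 : ℝ) * ξ1 + b2 * ξ2 + b3) ((b1 : ℝ) * ξ1 + b2 * ξ2)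
    rw [← e3] at e4
    have e5 := abs_add_le ((b1 : ℝ) * ξ1) (b2 * ξ2)
    linarith
  obtain ⟨r, hr, hmin⟩ := Set.exists_min_image _ id hfin ⟨_, hmem, le_refl |ξ1|⟩
  have hleast : IsLeast S r := by
    refine ⟨hr.1, fun y hy => ?_⟩
    rcases le_total y |ξ1| with h | h
    · exact hmin y ⟨hy, h⟩
    · exact le_trans hr.2 h
  have heq : psiTwo ξ1 ξ2 t = r := hleast.csInf_eq
  obtain ⟨b1, b2, b3, h0, h1, h2, hreq⟩ := hr.1
  exact ⟨b1, b2, b3, h0, h1, h2, heq.trans hreq⟩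

theorem psiTwo_anti (ξ1 ξ2 : ℝ) {s t : ℝ} (hs : 1 ≤ s) (hst : s ≤ t) :
    psiTwo ξ1 ξ2 t ≤ psiTwo ξ1 ξ2 s := by
  obtain ⟨b1, b2, b3, h0, h1, h2, h⟩ := exists_psiTwo_eq ξ1 ξ2 hs
  rw [h]
  exact psiTwo_le b3 h0 (h1.trans hst) (h2.trans hst)

theorem psiTwo_pos {ξ1 ξ2 : ℝ} (hlin : LinearIndependent ℚ ![(1 : ℝ), ξ1, ξ2]) {t : ℝ}
    (ht : 1 ≤ t) : 0 < psiTwo ξ1 ξ2 t := by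
  obtain ⟨b1, b2, b3, h0, h1, h2, h⟩ := exists_psiTwo_eq ξ1 ξ2 ht
  rw [h, abs_pos]
  intro h3
  have := Fintype.linearIndependent_iff.1 hlin ![(b3 : ℚ), b1, b2] (by
    simp [Fin.sum_univ_three, Rat.smul_def]
    linarith)
  have g1 : (b1 : ℚ) = 0 := this 1
  have g2 : (b2 : ℚ) = 0 := this 2
  rcases h0 with h0 | h0
  · exact h0 (by exact_mod_cast g1)
  · exact h0 (by exact_mod_cast g2)

theorem isBoundedUnder_of_limsup_pos {f : ℝ → ℝ} (h : 0 < limsup f atTop) :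
    IsBoundedUnder (· ≤ ·) atTop f := by
  by_contra hb
  have : {a | ∀ᶠ t in atTop, f t ≤ a} = ∅ := by
    rw [Set.eq_empty_iff_forall_notMem]
    exact fun a ha => hb ⟨a, ha⟩
  rw [limsup_eq, this, Real.sInf_empty] at h
  exact lt_irrefl _ h

theorem exists_psiTwo_jump {n : ℕ} (hn : 0 < n) {ξ1 ξ2 c : ℝ} (hc : 0 < c)
    (hlin : LinearIndependent ℚ ![(1 : ℝ), ξ1, ξ2])
    (hlim : limsup (fun t : ℝ => t ^ n * psiTwo ξ1 ξ2 t) atTop = c) {η : ℝ} (hη : 0 < η) (K : ℕ) :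
    ∃ T : ℕ, K ≤ T ∧ (1 - η) * c / T ^ n ≤ psiTwo ξ1 ξ2 (T - 1) ∧
      psiTwo ξ1 ξ2 (T - 1) ≤ 1.01 * (c / T ^ n) ∧ psiTwo ξ1 ξ2 T < psiTwo ξ1 ξ2 (T - 1) := by
  have hbdd : IsBoundedUnder (· ≤ ·) atTop (fun t : ℝ => t ^ n * psiTwo ξ1 ξ2 t) :=
    isBoundedUnder_of_limsup_pos (by rw [hlim]; exact hc)
  have hcobdd : IsCoboundedUnder (· ≤ ·) atTop (fun t : ℝ => t ^ n * psiTwo ξ1 ξ2 t) :=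
    IsBoundedUnder.isCoboundedUnder_le ⟨0, by
      rw [eventually_map]
      filter_upwards [eventually_ge_atTop 0] with t ht
      exact mul_nonneg (pow_nonneg ht n) (psiTwo_nonneg _ _ _)⟩
  have hup : ∀ᶠ t : ℝ in atTop, t ^ n * psiTwo ξ1 ξ2 t < 1.005 * c :=
    eventually_lt_of_limsup_lt (by rw [hlim]; linarith) hbdd
  have hlow : ∃ᶠ t : ℝ in atTop, (1 - η) * c < t ^ n * psiTwo ξ1 ξ2 t :=
    frequently_lt_of_lt_limsup hcobdd (by rw [hlim]; nlinarith)
  obtain ⟨t₀, ht₀⟩ := eventually_atTop.1 hup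
  obtain ⟨t, ht, hflow⟩ := frequently_atTop.1 hlow (max (max (t₀ + 1) K) (max 2 (1000 * n)))
  have hb1 : t₀ + 1 ≤ t := le_trans (le_max_of_le_left (le_max_left _ _)) ht
  have hb2 : (K : ℝ) ≤ t := le_trans (le_max_of_le_left (le_max_right _ _)) ht
  have hb3 : 2 ≤ t := le_trans (le_max_of_le_right (le_max_left _ _)) ht
  have hb4 : 1000 * n ≤ t := le_trans (le_max_of_le_right (le_max_right _ _)) ht
  have hpos : 0 < psiTwo ξ1 ξ2 t := psiTwo_pos hlin (by linarith)
  have hex : ∃ T : ℕ, 1 ≤ T ∧ psiTwo ξ1 ξ2 T < psiTwo ξ1 ξ2 t := by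
    obtain ⟨T, hT⟩ := exists_nat_gt (max t (1.005 * c / psiTwo ξ1 ξ2 t))
    have hT1 : t < T := lt_of_le_of_lt (le_max_left _ _) hT
    have hT2 : 1.005 * c / psiTwo ξ1 ξ2 t < T := lt_of_le_of_lt (le_max_right _ _) hT
    refine ⟨T, by exact_mod_cast (by linarith : (1 : ℝ) ≤ T), ?_⟩
    rw [div_lt_iff₀ hpos] at hT2
    have h1 := ht₀ T (by linarith)
    have h2 : (T : ℝ) ≤ (T : ℝ) ^ n := le_self_pow₀ (by linarith) hn.ne'
    have h3 := mul_le_mul_of_nonneg_right h2 (psiTwo_nonneg ξ1 ξ2 T)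
    by_contra! h4
    have h5 := mul_le_mul_of_nonneg_left h4 (by linarith : (0 : ℝ) ≤ T)
    linarith
  classical
  obtain ⟨T, hTdef⟩ : ∃ T, T = Nat.find hex := ⟨_, rfl⟩
  obtain ⟨hT1, hTlt⟩ : 1 ≤ T ∧ psiTwo ξ1 ξ2 T < psiTwo ξ1 ξ2 t := hTdef ▸ Nat.find_spec hex
  have hmin : ∀ S : ℕ, S < T → 1 ≤ S → psiTwo ξ1 ξ2 t ≤ psiTwo ξ1 ξ2 S := by
    intro S hS hS1
    by_contra! h
    exact Nat.find_min hex (hTdef ▸ hS) ⟨hS1, h⟩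
  have htT : t < T := by
    by_contra! h
    exact absurd (psiTwo_anti ξ1 ξ2 (by exact_mod_cast hT1) h) (not_le.2 hTlt)
  have hT2 : 2 < T := by exact_mod_cast lt_of_le_of_lt hb3 htT
  have hcast : ((T - 1 : ℕ) : ℝ) = T - 1 := by push_cast [hT1]; ring
  have hμ : psiTwo ξ1 ξ2 t ≤ psiTwo ξ1 ξ2 (T - 1) := by
    have := hmin (T - 1) (by omega) (by omega)
    rwa [hcast] at this
  have hT0 : (0 : ℝ) < T := by linarith
  refine ⟨T, by exact_mod_cast hb2.trans htT.le, ?_, ?_, hTlt.trans_le hμ⟩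
  · rw [div_le_iff₀ (by positivity), mul_comm (psiTwo _ _ _)]
    refine hflow.le.trans (mul_le_mul (pow_le_pow_left₀ (by linarith) htT.le n) hμ
      (psiTwo_nonneg _ _ _) (by positivity))
  · have h1 := ht₀ (T - 1) (by linarith)
    rw [← mul_div_assoc, le_div_iff₀ (by positivity)]
    have h2 := one_add_mul_le_pow (a := -(1 / (T : ℝ))) (by
      have : 1 / (T : ℝ) ≤ 1 := by rw [div_le_one hT0]; linarith
      linarith) n
    have h3 : ((T : ℝ) - 1) ^ n = T ^ n * (1 + -(1 / (T : ℝ))) ^ n := by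
      rw [← mul_pow]
      congr 1
      field_simp
      ring
    have h4 : 0.999 ≤ 1 + n * -(1 / (T : ℝ)) := by
      have : n * (1 / (T : ℝ)) ≤ 0.001 := by
        rw [mul_one_div, div_le_iff₀ hT0]
        linarith
      linarith
    have h5 : 0.999 * (psiTwo ξ1 ξ2 (T - 1) * (T : ℝ) ^ n) ≤ ((T : ℝ) - 1) ^ n * psiTwo ξ1 ξ2 (T - 1) := by
      rw [h3]
      have h6 : 0 ≤ psiTwo ξ1 ξ2 (T - 1) * (T : ℝ) ^ n :=
        mul_nonneg (psiTwo_nonneg _ _ _) (by positivity)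
      have := mul_le_mul_of_nonneg_right (h4.trans h2) h6
      linarith
    linarith

theorem psiTwo_le_form {ξ1 ξ2 t : ℝ} {z : Fin 2 → ℤ} (z₃ : ℤ) (hz : z ≠ 0)
    (h : ∀ k, |(z k : ℝ)| ≤ t) :
    psiTwo ξ1 ξ2 t ≤ |∑ k, (z k : ℝ) * ![ξ1, ξ2] k + z₃| := by
  have h0 : z 0 ≠ 0 ∨ z 1 ≠ 0 := by
    by_contra! h0
    exact hz (funext fun k => by fin_cases k; exacts [h0.1, h0.2])
  simpa [Fin.sum_univ_two] using psiTwo_le (ξ1 := ξ1) (ξ2 := ξ2) z₃ h0 (h 0) (h 1)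

theorem exists_psiTwo_eq_form (ξ1 ξ2 : ℝ) {t : ℝ} (ht : 1 ≤ t) : ∃ (z : Fin 2 → ℤ) (z₃ : ℤ),
    z ≠ 0 ∧ (∀ k, |(z k : ℝ)| ≤ t) ∧
    psiTwo ξ1 ξ2 t = |∑ k, (z k : ℝ) * ![ξ1, ξ2] k + z₃| := by
  obtain ⟨b1, b2, b3, h0, h1, h2, h⟩ := exists_psiTwo_eq ξ1 ξ2 ht
  refine ⟨![b1, b2], b3, ?_, ?_, ?_⟩
  · intro hz
    rcases h0 with h0 | h0
    · exact h0 (congrFun hz 0)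
    · exact h0 (congrFun hz 1)
  · intro k
    fin_cases k
    exacts [h1, h2]
  · simpa [Fin.sum_univ_two] using h

theorem isBasePair_of_consecutive {T : ℕ} {μ κ : ℝ} {ξ : Fin 2 → ℝ} (hμ : 0 < μ)
    (hTμ : 2 * T * μ < 1) (hμκ : μ ≤ 1.01 * κ)
    (hmin : ∀ (z : Fin 2 → ℤ) (z₃ : ℤ), z ≠ 0 → (∀ k, |z k| < T) →
      μ ≤ |∑ k, (z k : ℝ) * ξ k + z₃|) {e : Fin 2 → Fin 2 → ℤ} {e₃ : Fin 2 → ℤ}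
    (hu : ∀ k, |e 0 k| < T) (hLu : |∑ k, (e 0 k : ℝ) * ξ k + e₃ 0| = μ)
    (hv : ∀ k, |e 1 k| ≤ T) (hv0 : e 1 ≠ 0) (hLv : |∑ k, (e 1 k : ℝ) * ξ k + e₃ 1| < μ) :
    IsBasePair T κ ξ e e₃ := by
  set Lu : ℝ := ∑ k, (e 0 k : ℝ) * ξ k + e₃ 0 with hLu'
  set Lv : ℝ := ∑ k, (e 1 k : ℝ) * ξ k + e₃ 1 with hLv'
  have hdet : e 0 0 * e 1 1 - e 0 1 * e 1 0 ≠ 0 := by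
    intro hdet
    obtain ⟨k, hk⟩ : ∃ k, |e 1 k| = T := by
      by_contra! h
      exact absurd (hmin (e 1) (e₃ 1) hv0 fun k => lt_of_le_of_ne (hv k) (h k)) (not_le.2 hLv)
    have hcross : (e 1 k : ℝ) * Lu - e 0 k * Lv = (e 1 k * e₃ 0 - e 0 k * e₃ 1 : ℤ) := by
      have hdet' : (e 0 0 * e 1 1 - e 0 1 * e 1 0 : ℝ) = 0 := by exact_mod_cast hdet
      rw [hLu', hLv', Fin.sum_univ_two, Fin.sum_univ_two]
      push_cast
      fin_cases k
      · simp only [Fin.zero_eta]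
        linear_combination -ξ 1 * hdet'
      · simp only [Fin.mk_one]
        linear_combination ξ 0 * hdet'
    have hkT : |(e 1 k : ℝ)| = T := by exact_mod_cast hk
    have huT : |(e 0 k : ℝ)| < T := by exact_mod_cast hu k
    have hlt : |((e 1 k * e₃ 0 - e 0 k * e₃ 1 : ℤ) : ℝ)| < 1 := by
      rw [← hcross]
      refine (abs_sub _ _).trans_lt ?_
      rw [abs_mul, abs_mul, hLu, hkT]
      have := mul_le_mul huT.le hLv.le (abs_nonneg _) (by positivity)
      linarith
    have hzero : (e 1 k * e₃ 0 - e 0 k * e₃ 1 : ℤ) = 0 := by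
      rw [← Int.abs_lt_one_iff]
      exact_mod_cast hlt
    rw [hzero, Int.cast_zero, sub_eq_zero] at hcross
    have habs := congrArg abs hcross
    rw [abs_mul, abs_mul, hLu, hkT] at habs
    have h1 : |(e 0 k : ℝ)| * |Lv| ≤ |(e 0 k : ℝ)| * μ :=
      mul_le_mul_of_nonneg_left hLv.le (abs_nonneg _)
    have h2 : |(e 0 k : ℝ)| * μ < T * μ := mul_lt_mul_of_pos_right huT hμ
    linarith
  refine ⟨fun s k => ?_, hdet, fun r hr d hd hd₃ => ?_, fun s => ?_⟩
  · fin_cases s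
    exacts [(hu k).le, hv k]
  · simp only [Fin.sum_univ_two] at hd hd₃
    have hr0 : (0 : ℤ) < r := by exact_mod_cast hr.pos
    have hr0' : (0 : ℝ) < r := by exact_mod_cast hr.pos
    obtain ⟨a, ha, har⟩ : ∃ a : ℤ, (r : ℤ) ∣ d 0 - a ∧ 2 * |a| ≤ r :=
      ⟨Int.bmod (d 0) r, Int.dvd_self_sub_bmod, by
        have h1 := Int.bmod_le (x := d 0) hr.pos
        have h2 := Int.le_bmod (x := d 0) hr.pos
        have : |Int.bmod (d 0) r| ≤ r / 2 := abs_le.2 ⟨by omega, by omega⟩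
        omega⟩
    obtain ⟨b, hb, hbr⟩ : ∃ a : ℤ, (r : ℤ) ∣ d 1 - a ∧ 2 * |a| ≤ r :=
      ⟨Int.bmod (d 1) r, Int.dvd_self_sub_bmod, by
        have h1 := Int.bmod_le (x := d 1) hr.pos
        have h2 := Int.le_bmod (x := d 1) hr.pos
        have : |Int.bmod (d 1) r| ≤ r / 2 := abs_le.2 ⟨by omega, by omega⟩
        omega⟩
    have hz : ∀ k, ∃ z, a * e 0 k + b * e 1 k = r * z := by
      intro k
      have h1 := Int.dvd_sub (hd k) (Int.dvd_add (Dvd.dvd.mul_right ha (e 0 k))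
        (Dvd.dvd.mul_right hb (e 1 k)))
      have h2 : d 0 * e 0 k + d 1 * e 1 k - ((d 0 - a) * e 0 k + (d 1 - b) * e 1 k) =
        a * e 0 k + b * e 1 k := by ring
      rw [h2] at h1
      exact h1
    have hz₃ : ∃ z, a * e₃ 0 + b * e₃ 1 = r * z := by
      have h1 := Int.dvd_sub hd₃ (Int.dvd_add (Dvd.dvd.mul_right ha (e₃ 0))
        (Dvd.dvd.mul_right hb (e₃ 1)))
      have h2 : d 0 * e₃ 0 + d 1 * e₃ 1 - ((d 0 - a) * e₃ 0 + (d 1 - b) * e₃ 1) =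
        a * e₃ 0 + b * e₃ 1 := by ring
      rw [h2] at h1
      exact h1
    choose z hz using hz
    obtain ⟨z₃, hz₃⟩ := hz₃
    have hzT : ∀ k, |z k| < T := by
      intro k
      have h1 : r * |z k| ≤ |a| * |e 0 k| + |b| * |e 1 k| := by
        rw [← abs_mul a, ← abs_mul b, ← abs_of_pos hr0, ← abs_mul, ← hz k]
        exact abs_add_le _ _
      have h2 : |a| * |e 0 k| ≤ |a| * (T - 1) :=
        mul_le_mul_of_nonneg_left (by have := hu k; omega) (abs_nonneg _)
      have h3 : |b| * |e 1 k| ≤ |b| * T := mul_le_mul_of_nonneg_left (hv k) (abs_nonneg _)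
      have h4 : 0 < (T : ℤ) := (abs_nonneg _).trans_lt (hu k)
      have h5 : 2 * (r * |z k|) < 2 * (r * T) := by nlinarith
      nlinarith
    have hLz : |∑ k, (z k : ℝ) * ξ k + z₃| < μ := by
      have h1 : r * (∑ k, (z k : ℝ) * ξ k + z₃) = a * Lu + b * Lv := by
        have hz0 : (a * e 0 0 + b * e 1 0 : ℝ) = r * z 0 := by exact_mod_cast hz 0
        have hz1 : (a * e 0 1 + b * e 1 1 : ℝ) = r * z 1 := by exact_mod_cast hz 1
        have hz3 : (a * e₃ 0 + b * e₃ 1 : ℝ) = r * z₃ := by exact_mod_cast hz₃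
        rw [hLu', hLv', Fin.sum_univ_two, Fin.sum_univ_two, Fin.sum_univ_two]
        linear_combination -ξ 0 * hz0 - ξ 1 * hz1 - hz3
      have h2 : r * |∑ k, (z k : ℝ) * ξ k + z₃| ≤ |(a : ℝ)| * μ + |(b : ℝ)| * |Lv| := by
        rw [← hLu, ← abs_mul, ← abs_mul, ← abs_of_pos hr0', ← abs_mul, h1]
        exact abs_add_le _ _
      have ha2 : 2 * |(a : ℝ)| ≤ r := by exact_mod_cast har
      have hb2 : 2 * |(b : ℝ)| ≤ r := by exact_mod_cast hbr
      have h3 : |(b : ℝ)| * |Lv| ≤ r / 2 * |Lv| :=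
        mul_le_mul_of_nonneg_right (by linarith) (abs_nonneg _)
      have h4 : r / 2 * |Lv| < r / 2 * μ := mul_lt_mul_of_pos_left hLv (by linarith)
      have h5 : |(a : ℝ)| * μ ≤ r / 2 * μ := mul_le_mul_of_nonneg_right (by linarith) hμ.le
      exact lt_of_mul_lt_mul_left (by linarith : r * |∑ k, (z k : ℝ) * ξ k + z₃| < r * μ) hr0'.le
    have hz0 : z = 0 := by
      by_contra h
      exact absurd (hmin z z₃ h hzT) (not_le.2 hLz)
    have e0 := hz 0
    have e1 := hz 1
    simp only [hz0, Pi.zero_apply, mul_zero] at e0 e1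
    have ha0 : a = 0 := by
      refine (mul_eq_zero.1 ?_).resolve_right hdet
      linear_combination e 1 1 * e0 - e 1 0 * e1
    have hb0 : b = 0 := by
      refine (mul_eq_zero.1 ?_).resolve_right hdet
      linear_combination e 0 0 * e1 - e 0 1 * e0
    rw [ha0, sub_zero] at ha
    rw [hb0, sub_zero] at hb
    intro s
    fin_cases s
    exacts [ha, hb]
  · fin_cases s
    · exact hLu.le.trans hμκ
    · exact hLv.le.trans hμκ

theorem exists_isBasePair {n : ℕ} (hn : 0 < n) {ξ1 ξ2 c : ℝ} (hc : 0 < c) (hc8 : c ≤ 1 / 8)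
    (hlin : LinearIndependent ℚ ![(1 : ℝ), ξ1, ξ2])
    (hlim : limsup (fun t : ℝ => t ^ n * psiTwo ξ1 ξ2 t) atTop = c) {η : ℝ} (hη : 0 < η) (K : ℕ) :
    ∃ T : ℕ, K ≤ T ∧ ∃ e e₃, IsBasePair T (c / T ^ n) ![ξ1, ξ2] e e₃ ∧
      ∀ (z : Fin 2 → ℤ) (z₃ : ℤ), z ≠ 0 → (∀ k, |z k| < T) →
        (1 - η) * c / T ^ n ≤ |∑ k, (z k : ℝ) * ![ξ1, ξ2] k + z₃| := by
  obtain ⟨T, hKT, hlow, hup, hjump⟩ := exists_psiTwo_jump hn hc hlin hlim hη (max K 2)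
  have hT2 : (2 : ℝ) ≤ T := by exact_mod_cast (le_max_right _ _).trans hKT
  obtain ⟨u, u₃, hu0, hu, hLu⟩ := exists_psiTwo_eq_form ξ1 ξ2 (t := (T : ℝ) - 1) (by linarith)
  obtain ⟨v, v₃, hv0, hv, hLv⟩ := exists_psiTwo_eq_form ξ1 ξ2 (t := (T : ℝ)) (by linarith)
  have hmin : ∀ (z : Fin 2 → ℤ) (z₃ : ℤ), z ≠ 0 → (∀ k, |z k| < T) →
      psiTwo ξ1 ξ2 (T - 1) ≤ |∑ k, (z k : ℝ) * ![ξ1, ξ2] k + z₃| := by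
    intro z z₃ hz hzT
    refine psiTwo_le_form z₃ hz fun k => ?_
    have : |z k| ≤ T - 1 := by have := hzT k; omega
    exact_mod_cast this
  refine ⟨T, (le_max_left _ _).trans hKT, ![u, v], ![u₃, v₃], ?_, fun z z₃ hz hzT =>
    hlow.trans (hmin z z₃ hz hzT)⟩
  refine isBasePair_of_consecutive (psiTwo_pos hlin (by linarith)) ?_ hup hmin (fun k => ?_)
    hLu.symm (fun k => ?_) hv0 (hLv.symm.trans_lt hjump)
  · have h1 : (T : ℝ) ≤ (T : ℝ) ^ n := le_self_pow₀ (by linarith) hn.ne'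
    rw [← mul_div_assoc, le_div_iff₀ (by positivity)] at hup
    have := mul_le_mul_of_nonneg_left h1 (psiTwo_nonneg ξ1 ξ2 (T - 1))
    linarith
  · have h : (|u k| : ℤ) ≤ T - 1 := by exact_mod_cast hu k
    change |u k| < _
    omega
  · change |v k| ≤ _
    exact_mod_cast hv k

theorem sum_mul_extendVec {m : ℕ} (ξ1 ξ2 : ℝ) (γ : Fin m → ℝ) (b : Fin (m + 2) → ℤ) :
    ∑ i, (b i : ℝ) * extendVec (m + 2) ξ1 ξ2 γ i =
      b 0 * ξ1 + (b 1 * ξ2 + ∑ j : Fin m, (b j.succ.succ : ℝ) * γ j) := by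
  rw [Fin.sum_univ_succ, Fin.sum_univ_succ]
  simp [extendVec]

theorem psiDual_nonneg (n : ℕ) (ζ : Fin n → ℝ) (t : ℝ) : 0 ≤ psiDual n ζ t :=
  Real.sInf_nonneg (by rintro _ ⟨_, _, _, _, rfl⟩; exact abs_nonneg _)

theorem psiDual_extendVec_le_psiTwo {m : ℕ} (ξ1 ξ2 : ℝ) (γ : Fin m → ℝ) {t : ℝ} (ht : 1 ≤ t) :
    psiDual (m + 2) (extendVec (m + 2) ξ1 ξ2 γ) t ≤ psiTwo ξ1 ξ2 t := by
  obtain ⟨b1, b2, b3, h0, h1, h2, h⟩ := exists_psiTwo_eq ξ1 ξ2 ht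
  rw [h]
  refine csInf_le ⟨0, by rintro _ ⟨_, _, _, _, rfl⟩; exact abs_nonneg _⟩
    ⟨Fin.cons b1 (Fin.cons b2 0), b3, ?_, ?_, ?_⟩
  · rcases h0 with h0 | h0
    · exact ⟨0, h0⟩
    · exact ⟨1, h0⟩
  · intro i
    refine Fin.cases h1 (fun i => Fin.cases h2 (fun i => ?_) i) i
    simp
    linarith
  · rw [sum_mul_extendVec]
    have e1 : (Fin.cons b1 (Fin.cons b2 0) : Fin (m + 2) → ℤ) 1 = b2 := rfl
    simp [e1]

theorem le_psiDual_extendVec {m T : ℕ} (hT : 2 ≤ T) {ξ1 ξ2 κ μ : ℝ} (hμ : μ ≤ κ)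
    (hmin : ∀ (z : Fin 2 → ℤ) (z₃ : ℤ), z ≠ 0 → (∀ k, |z k| < T) →
      μ ≤ |∑ k, (z k : ℝ) * ![ξ1, ξ2] k + z₃|) {γ : Fin m → ℝ}
    (hγ : γ ∈ goodSet T κ ![ξ1, ξ2]) :
    μ ≤ psiDual (m + 2) (extendVec (m + 2) ξ1 ξ2 γ) (T - 1) := by
  have hT' : (2 : ℝ) ≤ T := by exact_mod_cast hT
  refine le_csInf ⟨_, Pi.single 0 1, 0, ⟨0, by simp⟩, fun i => ?_, rfl⟩ ?_
  · by_cases h : i = 0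
    · subst h; simp; linarith
    · simp [h]; linarith
  rintro _ ⟨b, b', ⟨i₀, hi₀⟩, hb, rfl⟩
  have hb' : ∀ i, |b i| < T := by
    intro i
    have : |b i| ≤ T - 1 := by exact_mod_cast hb i
    omega
  rw [sum_mul_extendVec]
  by_cases hj : ∃ j : Fin m, b j.succ.succ ≠ 0
  · have := hγ (Sum.elim ![b 0, b 1] fun j => b j.succ.succ) b' hj (by
      rintro (k | k)
      · fin_cases k
        exacts [hb' 0, hb' 1]
      · exact hb' _)
    rw [linForm_apply] at this
    simp only [Sum.elim_inr, Sum.elim_inl, Fin.sum_univ_two, Matrix.cons_val_zero,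
      Matrix.cons_val_one] at this
    refine (hμ.trans this).trans_eq ?_
    congr 1
    ring
  · push Not at hj
    have h0 : b 0 ≠ 0 ∨ b 1 ≠ 0 := by
      by_contra! h
      refine hi₀ ?_
      revert i₀
      intro i
      exact fun _ => Fin.cases h.1 (fun i => Fin.cases h.2 hj i) i
    have := hmin ![b 0, b 1] b' (by
      intro hz
      rcases h0 with h0 | h0
      · exact h0 (congrFun hz 0)
      · exact h0 (congrFun hz 1)) (fun k => by fin_cases k; exacts [hb' 0, hb' 1])
    simpa [hj, Fin.sum_univ_two] using this

theorem le_one_eighth_of_lt {n : ℕ} (hn : 4 ≤ n) {c : ℝ}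
    (hcn : c < ((n : ℝ) - 3) / (8 * ((n : ℝ) - 2) ^ ((3 : ℝ) / 2)) * Real.sqrt Real.pi *
      (Real.Gamma ((n : ℝ) - 1 / 2) / Real.Gamma (n : ℝ))) : c ≤ 1 / 8 := by
  have hn' : (4 : ℝ) ≤ n := by exact_mod_cast hn
  have hΓ : Real.Gamma ((n : ℝ) - 1 / 2) / Real.Gamma (n : ℝ) ≤ 1 := by
    rw [div_le_one (Real.Gamma_pos_of_pos (by linarith))]
    exact Real.Gamma_strictMonoOn_Ici.monotoneOn (Set.mem_Ici.2 (by linarith))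
      (Set.mem_Ici.2 (by linarith)) (by linarith)
  have hπ : Real.sqrt Real.pi ≤ 2 := by
    rw [Real.sqrt_le_left (by norm_num)]
    linarith [Real.pi_le_four]
  have hpow : ((n : ℝ) - 2) ^ ((3 : ℝ) / 2) = Real.sqrt ((n : ℝ) - 2) ^ 3 := by
    rw [Real.sqrt_eq_rpow, ← Real.rpow_natCast, ← Real.rpow_mul (by linarith)]
    norm_num
  have hs := Real.sq_sqrt (show 0 ≤ (n : ℝ) - 2 by linarith)
  have hs0 : 0 < Real.sqrt ((n : ℝ) - 2) := Real.sqrt_pos.2 (by linarith)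
  have hfrac : ((n : ℝ) - 3) / (8 * ((n : ℝ) - 2) ^ ((3 : ℝ) / 2)) ≤ 1 / 16 := by
    rw [hpow, div_le_iff₀ (by positivity)]
    nlinarith [mul_nonneg (sq_nonneg (Real.sqrt ((n : ℝ) - 2) - 4 / 3))
      (by linarith : 0 ≤ Real.sqrt ((n : ℝ) - 2) + 2 / 3)]
  have hΓ0 : 0 ≤ Real.Gamma ((n : ℝ) - 1 / 2) / Real.Gamma (n : ℝ) :=
    div_nonneg (Real.Gamma_pos_of_pos (by linarith)).le (Real.Gamma_pos_of_pos (by linarith)).le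
  have h1 := mul_le_mul hfrac hπ (Real.sqrt_nonneg _) (by norm_num)
  have h2 := mul_le_mul h1 hΓ hΓ0 (by norm_num)
  linarith

theorem ofReal_le_measure_frequently {α : Type*} [MeasurableSpace α] {μ : Measure α} {C : Set α}
    (hC : MeasurableSet C) (hμC : μ C ≠ ⊤) {G : ℕ → Set α} (hG : ∀ k, MeasurableSet (G k))
    {ρ : ENNReal} (h : ∀ k, ρ ≤ μ (C ∩ G k)) : ρ ≤ μ {x | ∃ᶠ k in atTop, x ∈ G k} := by
  let B : ℕ → Set α := fun K => ⋃ k ≥ K, C ∩ G k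
  have hB : Antitone B := fun K K' hK =>
    Set.biUnion_subset_biUnion_left fun k hk => le_trans hK hk
  have hBm : ∀ K, MeasurableSet (B K) := fun K =>
    MeasurableSet.biUnion (Set.to_countable _) fun k _ => hC.inter (hG k)
  have hBC : μ (B 0) ≠ ⊤ := ne_top_of_le_ne_top hμC (measure_mono
    (Set.iUnion₂_subset fun _ _ => Set.inter_subset_left))
  have htend := tendsto_measure_iInter_atTop (fun K => (hBm K).nullMeasurableSet) hB ⟨0, hBC⟩
  refine (ge_of_tendsto' htend fun K => (h K).trans (measure_mono ?_)).trans (measure_mono ?_)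
  · exact Set.subset_iUnion₂_of_subset K le_rfl subset_rfl
  · intro x hx
    refine frequently_atTop.2 fun K => ?_
    obtain ⟨k, hk, hxk⟩ := Set.mem_iUnion₂.1 (Set.mem_iInter.1 hx K)
    exact ⟨k, hk, hxk.2⟩

theorem limsup_psiDual_eq {m : ℕ} {ξ1 ξ2 c : ℝ} (hc : 0 < c)
    (hlim : limsup (fun t : ℝ => t ^ (m + 2) * psiTwo ξ1 ξ2 t) atTop = c) {T : ℕ → ℕ}
    (hT : ∀ k, k + 2 ≤ T k)
    (hmin : ∀ k, ∀ (z : Fin 2 → ℤ) (z₃ : ℤ), z ≠ 0 → (∀ l, |z l| < T k) →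
      (1 - 1 / (k + 2)) * c / T k ^ (m + 2) ≤ |∑ l, (z l : ℝ) * ![ξ1, ξ2] l + z₃|)
    {γ : Fin m → ℝ} (hγ : ∃ᶠ k in atTop, γ ∈ goodSet (T k) (c / T k ^ (m + 2)) ![ξ1, ξ2]) :
    limsup (fun t : ℝ => t ^ (m + 2) * psiDual (m + 2) (extendVec (m + 2) ξ1 ξ2 γ) t) atTop = c := by
  have hbdd : IsBoundedUnder (· ≤ ·) atTop (fun t : ℝ => t ^ (m + 2) * psiTwo ξ1 ξ2 t) :=
    isBoundedUnder_of_limsup_pos (by rw [hlim]; exact hc)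
  have hle : (fun t : ℝ => t ^ (m + 2) * psiDual (m + 2) (extendVec (m + 2) ξ1 ξ2 γ) t) ≤ᶠ[atTop]
      fun t : ℝ => t ^ (m + 2) * psiTwo ξ1 ξ2 t := by
    filter_upwards [eventually_ge_atTop 1] with t ht
    exact mul_le_mul_of_nonneg_left (psiDual_extendVec_le_psiTwo ξ1 ξ2 γ ht) (by positivity)
  have hcobdd : IsCoboundedUnder (· ≤ ·) atTop
      (fun t : ℝ => t ^ (m + 2) * psiDual (m + 2) (extendVec (m + 2) ξ1 ξ2 γ) t) :=
    IsBoundedUnder.isCoboundedUnder_le ⟨0, by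
      rw [eventually_map]
      filter_upwards [eventually_ge_atTop 0] with t ht
      exact mul_nonneg (pow_nonneg ht _) (psiDual_nonneg _ _ _)⟩
  refine le_antisymm ((limsup_le_limsup hle hcobdd hbdd).trans_eq hlim) ?_
  have hTt : Tendsto (fun k => (T k : ℝ)) atTop atTop :=
    tendsto_natCast_atTop_atTop.comp (tendsto_atTop_mono (fun k => by have := hT k; simp only [id]; omega) tendsto_id)
  have hTt1 : Tendsto (fun k => (T k : ℝ) - 1) atTop atTop :=
    tendsto_atTop_add_const_right _ (-1) hTt
  have hval : Tendsto (fun k : ℕ => (1 - 1 / (T k : ℝ)) ^ (m + 2) * ((1 - 1 / ((k : ℝ) + 2)) * c))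
      atTop (nhds c) := by
    have h1 : Tendsto (fun k : ℕ => 1 / (T k : ℝ)) atTop (nhds 0) :=
      tendsto_const_nhds.div_atTop hTt
    have h2 : Tendsto (fun k : ℕ => 1 / ((k : ℝ) + 2)) atTop (nhds 0) :=
      tendsto_const_nhds.div_atTop
        (tendsto_atTop_add_const_right _ _ tendsto_natCast_atTop_atTop)
    have h3 := ((h1.const_sub 1).pow (m + 2)).mul ((h2.const_sub 1).mul_const c)
    simpa using h3
  refine le_of_forall_lt fun a ha => ?_
  obtain ⟨a', haa', ha'⟩ := exists_between ha
  refine haa'.trans_le (le_limsup_of_frequently_le ?_ (hbdd.mono_le hle))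
  refine hTt1.frequently ((hγ.and_eventually (hval.eventually_const_lt ha')).mono ?_)
  rintro k ⟨hk, hka⟩
  refine hka.le.trans ?_
  have hT2 : 2 ≤ T k := by have := hT k; omega
  have hT0 : (0 : ℝ) < T k := by exact_mod_cast (by omega : 0 < T k)
  have hk2 : (0 : ℝ) < 1 / ((k : ℝ) + 2) := by positivity
  have hμ := le_psiDual_extendVec hT2 (κ := c / T k ^ (m + 2))
    (div_le_div_of_nonneg_right (by nlinarith) (by positivity)) (hmin k) hk
  have h1 : (1 : ℝ) ≤ T k := by exact_mod_cast (by omega : 1 ≤ T k)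
  refine le_trans (le_of_eq ?_)
    (mul_le_mul_of_nonneg_left hμ (pow_nonneg (by linarith : (0 : ℝ) ≤ T k - 1) (m + 2)))
  rw [one_sub_div hT0.ne', div_pow]
  field_simp

/-- for `n ≥ 4` there is `ε₀ > 0` such that for any
`c ∈ (0, c(n))` with `c(n) = ((n−3)/(8(n−2)^{3/2}))·√π·Γ(n−1/2)/Γ(n)` and any
`ξ = (ξ₁,ξ₂)` as in Theorem 5.1 (with `0 < ξ₁,ξ₂ < ε₀`), the set `𝒴 ⊆ ℝ^{n−2}` of
vectors `(ζ₃,…,ζ_n)` for which `ζ = (ξ₁,ξ₂,ζ₃,…,ζ_n)` satisfies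
`limsup tⁿψ_ζ(t) = c` (i.e. `ζ ∈ DI_n(c)`) has positive Lebesgue measure. -/
theorem positive_measure_exact_extension (n : ℕ) (hn : 4 ≤ n)
    (c : ℝ) (hc0 : 0 < c)
    (hcn : c < ((n : ℝ) - 3) / (8 * ((n : ℝ) - 2) ^ ((3 : ℝ) / 2)) * Real.sqrt Real.pi *
      (Real.Gamma ((n : ℝ) - 1 / 2) / Real.Gamma (n : ℝ))) :
    ∃ ε0 : ℝ, 0 < ε0 ∧
      ∀ ξ1 ξ2 : ℝ, 0 < ξ1 → ξ1 < ε0 → 0 < ξ2 → ξ2 < ε0 →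
        LinearIndependent ℚ ![(1 : ℝ), ξ1, ξ2] →
        limsup (fun t : ℝ => t ^ n * psiTwo ξ1 ξ2 t) atTop = c →
        liminf (fun t : ℝ => t ^ n * psiTwo ξ1 ξ2 t) atTop = 0 →
        0 < volume {γ : Fin (n - 2) → ℝ |
          limsup (fun t : ℝ => t ^ n * psiDual n (extendVec n ξ1 ξ2 γ) t) atTop = c} := by
  obtain ⟨m, rfl⟩ : ∃ m, n = m + 2 := ⟨n - 2, by omega⟩
  have hc8 : c ≤ 1 / 8 := le_one_eighth_of_lt hn hcn
  refine ⟨1, one_pos, fun ξ1 ξ2 _ _ _ _ hlin hlim _ => ?_⟩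
  obtain ⟨ρ, hρ, T₀, hgood⟩ := exists_ofReal_le_volume_goodSet (m := m) (by omega) hc0 hc8
  choose T hT e e₃ hbase hmin using fun k : ℕ => exists_isBasePair (n := m + 2) (by omega) hc0 hc8
    hlin hlim (η := 1 / ((k : ℝ) + 2)) (by positivity) (k + 2 + T₀)
  have hvol : ∀ k, ENNReal.ofReal ρ ≤ volume ((Set.univ.pi fun _ : Fin m => Set.Ioc (0 : ℝ) 1) ∩
      goodSet (T k) (c / T k ^ (m + 2)) ![ξ1, ξ2]) := by
    intro k
    refine hgood (T k) (by have := hT k; omega) _ _ _ (hbase k) fun z z₃ hz hzT =>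
      le_trans ?_ (hmin k z z₃ hz hzT)
    have hk : 1 / ((k : ℝ) + 2) ≤ 1 / 2 := one_div_le_one_div_of_le (by norm_num) (by simp)
    rw [div_right_comm]
    exact div_le_div_of_nonneg_right (by nlinarith) (by positivity)
  refine (ENNReal.ofReal_pos.2 hρ).trans_le ((ofReal_le_measure_frequently
    (MeasurableSet.univ_pi fun _ => measurableSet_Ioc) ?_
    (fun k => measurableSet_goodSet (T k) (c / T k ^ (m + 2)) ![ξ1, ξ2]) hvol).trans
    (measure_mono fun γ hγ => limsup_psiDual_eq hc0 hlim (fun k => by have := hT k; omega) hmin hγ))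
  simp [Real.volume_pi_Ioc]
end
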